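/- Suppose m, n are natural numbers with m ≤ 3 and n ≤ 3, and x_1, …, x_m, y_1, …, y_n are positive real numbers such that P_Λ(t) · ∏_{j=1}^n (1 − y_j t) = ∏_{i=1}^m (1 + x_i t) as formal power series over ℝ. Then there exist ε_1, ε_2, δ_1, δ_2 ∈ {0, 1} and integers a, b ≥ 2 such that P_Λ(t) · (1 − t)^{δ_1} (1 − b t + t²)^{δ_2} = (1 + t)^{ε_1} (1 + a t + t²)^{ε_2} as formal power series over ℝ (the quadratic factors being absent, and the corresponding integer unconstrained, when the corresponding exponent is 0). -/

import Mathlib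

open TensorProduct Polynomial

noncomputable section

/-- The linear map `V ⊗ V → T(V)` sending `v ⊗ w` to `ι v * ι w`. -/
def mulTwo (K : Type) [Field K] (V : Type) [AddCommGroup V] [Module K V] :
    V ⊗[K] V →ₗ[K] TensorAlgebra K V :=
  TensorProduct.lift
    ((LinearMap.mul K (TensorAlgebra K V)).compl₁₂ (TensorAlgebra.ι K) (TensorAlgebra.ι K))

/-- `R : V ⊗ V → V ⊗ V` is a Hecke symmetry with parameter `q`:
it is invertible, satisfies the braid relation, the Hecke relation
`(R + 1)(R - q) = 0`, and its half adjoint `R♯ : V* ⊗ V → V ⊗ V*`,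
characterized by `⟨R♯(ξ ⊗ v), w⟩ = ⟨ξ, R(v ⊗ w)⟩`, is invertible. -/
def IsHeckeSymmetry (K : Type) [Field K] (V : Type) [AddCommGroup V] [Module K V]
    (q : K) (R : V ⊗[K] V →ₗ[K] V ⊗[K] V) : Prop :=
  Function.Bijective R ∧
  (TensorProduct.map R LinearMap.id ∘ₗ
      ((TensorProduct.assoc K V V V).symm.toLinearMap ∘ₗ
        TensorProduct.map LinearMap.id R ∘ₗ (TensorProduct.assoc K V V V).toLinearMap) ∘ₗ
      TensorProduct.map R LinearMap.id =
    ((TensorProduct.assoc K V V V).symm.toLinearMap ∘ₗ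
        TensorProduct.map LinearMap.id R ∘ₗ (TensorProduct.assoc K V V V).toLinearMap) ∘ₗ
      TensorProduct.map R LinearMap.id ∘ₗ
      ((TensorProduct.assoc K V V V).symm.toLinearMap ∘ₗ
        TensorProduct.map LinearMap.id R ∘ₗ (TensorProduct.assoc K V V V).toLinearMap)) ∧
  ((R + LinearMap.id) ∘ₗ (R - q • LinearMap.id) = 0) ∧
  (∃ Rs : Module.Dual K V ⊗[K] V →ₗ[K] V ⊗[K] Module.Dual K V,
    Function.Bijective Rs ∧
    ∀ (ξ : Module.Dual K V) (v w : V),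
      dualTensorHom K V V ((TensorProduct.comm K V (Module.Dual K V)) (Rs (ξ ⊗ₜ[K] v))) w =
        TensorProduct.lid K V (TensorProduct.map ξ LinearMap.id (R (v ⊗ₜ[K] w))))

/-- The relation on `T(V)` whose closure cuts out the exterior algebra `Λ` of `R`:
all elements of the image of `R + 1` in degree two are set to zero. -/
def lambdaRel (K : Type) [Field K] (V : Type) [AddCommGroup V] [Module K V]
    (R : V ⊗[K] V →ₗ[K] V ⊗[K] V) :
    TensorAlgebra K V → TensorAlgebra K V → Prop :=
  fun a b => b = 0 ∧ ∃ u : V ⊗[K] V, a = mulTwo K V ((R + (LinearMap.id : V ⊗[K] V →ₗ[K] V ⊗[K] V)) u)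

/-- The `l`-th homogeneous component of the exterior algebra `Λ = T(V)/(im(R+1))`,
as the image of the `l`-th graded piece of the tensor algebra. -/
def lambdaGrade (K : Type) [Field K] (V : Type) [AddCommGroup V] [Module K V]
    (R : V ⊗[K] V →ₗ[K] V ⊗[K] V) (l : ℕ) :
    Submodule K (RingQuot (lambdaRel K V R)) :=
  Submodule.map (RingQuot.mkAlgHom K (lambdaRel K V R)).toLinearMap
    (LinearMap.range (TensorAlgebra.ι K : V →ₗ[K] TensorAlgebra K V) ^ l)

/-- The Poincaré series `P_Λ(t) = ∑ (dim Λ_l) t^l` of the exterior algebra,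
as a formal power series over `ℝ`. -/
def poincareLambda (K : Type) [Field K] (V : Type) [AddCommGroup V] [Module K V]
    (R : V ⊗[K] V →ₗ[K] V ⊗[K] V) : PowerSeries ℝ :=
  PowerSeries.mk fun l => (Module.finrank K (lambdaGrade K V R l) : ℝ)



set_option linter.all false
namespace HS

/-- Hecke algebra relations. -/
structure IsHecke {L P : Type*} [Field L] [Ring P] [Algebra L P] (q : L) (T : ℕ → P) : Prop where
  quad : ∀ i, T i * T i = (q - 1) • T i + q • (1 : P)
  braid : ∀ i, T i * T (i+1) * T i = T (i+1) * T i * T (i+1)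
  comm : ∀ i j, i + 2 ≤ j → Commute (T i) (T j)

section
variable {L P : Type*} [Field L] [Ring P] [Algebra L P] {q : L} {T : ℕ → P}

variable (L) in
def HH (T : ℕ → P) (r : ℕ) : Subalgebra L P := Algebra.adjoin L {x | ∃ i, i < r ∧ x = T i}

variable (L) in
def NN (T : ℕ → P) (r : ℕ) : Submodule L P :=
  Submodule.span L {x | ∃ b ∈ HH L T r, ∃ c ∈ HH L T r, x = b * T r * c}

lemma HH_mono {r s : ℕ} (h : r ≤ s) : HH L T r ≤ HH L T s :=
  Algebra.adjoin_mono (fun _ ⟨i, hi, hx⟩ => ⟨i, lt_of_lt_of_le hi h, hx⟩)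

lemma T_mem {i r : ℕ} (h : i < r) : T i ∈ HH L T r := Algebra.subset_adjoin ⟨i, h, rfl⟩

lemma HH_zero {x : P} (h : x ∈ HH L T 0) : ∃ c : L, x = algebraMap L P c := by
  have : {x | ∃ i, i < 0 ∧ x = T i} = (∅ : Set P) := by ext; simp
  rw [HH, this, Algebra.adjoin_empty] at h
  obtain ⟨c, hc⟩ := Algebra.mem_bot.1 h
  exact ⟨c, hc.symm⟩

lemma HH_commute {r : ℕ} {y : P} (hy : ∀ i < r, Commute (T i) y) {x : P} (hx : x ∈ HH L T r) :
    Commute x y := by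
  induction hx using Algebra.adjoin_induction with
  | mem x h => obtain ⟨i, hi, rfl⟩ := h; exact hy i hi
  | algebraMap c => exact Algebra.commutes c y
  | add a b _ _ ha hb => exact ha.add_left hb
  | mul a b _ _ ha hb => exact ha.mul_left hb

lemma IsHecke.commT (H : IsHecke q T) {r k : ℕ} (hk : r + 1 ≤ k) {x : P} (hx : x ∈ HH L T r) :
    Commute x (T k) := HH_commute (fun i hi => H.comm i k (by omega)) hx

lemma NN_mem {r : ℕ} {b c : P} (hb : b ∈ HH L T r) (hc : c ∈ HH L T r) : b * T r * c ∈ NN L T r :=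
  Submodule.subset_span ⟨b, hb, c, hc, rfl⟩

lemma NN_le (r : ℕ) {x : P} (hx : x ∈ NN L T r) : x ∈ HH L T (r+1) := by
  have : NN L T r ≤ Subalgebra.toSubmodule (HH L T (r+1)) := by
    refine Submodule.span_le.2 ?_
    rintro _ ⟨b, hb, c, hc, rfl⟩
    show _ ∈ HH L T (r+1)
    exact mul_mem (mul_mem (HH_mono (Nat.le_succ r) hb) (T_mem (Nat.lt_succ_self r)))
      (HH_mono (Nat.le_succ r) hc)
  exact this hx

lemma NN_mul_left {r : ℕ} {a x : P} (ha : a ∈ HH L T r) (hx : x ∈ NN L T r) : a * x ∈ NN L T r := by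
  induction hx using Submodule.span_induction with
  | mem x h => obtain ⟨b, hb, c, hc, rfl⟩ := h; rw [← mul_assoc, ← mul_assoc]; exact NN_mem (mul_mem ha hb) hc
  | zero => simp
  | add x y _ _ h1 h2 => rw [mul_add]; exact add_mem h1 h2
  | smul c x _ h => rw [mul_smul_comm]; exact Submodule.smul_mem _ _ h

lemma NN_mul_right {r : ℕ} {a x : P} (ha : a ∈ HH L T r) (hx : x ∈ NN L T r) : x * a ∈ NN L T r := by
  induction hx using Submodule.span_induction with
  | mem x h => obtain ⟨b, hb, c, hc, rfl⟩ := h; rw [mul_assoc]; exact NN_mem hb (mul_mem hc ha)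
  | zero => simp
  | add x y _ _ h1 h2 => rw [add_mul]; exact add_mem h1 h2
  | smul c x _ h => rw [smul_mul_assoc]; exact Submodule.smul_mem _ _ h

lemma NN_rep {r : ℕ} {x : P} (hx : x ∈ NN L T r) : ∃ (k : ℕ) (b c : Fin k → P),
    (∀ i, b i ∈ HH L T r) ∧ (∀ i, c i ∈ HH L T r) ∧ x = ∑ i, b i * T r * c i := by
  induction hx using Submodule.span_induction with
  | mem x h =>
    obtain ⟨b, hb, c, hc, rfl⟩ := h
    exact ⟨1, fun _ => b, fun _ => c, fun _ => hb, fun _ => hc, by simp⟩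
  | zero => exact ⟨0, fun _ => 0, fun _ => 0, fun i => i.elim0, fun i => i.elim0, by simp⟩
  | add x y _ _ h1 h2 =>
    obtain ⟨k, b, c, hb, hc, rfl⟩ := h1
    obtain ⟨l, b', c', hb', hc', rfl⟩ := h2
    refine ⟨k + l, Fin.append b b', Fin.append c c', ?_, ?_, ?_⟩
    · intro i; refine Fin.addCases (fun i => ?_) (fun i => ?_) i <;> simp [hb, hb']
    · intro i; refine Fin.addCases (fun i => ?_) (fun i => ?_) i <;> simp [hc, hc']
    · simp [Fin.sum_univ_add]
  | smul a x _ h =>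
    obtain ⟨k, b, c, hb, hc, rfl⟩ := h
    exact ⟨k, fun i => a • b i, c, fun i => Subalgebra.smul_mem _ (hb i) a, hc,
      by simp [Finset.smul_sum]⟩

/-- middle multiplication: `T_{r+1} y T_{r+1}` for `y ∈ NN r`. -/
lemma IsHecke.NN_step (H : IsHecke q T) {r : ℕ} {y : P} (hy : y ∈ NN L T r) :
    T (r+1) * y * T (r+1) ∈ NN L T (r+1) := by
  induction hy using Submodule.span_induction with
  | mem x h =>
    obtain ⟨b, hb, c, hc, rfl⟩ := h
    have e1 := (H.commT (le_refl (r+1)) hb).eq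
    have e2 := (H.commT (le_refl (r+1)) hc).eq
    have : T (r+1) * (b * T r * c) * T (r+1) = (b * T r) * T (r+1) * (T r * c) := by
      calc _ = (T (r+1) * b) * T r * (c * T (r+1)) := by noncomm_ring
        _ = b * (T (r+1) * T r * T (r+1)) * c := by rw [← e1, e2]; noncomm_ring
        _ = _ := by rw [← H.braid]; noncomm_ring
    rw [this]
    exact NN_mem (mul_mem (HH_mono (Nat.le_succ r) hb) (T_mem (Nat.lt_succ_self r)))
      (mul_mem (T_mem (Nat.lt_succ_self r)) (HH_mono (Nat.le_succ r) hc))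
  | zero => simp
  | add x y _ _ h1 h2 => rw [mul_add, add_mul]; exact add_mem h1 h2
  | smul c x _ h => rw [mul_smul_comm, smul_mul_assoc]; exact Submodule.smul_mem _ _ h

lemma T_mem_NN (r : ℕ) : T r ∈ NN L T r := by
  simpa using NN_mem (T := T) (r := r) (one_mem (HH L T r)) (one_mem (HH L T r))

lemma IsHecke.decomp (H : IsHecke q T) : ∀ (r : ℕ) {x : P}, x ∈ HH L T (r+1) →
    ∃ a ∈ HH L T r, ∃ y ∈ NN L T r, x = a + y := by
  intro r
  induction r with
  | zero =>
    intro x hx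
    induction hx using Algebra.adjoin_induction with
    | mem x h =>
      obtain ⟨i, hi, rfl⟩ := h
      obtain rfl : i = 0 := by omega
      exact ⟨0, zero_mem _, _, T_mem_NN 0, by simp⟩
    | algebraMap c => exact ⟨_, Subalgebra.algebraMap_mem _ c, 0, zero_mem _, by simp⟩
    | add a b _ _ ha hb =>
      obtain ⟨a, ha, y, hy, rfl⟩ := ha
      obtain ⟨a', ha', y', hy', rfl⟩ := hb
      exact ⟨a + a', add_mem ha ha', y + y', add_mem hy hy', by abel⟩
    | mul a b _ _ ha hb =>
      obtain ⟨a, ha, y, hy, rfl⟩ := ha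
      obtain ⟨a', ha', y', hy', rfl⟩ := hb
      have key : ∃ a'' ∈ HH L T 0, ∃ y'' ∈ NN L T 0, y * y' = a'' + y'' := by
        have hsc : ∀ z ∈ NN L T 0, ∃ c : L, z = c • T 0 := by
          intro z hz
          obtain ⟨k, b, c, hb, hc, rfl⟩ := NN_rep hz
          choose bb hbb using fun i => HH_zero (hb i)
          choose cc hcc using fun i => HH_zero (hc i)
          refine ⟨∑ i, bb i * cc i, ?_⟩
          rw [Finset.sum_smul]
          refine Finset.sum_congr rfl fun i _ => ?_
          rw [hbb, hcc, ← Algebra.commutes, Algebra.algebraMap_eq_smul_one,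
            Algebra.algebraMap_eq_smul_one]
          simp [smul_smul, mul_comm]
        obtain ⟨c, rfl⟩ := hsc y hy
        obtain ⟨c', rfl⟩ := hsc y' hy'
        refine ⟨(c * c' * q) • 1, Subalgebra.smul_mem _ (one_mem _) _, (c * c' * (q-1)) • T 0,
          Submodule.smul_mem _ _ (T_mem_NN 0), ?_⟩
        simp only [smul_mul_smul_comm, H.quad, smul_add, smul_smul]
        abel
      obtain ⟨a'', h1, y'', h2, e⟩ := key
      refine ⟨a * a' + a'', add_mem (mul_mem ha ha') h1, a * y' + y * a' + y'',
        add_mem (add_mem (NN_mul_left ha hy') (NN_mul_right ha' hy)) h2, ?_⟩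
      rw [add_mul, mul_add, mul_add, e]; abel
  | succ r ih =>
    intro x hx
    induction hx using Algebra.adjoin_induction with
    | mem x h =>
      obtain ⟨i, hi, rfl⟩ := h
      rcases Nat.lt_succ_iff_lt_or_eq.1 hi with h | rfl
      · exact ⟨_, T_mem h, 0, zero_mem _, by simp⟩
      · exact ⟨0, zero_mem _, _, T_mem_NN _, by simp⟩
    | algebraMap c => exact ⟨_, Subalgebra.algebraMap_mem _ c, 0, zero_mem _, by simp⟩
    | add a b _ _ ha hb =>
      obtain ⟨a, ha, y, hy, rfl⟩ := ha
      obtain ⟨a', ha', y', hy', rfl⟩ := hb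
      exact ⟨a + a', add_mem ha ha', y + y', add_mem hy hy', by abel⟩
    | mul a b _ _ ha hb =>
      obtain ⟨a, ha, y, hy, rfl⟩ := ha
      obtain ⟨a', ha', y', hy', rfl⟩ := hb
      -- product of two NN elements
      have mid : ∀ m ∈ HH L T (r+1), ∃ a'' ∈ HH L T (r+1), ∃ y'' ∈ NN L T (r+1),
          T (r+1) * m * T (r+1) = a'' + y'' := by
        intro m hm
        obtain ⟨u, hu, v, hv, rfl⟩ := ih hm
        refine ⟨q • u, Subalgebra.smul_mem _ (HH_mono (Nat.le_succ r) hu) q,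
          (q-1) • (u * T (r+1)) + T (r+1) * v * T (r+1), add_mem (Submodule.smul_mem _ _ ?_)
            (H.NN_step hv), ?_⟩
        · simpa using NN_mem (T := T) (HH_mono (Nat.le_succ r) hu) (one_mem (HH L T (r+1)))
        · rw [mul_add, add_mul, ← (H.commT (le_refl (r+1)) hu).eq, mul_assoc u, H.quad, mul_add,
            mul_smul_comm, mul_smul_comm, mul_one]
          abel
      have key0 : ∀ y y' : P, y ∈ NN L T (r+1) → y' ∈ NN L T (r+1) →
          ∃ a'' ∈ HH L T (r+1), ∃ y'' ∈ NN L T (r+1), y * y' = a'' + y'' := by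
        intro y y' hy hy'
        obtain ⟨k, b, c, hb, hc, rfl⟩ := NN_rep hy
        obtain ⟨l, b', c', hb', hc', rfl⟩ := NN_rep hy'
        choose aa h1 yy h2 e using fun (p : Fin k × Fin l) =>
          mid (c p.1 * b' p.2) (mul_mem (hc p.1) (hb' p.2))
        refine ⟨∑ p : Fin k × Fin l, b p.1 * aa p * c' p.2,
          sum_mem fun p _ => mul_mem (mul_mem (hb _) (h1 p)) (hc' _),
          ∑ p : Fin k × Fin l, b p.1 * yy p * c' p.2,
          sum_mem fun p _ => NN_mul_right (hc' _) (NN_mul_left (hb _) (h2 p)), ?_⟩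
        rw [Finset.sum_mul_sum, ← Finset.sum_add_distrib, ← Finset.sum_product']
        refine Finset.sum_congr rfl fun p _ => ?_
        calc b p.1 * T (r+1) * c p.1 * (b' p.2 * T (r+1) * c' p.2)
            = b p.1 * (T (r+1) * (c p.1 * b' p.2) * T (r+1)) * c' p.2 := by
              simp only [mul_assoc]
          _ = _ := by rw [e]; noncomm_ring
      have key := key0 y y' hy hy'
      obtain ⟨a'', h1, y'', h2, e⟩ := key
      refine ⟨a * a' + a'', add_mem (mul_mem ha ha') h1, a * y' + y * a' + y'',
        add_mem (add_mem (NN_mul_left ha hy') (NN_mul_right ha' hy)) h2, ?_⟩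
      rw [add_mul, mul_add, mul_add, e]; abel

/-- inverse of `T i`. -/
def Tinv (q : L) (T : ℕ → P) (i : ℕ) : P := q⁻¹ • (T i - (q-1) • (1:P))

lemma IsHecke.T_mul_inv (H : IsHecke q T) (hq : q ≠ 0) (i : ℕ) : T i * Tinv q T i = 1 := by
  rw [Tinv, mul_smul_comm, mul_sub, H.quad, mul_smul_comm, mul_one, add_sub_cancel_left, smul_smul,
    inv_mul_cancel₀ hq, one_smul]

lemma IsHecke.inv_mul_T (H : IsHecke q T) (hq : q ≠ 0) (i : ℕ) : Tinv q T i * T i = 1 := by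
  rw [Tinv, smul_mul_assoc, sub_mul, H.quad, smul_mul_assoc, one_mul, add_sub_cancel_left, smul_smul,
    inv_mul_cancel₀ hq, one_smul]

lemma Tinv_mem {i r : ℕ} (h : i < r) : Tinv q T i ∈ HH L T r :=
  Subalgebra.smul_mem _ (sub_mem (T_mem h) (Subalgebra.smul_mem _ (one_mem _) _)) _

/-- coset representatives -/
def cu (T : ℕ → P) : ℕ → ℕ → P
  | _, 0 => 1
  | 0, _+1 => 0
  | r+1, k+1 => T r * cu T r k

def cv (T : ℕ → P) : ℕ → ℕ → P
  | _, 0 => 1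
  | 0, _+1 => 0
  | r+1, k+1 => cv T r k * T r

@[simp] lemma cu_zero (r) : cu T r 0 = 1 := by cases r <;> rfl
@[simp] lemma cv_zero (r) : cv T r 0 = 1 := by cases r <;> rfl

lemma cu_mem : ∀ r k, cu T r k ∈ HH L T r
  | 0, 0 => one_mem _
  | 0, _+1 => zero_mem _
  | r+1, 0 => one_mem _
  | r+1, k+1 => mul_mem (T_mem (Nat.lt_succ_self r)) (HH_mono (Nat.le_succ r) (cu_mem r k))

lemma cv_mem : ∀ r k, cv T r k ∈ HH L T r
  | 0, 0 => one_mem _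
  | 0, _+1 => zero_mem _
  | r+1, 0 => one_mem _
  | r+1, k+1 => mul_mem (HH_mono (Nat.le_succ r) (cv_mem r k)) (T_mem (Nat.lt_succ_self r))

/-- spanning by cosets -/
lemma IsHecke.coset_span (H : IsHecke q T) : ∀ (r : ℕ) {x : P}, x ∈ HH L T (r+1) →
    ∃ a : ℕ → P, (∀ k, a k ∈ HH L T r) ∧ x = ∑ k ∈ Finset.range (r+2), a k * cu T (r+1) k := by
  intro r
  -- it suffices to treat NN elements
  suffices hN : ∀ y ∈ NN L T r, ∃ a : ℕ → P, (∀ k, a k ∈ HH L T r) ∧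
      y = ∑ k ∈ Finset.range (r+2), a k * cu T (r+1) k by
    intro x hx
    obtain ⟨a, ha, y, hy, rfl⟩ := H.decomp r hx
    obtain ⟨f, hf, rfl⟩ := hN y hy
    refine ⟨fun k => if k = 0 then a + f 0 else f k, fun k => ?_, ?_⟩
    · dsimp only
      split_ifs
      · exact add_mem ha (hf 0)
      · exact hf k
    · rw [Finset.sum_range_succ', Finset.sum_range_succ' (fun k => (if k = 0 then a + f 0 else f k) * _)]
      simp [add_mul]; abel
  induction r with
  | zero =>
    intro y hy
    induction hy using Submodule.span_induction with
    | zero => exact ⟨0, fun _ => zero_mem _, by simp⟩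
    | add x z _ _ h1 h2 =>
      obtain ⟨f, hf, rfl⟩ := h1
      obtain ⟨g, hg, rfl⟩ := h2
      exact ⟨f + g, fun k => add_mem (hf k) (hg k), by simp [add_mul, Finset.sum_add_distrib]⟩
    | smul c x _ h =>
      obtain ⟨f, hf, rfl⟩ := h
      exact ⟨c • f, fun k => Subalgebra.smul_mem _ (hf k) c, by simp [Finset.smul_sum]⟩
    | mem x h =>
      obtain ⟨b, hb, c, hc, rfl⟩ := h
      obtain ⟨c, rfl⟩ := HH_zero hc
      refine ⟨fun k => if k = 0 then 0 else b * algebraMap L P c, fun k => ?_, ?_⟩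
      · dsimp only
        split_ifs
        · exact zero_mem _
        · exact mul_mem hb hc
      · rw [Finset.sum_range_succ']
        simp [cu, mul_assoc, Algebra.commutes]
  | succ r ih =>
    intro y hy
    induction hy using Submodule.span_induction with
    | zero => exact ⟨0, fun _ => zero_mem _, by simp⟩
    | add x z _ _ h1 h2 =>
      obtain ⟨f, hf, rfl⟩ := h1
      obtain ⟨g, hg, rfl⟩ := h2
      exact ⟨f + g, fun k => add_mem (hf k) (hg k), by simp [add_mul, Finset.sum_add_distrib]⟩
    | smul c x _ h =>
      obtain ⟨f, hf, rfl⟩ := h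
      exact ⟨c • f, fun k => Subalgebra.smul_mem _ (hf k) c, by simp [Finset.smul_sum]⟩
    | mem x h =>
      obtain ⟨b, hb, c, hc, rfl⟩ := h
      obtain ⟨u, hu, y, hy, rfl⟩ := H.decomp r hc
      obtain ⟨f, hf, rfl⟩ := ih y hy
      refine ⟨fun k => if k = 0 then 0 else if k = 1 then b * (u + f 0) else b * f (k-1), fun k => ?_, ?_⟩
      · dsimp only
        split_ifs
        · exact zero_mem _
        · exact mul_mem hb (HH_mono (Nat.le_succ r) (add_mem hu (hf 0)))
        · exact mul_mem hb (HH_mono (Nat.le_succ r) (hf _))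
      · have cm : ∀ k, T (r+1) * f k = f k * T (r+1) := fun k => ((H.commT (le_refl (r+1)) (hf k)).eq).symm
        have cm' : T (r+1) * u = u * T (r+1) := ((H.commT (le_refl (r+1)) hu).eq).symm
        have e1 : ∀ g : ℕ → P, ∑ k ∈ Finset.range (r+1+2), g k =
            (∑ k ∈ Finset.range (r+1), g (k+2)) + g 1 + g 0 := by
          intro g; rw [Finset.sum_range_succ', Finset.sum_range_succ']
        have e2 : ∀ g : ℕ → P, ∑ k ∈ Finset.range (r+2), g k =
            (∑ k ∈ Finset.range (r+1), g (k+1)) + g 0 := by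
          intro g; rw [Finset.sum_range_succ']
        have h2 : ∀ k, cu T (r+1+1) (k+2) = T (r+1) * cu T (r+1) (k+1) := fun k => rfl
        have h1 : cu T (r+1+1) 1 = T (r+1) := by simp [cu]
        rw [e1, e2]
        simp only [h2, h1, cu_zero, Nat.add_eq_zero_iff, one_ne_zero, OfNat.ofNat_ne_zero, and_false,
          if_false, if_true, zero_mul, add_zero, mul_one]
        have h3 : ∀ k, k + 2 ≠ 1 := fun k => by omega
        have h4 : ∀ k, k + 2 - 1 = k + 1 := fun k => by omega
        simp only [h3, h4, if_false]
        have : ∀ k, b * f (k+1) * (T (r+1) * cu T (r+1) (k+1)) =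
            b * T (r+1) * (f (k+1) * cu T (r+1) (k+1)) := by
          intro k
          calc _ = b * (f (k+1) * T (r+1)) * cu T (r+1) (k+1) := by simp only [mul_assoc]
            _ = _ := by rw [← cm]; simp only [mul_assoc]
        simp only [this, ← Finset.mul_sum]
        rw [mul_assoc b (u + f 0), add_mul, ← cm, ← cm']
        noncomm_ring

lemma IsHecke.coset_orth (H : IsHecke q T) : ∀ (r k l : ℕ), k ≤ r + 1 → l ≤ r + 1 →
    ∃ y ∈ NN L T r, cu T (r+1) k * cv T (r+1) l = (if k = l then q^k else 0) • (1:P) + y := by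
  intro r
  induction r with
  | zero =>
    intro k l hk hl
    have hT : (T 0 : P) ∈ NN L T 0 := T_mem_NN 0
    interval_cases k <;> interval_cases l
    · exact ⟨0, zero_mem _, by simp [cu, cv]⟩
    · exact ⟨T 0, hT, by simp [cu, cv]⟩
    · exact ⟨T 0, hT, by simp [cu, cv]⟩
    · exact ⟨(q-1) • T 0, Submodule.smul_mem _ _ hT, by simp [cu, cv, H.quad, add_comm]⟩
  | succ r ih =>
    intro k l hk hl
    match k, l with
    | 0, 0 => exact ⟨0, zero_mem _, by simp [cu, cv]⟩
    | 0, l+1 =>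
      refine ⟨cv T (r+1) l * T (r+1), ?_, by simp [cu, cv]⟩
      simpa using NN_mem (T := T) (cv_mem (L := L) (r+1) l) (one_mem (HH L T (r+1)))
    | k+1, 0 =>
      refine ⟨T (r+1) * cu T (r+1) k, ?_, by simp [cu, cv]⟩
      simpa using NN_mem (T := T) (one_mem (HH L T (r+1))) (cu_mem (L := L) (r+1) k)
    | k+1, l+1 =>
      obtain ⟨y, hy, e⟩ := ih k l (by omega) (by omega)
      refine ⟨(if k = l then q^k * (q-1) else 0) • T (r+1) + T (r+1) * y * T (r+1),
        add_mem (Submodule.smul_mem _ _ (T_mem_NN _)) (H.NN_step hy), ?_⟩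
      have : cu T (r+1+1) (k+1) * cv T (r+1+1) (l+1) = T (r+1) * (cu T (r+1) k * cv T (r+1) l) * T (r+1) := by
        simp only [cu, cv]; noncomm_ring
      rw [this, e, mul_add, add_mul, mul_smul_comm, smul_mul_assoc, mul_one, H.quad]
      by_cases h : k = l
      · simp only [h, if_true, smul_add, smul_smul, pow_succ]; abel
      · simp [h]

end
end HS

set_option linter.all false
namespace HS
open Polynomial

/-- A family of Markov functionals. -/
structure MarkovFam {L P : Type*} [Field L] [Ring P] [Algebra L P] (T : ℕ → P)
    (D : ℕ → L) (μ : ℕ → ℕ → P →ₗ[L] L) : Prop where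
  inj : Function.Injective D
  m0 : ∀ N, μ N 0 1 = D N
  m1 : ∀ N r a, a ∈ HH L T r → μ N (r+1) a = D N * μ N r a
  m2 : ∀ N r b c, b ∈ HH L T r → c ∈ HH L T r → μ N (r+1) (b * T r * c) = μ N r (b * c)

section
variable {L P : Type*} [Field L] [Ring P] [Algebra L P] {q : L} {T : ℕ → P}
  {D : ℕ → L} {μ : ℕ → ℕ → P →ₗ[L] L}

def PolyB (D : ℕ → L) (μ : ℕ → ℕ → P →ₗ[L] L) (r d : ℕ) (x : P) : Prop :=
  ∃ f : L[X], f.degree < (d : ℕ) ∧ ∀ N, μ N r x = f.eval (D N)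

lemma PolyB.add {r d : ℕ} {x y : P} (hx : PolyB D μ r d x) (hy : PolyB D μ r d y) :
    PolyB D μ r d (x + y) := by
  obtain ⟨f, hf, h⟩ := hx
  obtain ⟨g, hg, h'⟩ := hy
  exact ⟨f + g, lt_of_le_of_lt (degree_add_le _ _) (max_lt hf hg), fun N => by simp [h, h']⟩

lemma PolyB.smul {r d : ℕ} {x : P} (c : L) (hx : PolyB D μ r d x) :
    PolyB D μ r d (c • x) := by
  obtain ⟨f, hf, h⟩ := hx
  exact ⟨c • f, lt_of_le_of_lt (degree_smul_le _ _) hf, fun N => by simp [h]⟩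

lemma PolyB.zero {r d : ℕ} : PolyB D μ r d (0 : P) :=
  ⟨0, by simp, fun N => by simp⟩

lemma PolyB.mono {r d e : ℕ} (h : d ≤ e) {x : P} (hx : PolyB D μ r d x) : PolyB D μ r e x := by
  obtain ⟨f, hf, h'⟩ := hx
  exact ⟨f, lt_of_lt_of_le hf (by exact_mod_cast h), h'⟩

lemma PolyB.nn (M : MarkovFam T D μ) {r d : ℕ} (hb : ∀ x ∈ HH L T r, PolyB D μ r d x) {y : P}
    (hy : y ∈ NN L T r) : PolyB D μ (r+1) d y := by
  induction hy using Submodule.span_induction with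
  | zero => exact PolyB.zero
  | add x z _ _ h1 h2 => exact h1.add h2
  | smul c x _ h => exact h.smul c
  | mem x h =>
    obtain ⟨b, hb', c, hc, rfl⟩ := h
    obtain ⟨f, hf, h⟩ := hb (b * c) (mul_mem hb' hc)
    exact ⟨f, hf, fun N => by rw [M.m2 N r b c hb' hc, h]⟩

lemma IsHecke.bound (H : IsHecke q T) (M : MarkovFam T D μ) : ∀ (r : ℕ), ∀ x ∈ HH L T r,
    PolyB D μ r (r+2) x := by
  intro r
  induction r with
  | zero =>
    intro x hx
    obtain ⟨c, rfl⟩ := HH_zero hx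
    refine ⟨C c * X, ?_, fun N => ?_⟩
    · exact lt_of_le_of_lt (degree_C_mul_X_le _) (by exact_mod_cast (by norm_num : 1 < 0 + 2))
    · rw [Algebra.algebraMap_eq_smul_one, map_smul, M.m0]; simp
  | succ r ih =>
    intro x hx
    obtain ⟨a, ha, y, hy, rfl⟩ := H.decomp r hx
    refine PolyB.add ?_ ((PolyB.nn M ih hy).mono (by omega))
    obtain ⟨f, hf, h⟩ := ih a ha
    refine ⟨X * f, ?_, fun N => by rw [M.m1 N r a ha, h]; simp⟩
    rcases eq_or_ne f 0 with rfl | h0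
    · rw [mul_zero, degree_zero]; exact WithBot.bot_lt_coe _
    rw [degree_eq_natDegree h0] at hf
    have := natDegree_X_mul h0
    refine lt_of_le_of_lt degree_le_natDegree ?_
    rw [Nat.cast_lt] at hf ⊢
    omega

lemma poly_eq (M : MarkovFam T D μ) {f g : L[X]} (h : ∀ N, f.eval (D N) = g.eval (D N)) : f = g := by
  refine Polynomial.eq_of_infinite_eval_eq f g ?_
  refine Set.Infinite.mono (s := Set.range D) ?_ (Set.infinite_range_of_injective M.inj)
  rintro _ ⟨N, rfl⟩; exact h N

lemma IsHecke.small_down (H : IsHecke q T) (M : MarkovFam T D μ) {r : ℕ} {a : P} (ha : a ∈ HH L T r)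
    (hs : PolyB D μ (r+1) (r+2) a) : PolyB D μ r (r+1) a := by
  obtain ⟨g, hg, h⟩ := H.bound M r a ha
  obtain ⟨f, hf, h'⟩ := hs
  have : X * g = f := poly_eq M fun N => by rw [← h', M.m1 N r a ha, h]; simp
  refine ⟨g, ?_, h⟩
  subst this
  rcases eq_or_ne g 0 with rfl | h0
  · simp
  rw [degree_eq_natDegree h0]
  rw [degree_eq_natDegree (mul_ne_zero X_ne_zero h0), natDegree_X_mul h0] at hf
  rw [Nat.cast_lt] at hf ⊢
  omega

/-- isolating a coefficient -/
lemma IsHecke.isolate (H : IsHecke q T) (hq : q ≠ 0) (M : MarkovFam T D μ) {r : ℕ} (a : ℕ → P)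
    (ha : ∀ k, a k ∈ HH L T r) {l : ℕ} (hl : l < r + 2) {c : P} (hc : c ∈ HH L T r)
    (hs : PolyB D μ (r+1) (r+2) ((∑ k ∈ Finset.range (r+2), a k * cu T (r+1) k) * (cv T (r+1) l * c))) :
    PolyB D μ r (r+1) (a l * c) := by
  choose! y hy e using fun k (hk : k ≤ r + 1) => H.coset_orth r k l hk (by omega)
  have e1 : (∑ k ∈ Finset.range (r+2), a k * cu T (r+1) k) * (cv T (r+1) l * c) =
      q^l • (a l * c) + ∑ k ∈ Finset.range (r+2), a k * y k * c := by
    rw [Finset.sum_mul]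
    have : ∀ k ∈ Finset.range (r+2), a k * cu T (r+1) k * (cv T (r+1) l * c) =
        (if k = l then q^l • (a l * c) else 0) + a k * y k * c := by
      intro k hk
      have hk' : k ≤ r + 1 := by simp at hk; omega
      calc _ = a k * (cu T (r+1) k * cv T (r+1) l) * c := by simp only [mul_assoc]
        _ = _ := by
          rw [e k hk', mul_add, add_mul]
          congr 1
          split_ifs with h
          · subst h; simp
          · simp
    rw [Finset.sum_congr rfl this, Finset.sum_add_distrib, Finset.sum_ite_eq' , if_pos (by simpa using hl)]
  have hn : PolyB D μ (r+1) (r+2) (∑ k ∈ Finset.range (r+2), a k * y k * c) := by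
    refine PolyB.nn M (H.bound M r) (sum_mem fun k hk => ?_)
    have hk' : k ≤ r + 1 := by simp at hk; omega
    exact NN_mul_right hc (NN_mul_left (ha k) (hy k hk'))
  rw [e1] at hs
  have h3 := (hs.add (hn.smul (-1 : L))).smul ((q^l)⁻¹)
  have : (q^l)⁻¹ • (q^l • (a l * c) + ∑ k ∈ Finset.range (r+2), a k * y k * c +
      (-1 : L) • ∑ k ∈ Finset.range (r+2), a k * y k * c) = a l * c := by
    rw [neg_one_smul, add_neg_cancel_right, smul_smul, inv_mul_cancel₀ (pow_ne_zero _ hq), one_smul]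
  rw [this] at h3
  exact H.small_down M (mul_mem (ha l) hc) h3

lemma IsHecke.nd (H : IsHecke q T) (hq : q ≠ 0) (M : MarkovFam T D μ) : ∀ (r : ℕ), ∀ x ∈ HH L T r,
    (∀ c ∈ HH L T r, PolyB D μ r (r+1) (x * c)) → x = 0 := by
  intro r
  induction r with
  | zero =>
    intro x hx hs
    obtain ⟨c, rfl⟩ := HH_zero hx
    obtain ⟨f, hf, h⟩ := hs 1 (one_mem _)
    have : C c * X = f := poly_eq M fun N => by
      rw [← h, mul_one, Algebra.algebraMap_eq_smul_one, map_smul, M.m0]; simp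
    by_contra hne
    have hc : c ≠ 0 := by rintro rfl; simp at hne
    rw [← this, degree_C_mul_X hc] at hf
    simp at hf
  | succ r ih =>
    intro x hx hs
    obtain ⟨a, ha, rfl⟩ := H.coset_span r hx
    refine Finset.sum_eq_zero fun l hl => ?_
    have : a l = 0 := ih _ (ha l) fun c hc => H.isolate hq M a ha (by simpa using hl) hc
      (hs _ (mul_mem (cv_mem _ _) (HH_mono (Nat.le_succ r) hc)))
    simp [this]

lemma IsHecke.coset_indep (H : IsHecke q T) (hq : q ≠ 0) (M : MarkovFam T D μ) {r : ℕ} (a : ℕ → P)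
    (ha : ∀ k, a k ∈ HH L T r) (h0 : ∑ k ∈ Finset.range (r+2), a k * cu T (r+1) k = 0)
    {l : ℕ} (hl : l < r + 2) : a l = 0 :=
  H.nd hq M r _ (ha l) fun c hc => H.isolate hq M a ha hl hc (by rw [h0, zero_mul]; exact PolyB.zero)

variable (L) in
def cosetMap (T : ℕ → P) (r : ℕ) : (Fin (r+2) → HH L T r) →ₗ[L] HH L T (r+1) where
  toFun a := ⟨∑ k, (a k : P) * cu T (r+1) k, sum_mem fun k _ =>
    mul_mem (HH_mono (Nat.le_succ r) (a k).2) (cu_mem _ _)⟩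
  map_add' a b := by ext; simp [add_mul, Finset.sum_add_distrib]
  map_smul' c a := by ext; simp [Finset.smul_sum]

lemma IsHecke.cosetMap_bij (H : IsHecke q T) (hq : q ≠ 0) (M : MarkovFam T D μ) (r : ℕ) :
    Function.Bijective (cosetMap L T r) := by
  constructor
  · rw [injective_iff_map_eq_zero]
    intro a h
    have h' : ∑ k, (a k : P) * cu T (r+1) k = 0 := congrArg Subtype.val h
    let b : ℕ → P := fun k => if h : k < r + 2 then a ⟨k, h⟩ else 0
    have hb : ∀ k, b k ∈ HH L T r := fun k => by
      dsimp only [b]; split_ifs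
      · exact (a _).2
      · exact zero_mem _
    ext k
    have := H.coset_indep hq M b hb (by
      rw [Finset.sum_range, ← h']
      refine Finset.sum_congr rfl fun k _ => by simp [b]) k.2
    simpa [b] using this
  · rintro ⟨x, hx⟩
    obtain ⟨a, ha, rfl⟩ := H.coset_span r hx
    refine ⟨fun k => ⟨a k, ha k⟩, ?_⟩
    ext
    simp [cosetMap, Finset.sum_range]

lemma IsHecke.finrank (H : IsHecke q T) (hq : q ≠ 0) (M : MarkovFam T D μ) [Nontrivial P] (r : ℕ) :
    FiniteDimensional L (HH L T r) ∧ Module.finrank L (HH L T r) = (r+1).factorial := by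
  induction r with
  | zero =>
    have : HH L T 0 = ⊥ := by
      refine le_antisymm (fun x hx => ?_) bot_le
      obtain ⟨c, rfl⟩ := HH_zero hx
      exact Subalgebra.algebraMap_mem _ c
    rw [this]
    exact ⟨inferInstance, by simp⟩
  | succ r ih =>
    obtain ⟨h1, h2⟩ := ih
    let E := LinearEquiv.ofBijective _ (H.cosetMap_bij hq M r)
    refine ⟨Module.Finite.equiv E, ?_⟩
    rw [← E.finrank_eq, Module.finrank_pi_fintype]
    simp [h2, Nat.factorial_succ (r+1)]

/-- idempotent from non-nilpotent -/
lemma exists_idem (B : Subalgebra L P) [FiniteDimensional L B] {z : P} (hz : z ∈ B)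
    (hn : ¬ IsNilpotent z) : ∃ u ∈ B, (u * z) * (u * z) = u * z ∧ u * z ≠ 0 := by
  have hint : IsIntegral L (⟨z, hz⟩ : B) := Algebra.IsIntegral.isIntegral _
  have hint : IsIntegral L z := by
    have := hint.map B.val
    simpa using this
  set p := minpoly L z
  have hp : p ≠ 0 := minpoly.ne_zero hint
  obtain ⟨f, hf, hnd⟩ := Polynomial.exists_eq_pow_rootMultiplicity_mul_and_not_dvd p hp 0
  set a := rootMultiplicity 0 p
  rw [C_0, sub_zero] at hf hnd
  have hc : IsCoprime (X ^ (a+1)) f := by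
    refine IsCoprime.pow_left ?_
    exact (Polynomial.irreducible_X.coprime_iff_not_dvd).2 hnd
  obtain ⟨u, v, huv⟩ := hc
  have hpz : aeval z p = 0 := minpoly.aeval L z
  have hmem : ∀ g : L[X], aeval z g ∈ B := fun g => by
    have : aeval z g = B.val (aeval (⟨z, hz⟩ : B) g) := by
      rw [← Polynomial.aeval_algHom_apply]; rfl
    rw [this]; exact Subtype.property _
  have e1 : aeval z (u * X ^ a) * z = aeval z (u * X ^ (a+1)) := by
    rw [pow_succ, ← mul_assoc, map_mul _ (u * X ^ a) X, aeval_X]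
  refine ⟨aeval z (u * X ^ a), hmem _, ?_, ?_⟩
  · rw [e1, ← map_mul]
    have : u * X ^ (a+1) * (u * X ^ (a+1)) = u * X ^ (a+1) - (u * v * X) * p := by
      rw [hf]; linear_combination (u * X ^ (a+1)) * huv
    rw [this, map_sub, map_mul _ (u * v * X) p, hpz]; simp
  · rw [e1]
    intro h0
    apply hn
    refine ⟨a, ?_⟩
    have h1 : aeval z (v * f) = 1 := by
      have := congrArg (aeval z) huv
      rw [map_add, h0, zero_add, map_one] at this
      exact this
    have h2 : X ^ a * (v * f) = v * p := by rw [hf]; ring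
    have := congrArg (aeval z) h2
    rw [map_mul, h1, map_mul, hpz] at this
    simpa using this

lemma exists_fact (C : ℕ) : ∃ r : ℕ, C ^ (r+1) < (r+1).factorial := by
  have h := FloorSemiring.tendsto_pow_div_factorial_atTop (C : ℝ)
  have := (h.comp (Filter.tendsto_add_atTop_nat 1)).eventually (gt_mem_nhds (show (0:ℝ) < 1 by norm_num))
  obtain ⟨r, hr⟩ := this.exists
  refine ⟨r, ?_⟩
  simp only [Function.comp] at hr
  rw [div_lt_one (by positivity)] at hr
  exact_mod_cast hr

theorem IsHecke.deep (H : IsHecke q T) (hq : q ≠ 0) (M : MarkovFam T D μ)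
    (hnil : ∀ N r z, z ∈ HH L T r → IsNilpotent z → μ N r z = 0)
    {Q : Type*} [Ring Q] [Algebra L Q] [Nontrivial Q] (π : P →ₐ[L] Q) (C : ℕ)
    (hC : ∀ r, ∃ W : Submodule L Q, FiniteDimensional L W ∧ Module.finrank L W ≤ C ^ (r+1) ∧
      ∀ x ∈ HH L T r, π x ∈ W) :
    ∃ r, ∃ e ∈ HH L T r, e * e = e ∧ π e ≠ 0 ∧ ∃ y ∈ NN L T r, π e = π y := by
  haveI : Nontrivial P := ⟨0, 1, fun h => by
    have := congrArg π h; simp at this⟩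
  have hex : ∃ s, ¬ (∀ x ∈ HH L T s, π x = 0 → x = 0) := by
    by_contra hcon
    push Not at hcon
    obtain ⟨r, hr⟩ := exists_fact C
    obtain ⟨W, hW, hW', hm⟩ := hC r
    obtain ⟨h1, h2⟩ := H.finrank hq M r
    let φ : HH L T r →ₗ[L] W := (π.toLinearMap.comp (HH L T r).val.toLinearMap).codRestrict W
      (fun x => hm _ x.2)
    have hφ : Function.Injective φ := by
      rw [injective_iff_map_eq_zero]
      intro x hx
      have : π x = 0 := congrArg Subtype.val hx
      exact Subtype.ext (hcon r x x.2 this)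
    have := LinearMap.finrank_le_finrank_of_injective hφ
    omega
  classical
  obtain ⟨s, hs, hmin⟩ : ∃ s, ¬ (∀ x ∈ HH L T s, π x = 0 → x = 0) ∧
      ∀ s' < s, (∀ x ∈ HH L T s', π x = 0 → x = 0) :=
    ⟨Nat.find hex, Nat.find_spec hex, fun s' h => by simpa using Nat.find_min hex h⟩
  rcases s with _ | r
  · exfalso; apply hs
    intro x hx h
    obtain ⟨c, rfl⟩ := HH_zero hx
    rw [AlgHom.commutes] at h
    have : c = 0 := (algebraMap L Q).injective (by rw [h, map_zero])
    simp [this]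
  push Not at hs
  obtain ⟨x, hx, hπ, hne⟩ := hs
  have : ¬ ∀ c ∈ HH L T (r+1), PolyB D μ (r+1) (r+1+1) (x * c) := fun h => hne (H.nd hq M _ x hx h)
  push Not at this
  obtain ⟨c, hc, hns⟩ := this
  obtain ⟨z, hz, y, hy, e⟩ := H.decomp r (mul_mem hx hc)
  have hz0 : π z = - π y := by
    have := congrArg π e
    rw [map_mul, hπ, zero_mul, map_add] at this
    exact eq_neg_of_add_eq_zero_left this.symm
  have hnn : ¬ IsNilpotent z := by
    intro hzn
    apply hns
    rw [e]
    refine PolyB.add ⟨0, by simp, fun N => ?_⟩ (PolyB.nn M (H.bound M r) hy)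
    rw [M.m1 N r z hz, hnil N r z hz hzn]; simp
  haveI := (H.finrank hq M r).1
  obtain ⟨u, hu, hid, h0⟩ := exists_idem (HH L T r) hz hnn
  refine ⟨r, u * z, mul_mem hu hz, hid, fun h => h0 (hmin r (Nat.lt_succ_self r) _ (mul_mem hu hz) h),
    -(u * y), neg_mem (NN_mul_left hu hy), ?_⟩
  rw [map_mul, hz0, map_neg, map_mul]; simp

end
end HS

set_option linter.all false
namespace HS
open Matrix

noncomputable section
variable (L ι : Type*) [Field L] [Fintype ι] [DecidableEq ι]

abbrev EW := Module.End L ((ℕ → ι) → L)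

variable {L ι}
variable {S : Type*} [Fintype S] [DecidableEq S]

def Jlin (s : S → ℕ) (X : Matrix (S → ι) (S → ι) L) : EW L ι where
  toFun f := fun w => ∑ u, X (w ∘ s) u * f (Function.extend s u w)
  map_add' f g := by ext w; simp [mul_add, Finset.sum_add_distrib]
  map_smul' c f := by ext w; simp [Finset.mul_sum]; exact Finset.sum_congr rfl fun _ _ => by ring

lemma Jlin_apply (s : S → ℕ) (X : Matrix (S → ι) (S → ι) L) (f : (ℕ → ι) → L) (w : ℕ → ι) :
    Jlin s X f w = ∑ u, X (w ∘ s) u * f (Function.extend s u w) := rfl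

lemma ext_comp {S : Type*} {s : S → ℕ} (hs : Function.Injective s) (u : S → ι) (w : ℕ → ι) :
    Function.extend s u w ∘ s = u := by
  ext i; simp [hs.extend_apply]

lemma ext_ext {S : Type*} {s : S → ℕ} (hs : Function.Injective s) (u v : S → ι) (w : ℕ → ι) :
    Function.extend s v (Function.extend s u w) = Function.extend s v w := by
  ext k
  by_cases h : ∃ i, s i = k
  · obtain ⟨i, rfl⟩ := h; simp [hs.extend_apply]
  · simp [Function.extend_apply' _ _ _ h]

lemma ext_self {S : Type*} {s : S → ℕ} (hs : Function.Injective s) (w : ℕ → ι) :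
    Function.extend s (w ∘ s) w = w := by
  ext k
  by_cases h : ∃ i, s i = k
  · obtain ⟨i, rfl⟩ := h; simp [hs.extend_apply]
  · simp [Function.extend_apply' _ _ _ h]

def Jhom (s : S → ℕ) (hs : Function.Injective s) : Matrix (S → ι) (S → ι) L →ₐ[L] EW L ι :=
  AlgHom.ofLinearMap
    { toFun := Jlin s
      map_add' := fun X Y => by ext f w; simp [Jlin_apply, add_mul, Finset.sum_add_distrib]
      map_smul' := fun c X => by ext f w; simp [Jlin_apply, Finset.mul_sum, mul_assoc] }
    (by
      ext f w
      simp only [LinearMap.coe_mk, AddHom.coe_mk, Jlin_apply, Matrix.one_apply, ite_mul, one_mul, zero_mul,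
        Finset.sum_ite_eq, Finset.mem_univ, if_true, ext_self hs]
      rfl)
    (by
      intro X Y
      ext f w
      simp only [LinearMap.coe_mk, AddHom.coe_mk, Jlin_apply, Module.End.mul_apply, ext_comp hs, ext_ext hs,
        Matrix.mul_apply, Finset.sum_mul, Finset.mul_sum]
      rw [Finset.sum_comm]
      simp only [mul_assoc])

lemma Jhom_apply (s : S → ℕ) (hs : Function.Injective s) (X : Matrix (S → ι) (S → ι) L) (f : (ℕ → ι) → L)
    (w : ℕ → ι) : Jhom s hs X f w = ∑ u, X (w ∘ s) u * f (Function.extend s u w) := rfl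

lemma Jhom_inj [Nonempty ι] (s : S → ℕ) (hs : Function.Injective s) :
    Function.Injective (Jhom (L := L) (ι := ι) s hs) := by
  rw [injective_iff_map_eq_zero]
  intro X h
  ext u v
  have := congrFun (LinearMap.congr_fun h (fun w => if w ∘ s = v then 1 else 0))
    (Function.extend s u (fun _ => Classical.arbitrary ι))
  rw [Jhom_apply] at this
  simpa [ext_comp hs] using this

/-- one strand operator -/
def jlin (i : ℕ) (β : Matrix ι ι L) : EW L ι where
  toFun f := fun w => ∑ a, β (w i) a * f (Function.update w i a)
  map_add' f g := by ext w; simp [mul_add, Finset.sum_add_distrib]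
  map_smul' c f := by ext w; simp [Finset.mul_sum]; exact Finset.sum_congr rfl fun _ _ => by ring

lemma jlin_apply (i : ℕ) (β : Matrix ι ι L) (f : (ℕ → ι) → L) (w : ℕ → ι) :
    jlin i β f w = ∑ a, β (w i) a * f (Function.update w i a) := rfl

def jE (i : ℕ) : Matrix ι ι L →ₐ[L] EW L ι :=
  AlgHom.ofLinearMap
    { toFun := jlin i
      map_add' := fun X Y => by ext f w; simp [jlin_apply, add_mul, Finset.sum_add_distrib]
      map_smul' := fun c X => by ext f w; simp [jlin_apply, Finset.mul_sum, mul_assoc] }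
    (by
      ext f w
      simp only [LinearMap.coe_mk, AddHom.coe_mk, jlin_apply, Matrix.one_apply, ite_mul, one_mul, zero_mul,
        Finset.sum_ite_eq, Finset.mem_univ, if_true, Function.update_eq_self]
      rfl)
    (by
      intro X Y
      ext f w
      simp only [LinearMap.coe_mk, AddHom.coe_mk, jlin_apply, Module.End.mul_apply, Function.update_self,
        Function.update_idem,
        Matrix.mul_apply, Finset.sum_mul, Finset.mul_sum]
      rw [Finset.sum_comm]
      simp only [mul_assoc])

lemma jE_apply (i : ℕ) (β : Matrix ι ι L) (f : (ℕ → ι) → L) (w : ℕ → ι) :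
    jE i β f w = ∑ a, β (w i) a * f (Function.update w i a) := rfl

lemma jE_comm {i k : ℕ} (h : i ≠ k) (a b : Matrix ι ι L) : Commute (jE i a) (jE k b) := by
  ext f w
  simp only [Module.End.mul_apply, jE_apply, Finset.mul_sum, Function.update_of_ne h,
    Function.update_of_ne h.symm]
  rw [Finset.sum_comm]
  refine Finset.sum_congr rfl fun x _ => Finset.sum_congr rfl fun y _ => ?_
  rw [Function.update_comm h]; ring

abbrev JN (n : ℕ) : Matrix (Fin n → ι) (Fin n → ι) L →ₐ[L] EW L ι := Jhom Fin.val Fin.val_injective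

lemma extend_snoc (n : ℕ) (v : Fin n → ι) (a : ι) (w : ℕ → ι) :
    Function.extend Fin.val (Fin.snoc v a : Fin (n+1) → ι) w =
      Function.update (Function.extend Fin.val v w) n a := by
  ext k
  rcases lt_trichotomy k n with h | h | h
  · have e1 := (Fin.val_injective (n := n+1)).extend_apply (Fin.snoc v a : Fin (n+1) → ι) w (Fin.castSucc ⟨k, h⟩)
    have e2 := (Fin.val_injective (n := n)).extend_apply v w ⟨k, h⟩
    simp only [Fin.val_castSucc, Fin.snoc_castSucc] at e1 e2
    rw [e1, Function.update_of_ne h.ne, e2]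
  · subst h
    have e1 := (Fin.val_injective (n := k+1)).extend_apply (Fin.snoc v a : Fin (k+1) → ι) w (Fin.last k)
    simp only [Fin.val_last, Fin.snoc_last] at e1
    rw [e1, Function.update_self]
  · rw [Function.update_of_ne h.ne', Function.extend_apply', Function.extend_apply']
    · rintro ⟨i, hi⟩; have := i.2; omega
    · rintro ⟨i, hi⟩; have := i.2; omega

lemma sum_snoc {M : Type*} [AddCommMonoid M] (n : ℕ) (F : (Fin (n+1) → ι) → M) :
    ∑ u, F u = ∑ v : Fin n → ι, ∑ a, F (Fin.snoc v a) := by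
  rw [← (Fin.snocEquiv (fun _ => ι)).sum_comp, Fintype.sum_prod_type, Finset.sum_comm]
  rfl

def embM (n : ℕ) (Y : Matrix (Fin n → ι) (Fin n → ι) L) : Matrix (Fin (n+1) → ι) (Fin (n+1) → ι) L :=
  fun u v => if u (Fin.last n) = v (Fin.last n) then Y (Fin.init u) (Fin.init v) else 0

def lastM (n : ℕ) (β : Matrix ι ι L) : Matrix (Fin (n+1) → ι) (Fin (n+1) → ι) L :=
  fun u v => if Fin.init (α := fun _ => ι) u = Fin.init v then β (u (Fin.last n)) (v (Fin.last n)) else 0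

lemma init_comp (n : ℕ) (w : ℕ → ι) : Fin.init (α := fun _ => ι) (w ∘ (Fin.val : Fin (n+1) → ℕ)) = w ∘ Fin.val := by
  ext i; simp [Fin.init]

lemma last_comp (n : ℕ) (w : ℕ → ι) : (w ∘ (Fin.val : Fin (n+1) → ℕ)) (Fin.last n) = w n := by
  simp

lemma ext_val_last (n : ℕ) (v : Fin n → ι) (w : ℕ → ι) : Function.extend Fin.val v w n = w n := by
  rw [Function.extend_apply']
  rintro ⟨i, hi⟩; have := i.2; omega

lemma JN_emb (n : ℕ) (Y : Matrix (Fin n → ι) (Fin n → ι) L) : JN (n+1) (embM n Y) = JN n Y := by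
  ext f w
  rw [Jhom_apply, Jhom_apply, sum_snoc]
  refine Finset.sum_congr rfl fun v _ => ?_
  simp only [embM, last_comp, init_comp, Fin.snoc_last, Fin.init_snoc, extend_snoc, ite_mul, zero_mul,
    Finset.sum_ite_eq, Finset.mem_univ, if_true]
  congr 2
  conv_rhs => rw [← Function.update_eq_self n (Function.extend Fin.val v w)]
  rw [ext_val_last]

lemma JN_last (n : ℕ) (β : Matrix ι ι L) : JN (n+1) (lastM n β) = jE n β := by
  ext f w
  rw [Jhom_apply, jE_apply, sum_snoc, Finset.sum_comm]
  refine Finset.sum_congr rfl fun a _ => ?_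
  simp only [lastM, last_comp, init_comp, Fin.snoc_last, Fin.init_snoc, extend_snoc, ite_mul, zero_mul,
    Finset.sum_ite_eq, Finset.mem_univ, if_true, ext_self Fin.val_injective]

lemma trace_emb (n : ℕ) (Y : Matrix (Fin n → ι) (Fin n → ι) L) :
    (embM n Y).trace = Fintype.card ι * Y.trace := by
  simp only [Matrix.trace, Matrix.diag, embM, if_true]
  rw [sum_snoc]
  simp [Finset.mul_sum]

lemma single_eq (n : ℕ) (u v : Fin (n+1) → ι) (c : L) : Matrix.single u v c =
    embM n (Matrix.single (Fin.init u) (Fin.init v) c) *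
      lastM n (Matrix.single (u (Fin.last n)) (v (Fin.last n)) 1) := by
  ext x y
  rw [Matrix.mul_apply, sum_snoc]
  rw [Finset.sum_eq_single (Fin.init y : Fin n → ι) (fun b _ hb => Finset.sum_eq_zero fun a _ => by
      simp [lastM, hb]) (by simp),
    Finset.sum_eq_single (x (Fin.last n)) (fun a _ ha => by simp [embM, ha.symm]) (by simp)]
  simp only [embM, lastM, Fin.snoc_last, Fin.init_snoc, Matrix.single_apply, if_true]
  have hx : ∀ x u : Fin (n+1) → ι, u = x ↔ (Fin.init (α := fun _ => ι) u = Fin.init x ∧ u (Fin.last n) = x (Fin.last n)) := by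
    intro x u
    constructor
    · rintro rfl; simp
    · rintro ⟨h1, h2⟩
      rw [← Fin.snoc_init_self u, ← Fin.snoc_init_self x, h1, h2]
  simp only [hx x u, hx y v]
  by_cases h1 : Fin.init (α := fun _ => ι) u = Fin.init x <;> by_cases h2 : Fin.init (α := fun _ => ι) v = Fin.init y <;>
  by_cases h3 : u (Fin.last n) = x (Fin.last n) <;> by_cases h4 : v (Fin.last n) = y (Fin.last n) <;>
  simp [h1, h2, h3, h4]

variable (L ι) in
/-- the local algebra -/
def AA : Subalgebra L (EW L ι) := Algebra.adjoin L {x | ∃ i β, x = jE i β}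

variable (L ι) in
def AAn (n : ℕ) : Subalgebra L (EW L ι) := (JN n).range

lemma AAn_mono {n m : ℕ} (h : n ≤ m) : AAn L ι n ≤ AAn L ι m := by
  induction m, h using Nat.le_induction with
  | base => exact le_rfl
  | succ m _ ih =>
    refine ih.trans ?_
    rintro _ ⟨Y, rfl⟩
    exact ⟨embM m Y, JN_emb m Y⟩

lemma jE_mem_AAn {i n : ℕ} (h : i < n) (β : Matrix ι ι L) : jE i β ∈ AAn L ι n :=
  AAn_mono h ⟨lastM i β, JN_last i β⟩

lemma JN_mem_adjoin : ∀ (n : ℕ) (Y : Matrix (Fin n → ι) (Fin n → ι) L),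
    JN n Y ∈ Algebra.adjoin L {x | ∃ i β, i < n ∧ x = jE (L := L) (ι := ι) i β} := by
  intro n
  induction n with
  | zero =>
    intro Y
    have : Y = algebraMap L _ (Y default default) := by
      ext u v
      rw [Subsingleton.elim u default, Subsingleton.elim v default]
      simp [Matrix.algebraMap_matrix_apply]
    rw [this, AlgHom.commutes]
    exact Subalgebra.algebraMap_mem _ _
  | succ n ih =>
    intro Y
    rw [Matrix.matrix_eq_sum_single Y, map_sum]
    refine sum_mem fun u _ => ?_
    rw [map_sum]
    refine sum_mem fun v _ => ?_
    rw [single_eq, map_mul, JN_emb, JN_last]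
    refine mul_mem (Algebra.adjoin_mono ?_ (ih _)) (Algebra.subset_adjoin ⟨n, _, Nat.lt_succ_self n, rfl⟩)
    rintro _ ⟨i, β, hi, rfl⟩
    exact ⟨i, β, by omega, rfl⟩

lemma AAn_le (n : ℕ) : AAn L ι n ≤ AA L ι := by
  rintro _ ⟨Y, rfl⟩
  refine Algebra.adjoin_mono ?_ (JN_mem_adjoin n Y)
  rintro _ ⟨i, β, hi, rfl⟩
  exact ⟨i, β, rfl⟩

lemma AA_exists {x : EW L ι} (hx : x ∈ AA L ι) : ∃ n, x ∈ AAn L ι n := by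
  induction hx using Algebra.adjoin_induction with
  | mem x h => obtain ⟨i, β, rfl⟩ := h; exact ⟨i+1, jE_mem_AAn (Nat.lt_succ_self i) β⟩
  | algebraMap c => exact ⟨0, Subalgebra.algebraMap_mem _ c⟩
  | add a b _ _ ha hb =>
    obtain ⟨n, hn⟩ := ha; obtain ⟨m, hm⟩ := hb
    exact ⟨max n m, add_mem (AAn_mono (le_max_left _ _) hn) (AAn_mono (le_max_right _ _) hm)⟩
  | mul a b _ _ ha hb =>
    obtain ⟨n, hn⟩ := ha; obtain ⟨m, hm⟩ := hb
    exact ⟨max n m, mul_mem (AAn_mono (le_max_left _ _) hn) (AAn_mono (le_max_right _ _) hm)⟩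

/-- relabelling of strands -/
def alE (p : ℕ → ℕ) (hp : Function.Injective p) : EW L ι →ₐ[L] EW L ι :=
  AlgHom.ofLinearMap
    { toFun := fun X =>
        { toFun := fun f w => X (fun u => f (Function.extend p u w)) (w ∘ p)
          map_add' := fun f g => by
            ext w
            have : (fun u => (f + g) (Function.extend p u w)) =
              (fun u => f (Function.extend p u w)) + (fun u => g (Function.extend p u w)) := rfl
            simp only [this, map_add]; rfl
          map_smul' := fun c f => by
            ext w
            have : (fun u => (c • f) (Function.extend p u w)) = c • (fun u => f (Function.extend p u w)) := rfl
            simp only [this, map_smul]; rfl }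
      map_add' := fun X Y => by ext f w; rfl
      map_smul' := fun c X => by ext f w; rfl }
    (by
      ext f w
      show f (Function.extend p (w ∘ p) w) = f w
      rw [ext_self hp])
    (by
      intro X Y
      ext f w
      show X (Y fun u => f (Function.extend p u w)) (w ∘ p) =
        X (fun u => Y (fun u' => f (Function.extend p u' (Function.extend p u w))) (Function.extend p u w ∘ p)) (w ∘ p)
      simp only [ext_comp hp, ext_ext hp])

lemma alE_j (p : ℕ → ℕ) (hp : Function.Injective p) (i : ℕ) (β : Matrix ι ι L) :
    alE p hp (jE i β) = jE (p i) β := by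
  ext f w
  show ∑ a, β ((w ∘ p) i) a * f (Function.extend p (Function.update (w ∘ p) i a) w) = _
  rw [jE_apply]
  refine Finset.sum_congr rfl fun a _ => ?_
  congr 2
  ext k
  by_cases h : ∃ l, p l = k
  · obtain ⟨l, rfl⟩ := h
    rw [hp.extend_apply]
    by_cases hl : l = i
    · subst hl; simp
    · rw [Function.update_of_ne hl, Function.update_of_ne (fun h => hl (hp h))]; rfl
  · rw [Function.extend_apply' _ _ _ h, Function.update_of_ne (fun hk => h ⟨i, hk.symm⟩)]

lemma alE_mem (p : ℕ → ℕ) (hp : Function.Injective p) {x : EW L ι} (hx : x ∈ AA L ι) :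
    alE p hp x ∈ AA L ι := by
  induction hx using Algebra.adjoin_induction with
  | mem x h => obtain ⟨i, β, rfl⟩ := h; rw [alE_j]; exact Algebra.subset_adjoin ⟨_, _, rfl⟩
  | algebraMap c => rw [AlgHom.commutes]; exact Subalgebra.algebraMap_mem _ c
  | add a b _ _ ha hb => rw [map_add]; exact add_mem ha hb
  | mul a b _ _ ha hb => rw [map_mul]; exact mul_mem ha hb

end
end HS

set_option linter.all false
namespace HS
open Matrix

noncomputable section
variable {L ι : Type*} [Field L] [CharZero L] [Fintype ι] [DecidableEq ι] [Nonempty ι]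

variable (L ι) in
/-- the local algebra as a type -/
def Al : Type _ := ↥(AA L ι)

instance instRingAl : Ring (Al L ι) := inferInstanceAs (Ring ↥(AA L ι))
instance instAlgebraAl : Algebra L (Al L ι) := inferInstanceAs (Algebra L ↥(AA L ι))

variable (L ι) in
def Alval : Al L ι →ₐ[L] EW L ι := (AA L ι).val

/-- normalized trace relation -/
def IsNu (x : EW L ι) (c : L) : Prop :=
  ∃ n Y, JN n Y = x ∧ c = (Fintype.card ι : L)⁻¹ ^ n * Y.trace

lemma card_ne : (Fintype.card ι : L) ≠ 0 := by
  exact_mod_cast Fintype.card_ne_zero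

lemma nu_lift {n m : ℕ} (h : n ≤ m) (Y : Matrix (Fin n → ι) (Fin n → ι) L) :
    ∃ Y', JN m Y' = JN n Y ∧ (Fintype.card ι : L)⁻¹ ^ m * Y'.trace = (Fintype.card ι : L)⁻¹ ^ n * Y.trace := by
  induction m, h using Nat.le_induction with
  | base => exact ⟨Y, rfl, rfl⟩
  | succ m _ ih =>
    obtain ⟨Y', h1, h2⟩ := ih
    refine ⟨embM m Y', by rw [JN_emb, h1], ?_⟩
    rw [trace_emb, ← h2, pow_succ]
    have := card_ne (L := L) (ι := ι)
    field_simp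

lemma IsNu.unique {x : EW L ι} {c c' : L} (h : IsNu x c) (h' : IsNu x c') : c = c' := by
  obtain ⟨n, Y, rfl, rfl⟩ := h
  obtain ⟨m, Z, e, rfl⟩ := h'
  obtain ⟨Y', h1, h2⟩ := nu_lift (le_max_left n m) Y
  obtain ⟨Z', h3, h4⟩ := nu_lift (le_max_right n m) Z
  rw [← h2, ← h4]
  have : Y' = Z' := Jhom_inj _ _ (by rw [h1, h3, e])
  rw [this]

lemma nu_exists (x : Al L ι) : ∃ c, IsNu x.1 c := by
  obtain ⟨n, Y, hY⟩ := AA_exists x.2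
  exact ⟨_, n, Y, hY, rfl⟩

lemma common (x y : Al L ι) : ∃ n X Y, JN n X = x.1 ∧ JN n Y = y.1 := by
  obtain ⟨n, hn⟩ := AA_exists x.2
  obtain ⟨m, hm⟩ := AA_exists y.2
  obtain ⟨X, hX⟩ := AAn_mono (le_max_left n m) hn
  obtain ⟨Y, hY⟩ := AAn_mono (le_max_right n m) hm
  exact ⟨_, X, Y, hX, hY⟩

def nuF (x : Al L ι) : L := (nu_exists x).choose

lemma nuF_eq {x : Al L ι} {n : ℕ} {Y : Matrix (Fin n → ι) (Fin n → ι) L} (h : JN n Y = x.1) :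
    nuF x = (Fintype.card ι : L)⁻¹ ^ n * Y.trace :=
  (nu_exists x).choose_spec.unique ⟨n, Y, h, rfl⟩

def nu : Al L ι →ₗ[L] L where
  toFun := nuF
  map_add' x y := by
    obtain ⟨n, X, Y, hX, hY⟩ := common x y
    rw [nuF_eq hX, nuF_eq hY, nuF_eq (x := x + y) (Y := X + Y) (by rw [map_add, hX, hY]; rfl),
      Matrix.trace_add, mul_add]
  map_smul' c x := by
    obtain ⟨n, X, Y, hX, hY⟩ := common x x
    rw [nuF_eq hX, nuF_eq (x := c • x) (Y := c • X) (by rw [map_smul, hX]; rfl),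
      Matrix.trace_smul]
    simp; ring

lemma nu_eq {x : Al L ι} {n : ℕ} {Y : Matrix (Fin n → ι) (Fin n → ι) L} (h : JN n Y = x.1) :
    nu x = (Fintype.card ι : L)⁻¹ ^ n * Y.trace := nuF_eq h

lemma nu_comm (x y : Al L ι) : nu (x * y) = nu (y * x) := by
  obtain ⟨n, X, Y, hX, hY⟩ := common x y
  rw [nu_eq (x := x * y) (Y := X * Y) (by rw [map_mul, hX, hY]; rfl),
    nu_eq (x := y * x) (Y := Y * X) (by rw [map_mul, hX, hY]; rfl), Matrix.trace_mul_comm]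

lemma nu_one : nu (1 : Al L ι) = 1 := by
  rw [nu_eq (n := 0) (Y := 1) (by rw [map_one]; rfl)]
  simp

lemma nu_nilp {x : Al L ι} (h : IsNilpotent x) : nu x = 0 := by
  obtain ⟨n, X, Y, hX, hY⟩ := common x x
  have : IsNilpotent X := by
    obtain ⟨k, hk⟩ := h
    refine ⟨k, Jhom_inj _ Fin.val_injective ?_⟩
    have := congrArg (Alval L ι) hk
    rw [map_pow, map_zero] at this
    rw [map_pow, hX, map_zero]; exact this
  rw [nu_eq hX, (Matrix.isNilpotent_trace_of_isNilpotent this).eq_zero, mul_zero]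

lemma trace_idem {n : Type*} [Fintype n] [DecidableEq n] (E : Matrix n n L) (h : E * E = E) :
    E.trace = (Module.finrank L (LinearMap.range (Matrix.toLin' E)) : L) := by
  have h1 := LinearMap.IsIdempotentElem.isProj_range (Matrix.toLin' E)
    (by rw [IsIdempotentElem, Module.End.mul_eq_comp, ← Matrix.toLin'_mul, h])
  rw [← h1.trace, LinearMap.trace_eq_matrix_trace L (Pi.basisFun L n)]
  congr 1
  exact (LinearMap.toMatrix'_toLin' E).symm

lemma trace_idem_nat {n : Type*} [Fintype n] [DecidableEq n] (E : Matrix n n L) (h : E * E = E) :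
    ∃ k : ℕ, E.trace = k ∧ (k = 0 → E = 0) := by
  refine ⟨_, trace_idem E h, fun h0 => ?_⟩
  rw [Submodule.finrank_eq_zero, LinearMap.range_eq_bot] at h0
  exact (Matrix.toLin' (R := L)).injective (by rw [h0, map_zero])

/-- weighted trace of an idempotent -/
lemma trace_idem_weight {n : Type*} [Fintype n] [DecidableEq n] (E : Matrix n n L) (h : E * E = E)
    (φ : ℝ →+* L) (τ : n → ℝ) (hτ : ∀ u, 0 < τ u)
    (hc : E * Matrix.diagonal (fun u => φ (τ u)) = Matrix.diagonal (fun u => φ (τ u)) * E)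
    (h0 : (E * Matrix.diagonal (fun u => φ (τ u))).trace = 0) : E = 0 := by
  classical
  have hE : ∀ u v, τ u ≠ τ v → E u v = 0 := by
    intro u v huv
    have := congrFun (congrFun hc u) v
    rw [Matrix.mul_diagonal, Matrix.diagonal_mul, mul_comm] at this
    by_contra hne
    exact huv (φ.injective (mul_right_cancel₀ hne this)).symm
  -- spectral pieces
  let Pc : ℝ → Matrix n n L := fun c => Matrix.diagonal (fun u => if τ u = c then 1 else 0)
  have hP : ∀ c, Pc c * E = E * Pc c := by
    intro c; ext u v
    simp only [Pc, Matrix.mul_diagonal, Matrix.diagonal_mul]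
    by_cases huv : τ u = τ v
    · rw [huv, mul_comm]
    · simp [hE u v huv]
  have hPP : ∀ c, Pc c * Pc c = Pc c := by
    intro c; simp only [Pc, Matrix.diagonal_mul_diagonal]; congr 1; ext u; split_ifs <;> simp
  have hid : ∀ c, (E * Pc c) * (E * Pc c) = E * Pc c := by
    intro c
    calc _ = E * (Pc c * E) * Pc c := by simp only [mul_assoc]
      _ = (E * E) * (Pc c * Pc c) := by rw [hP]; simp only [mul_assoc]
      _ = _ := by rw [h, hPP]
  choose k hk hk0 using fun c => trace_idem_nat _ (hid c)
  have hs : (E * Matrix.diagonal (fun u => φ (τ u))).trace = ∑ c ∈ Finset.univ.image τ, φ c * (E * Pc c).trace := by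
    simp only [Matrix.trace, Matrix.diag, Matrix.mul_diagonal, Pc, Finset.mul_sum]
    rw [Finset.sum_comm]
    refine Finset.sum_congr rfl fun u _ => ?_
    rw [Finset.sum_eq_single (τ u)]
    · simp [mul_comm]
    · intro c _ hcu; simp [hcu.symm]
    · intro hu; exact absurd (Finset.mem_image_of_mem τ (Finset.mem_univ u)) hu
  have h1 : φ (∑ c ∈ Finset.univ.image τ, c * k c) = 0 := by
    rw [map_sum, ← h0, hs]
    refine Finset.sum_congr rfl fun c _ => ?_
    rw [map_mul, hk, map_natCast]
  have h2 : ∑ c ∈ Finset.univ.image τ, c * (k c : ℝ) = 0 := φ.injective (by rw [h1, map_zero])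
  have hpos : ∀ c ∈ Finset.univ.image τ, 0 < c := by
    intro c hc'; obtain ⟨u, _, rfl⟩ := Finset.mem_image.1 hc'; exact hτ u
  rw [Finset.sum_eq_zero_iff_of_nonneg (fun c hc' => mul_nonneg (hpos c hc').le (Nat.cast_nonneg _))] at h2
  ext u v
  have hm := Finset.mem_image_of_mem τ (Finset.mem_univ v)
  have h3 := h2 _ hm
  have h4 : k (τ v) = 0 := by
    rcases mul_eq_zero.1 h3 with h | h
    · exact absurd h (hτ v).ne'
    · exact_mod_cast h
  have := congrFun (congrFun (hk0 _ h4) u) v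
  simpa [Pc, Matrix.mul_diagonal] using this

/-- one strand operator -/
def jj (i : ℕ) : Matrix ι ι L →ₐ[L] Al L ι :=
  (jE i).codRestrict (AA L ι) (fun β => Algebra.subset_adjoin ⟨i, β, rfl⟩)

lemma jj_comm {i k : ℕ} (h : i ≠ k) (a b : Matrix ι ι L) : Commute (jj i a) (jj k b) :=
  Subtype.ext (jE_comm h a b)

def al (p : ℕ → ℕ) (hp : Function.Injective p) : Al L ι →ₐ[L] Al L ι :=
  ((alE p hp).comp (Alval L ι)).codRestrict (AA L ι) (fun x => alE_mem p hp x.2)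

lemma al_jj (p : ℕ → ℕ) (hp : Function.Injective p) (i : ℕ) (β : Matrix ι ι L) :
    al p hp (jj i β) = jj (p i) β := Subtype.ext (alE_j p hp i β)

/-- algebra on the strands in S -/
def Str (L ι : Type*) [Field L] [Fintype ι] [DecidableEq ι] (S : Set ℕ) : Subalgebra L (Al L ι) :=
  Algebra.adjoin L {x | ∃ i ∈ S, ∃ β, x = jj i β}


lemma Str_mono {S S' : Set ℕ} (h : S ⊆ S') : Str L ι S ≤ Str L ι S' :=
  Algebra.adjoin_mono (fun _ ⟨i, hi, hx⟩ => ⟨i, h hi, hx⟩)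

lemma jj_mem {S : Set ℕ} {i : ℕ} (h : i ∈ S) (β : Matrix ι ι L) : jj i β ∈ Str L ι S :=
  Algebra.subset_adjoin ⟨i, h, β, rfl⟩

lemma Str_comm_j {S : Set ℕ} {k : ℕ} (hk : k ∉ S) {x : Al L ι} (hx : x ∈ Str L ι S) (β : Matrix ι ι L) :
    Commute x (jj k β) := by
  induction hx using Algebra.adjoin_induction with
  | mem x h => obtain ⟨i, hi, γ, rfl⟩ := h; exact jj_comm (fun (e : i = k) => hk (by rw [← e]; exact hi)) _ _
  | algebraMap c => exact Algebra.commutes c _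
  | add a b _ _ ha hb => exact ha.add_left hb
  | mul a b _ _ ha hb => exact ha.mul_left hb

lemma Str_comm {S S' : Set ℕ} (h : Disjoint S S') {x y : Al L ι} (hx : x ∈ Str L ι S) (hy : y ∈ Str L ι S') :
    Commute x y := by
  induction hy using Algebra.adjoin_induction with
  | mem y h' =>
    obtain ⟨i, hi, γ, rfl⟩ := h'; exact Str_comm_j (fun h'' => Set.disjoint_left.1 h h'' hi) hx _
  | algebraMap c => exact (Algebra.commutes c _).symm
  | add a b _ _ ha hb => exact ha.add_right hb
  | mul a b _ _ ha hb => exact ha.mul_right hb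

lemma al_fix (p : ℕ → ℕ) (hp : Function.Injective p) {S : Set ℕ} (h : ∀ i ∈ S, p i = i) {x : Al L ι}
    (hx : x ∈ Str L ι S) : al p hp x = x := by
  induction hx using Algebra.adjoin_induction with
  | mem x h' => obtain ⟨i, hi, γ, rfl⟩ := h'; rw [al_jj, h i hi]
  | algebraMap c => exact AlgHom.commutes _ c
  | add a b _ _ ha hb => rw [map_add, ha, hb]
  | mul a b _ _ ha hb => rw [map_mul, ha, hb]

lemma al_mem (p : ℕ → ℕ) (hp : Function.Injective p) {S S' : Set ℕ} (h : ∀ i ∈ S, p i ∈ S') {x : Al L ι}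
    (hx : x ∈ Str L ι S) : al p hp x ∈ Str L ι S' := by
  induction hx using Algebra.adjoin_induction with
  | mem x h' => obtain ⟨i, hi, γ, rfl⟩ := h'; rw [al_jj]; exact jj_mem (h i hi) _
  | algebraMap c => rw [AlgHom.commutes]; exact Subalgebra.algebraMap_mem _ c
  | add a b _ _ ha hb => rw [map_add]; exact add_mem ha hb
  | mul a b _ _ ha hb => rw [map_mul]; exact mul_mem ha hb

lemma Str_AAn {n : ℕ} {x : Al L ι} (hx : x ∈ Str L ι (Set.Iio n)) : x.1 ∈ AAn L ι n := by
  induction hx using Algebra.adjoin_induction with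
  | mem x h' => obtain ⟨i, hi, γ, rfl⟩ := h'; exact jE_mem_AAn hi γ
  | algebraMap c => exact Subalgebra.algebraMap_mem _ c
  | add a b _ _ ha hb => exact add_mem ha hb
  | mul a b _ _ ha hb => exact mul_mem ha hb

lemma Str_univ (x : Al L ι) : x ∈ Str L ι Set.univ := by
  obtain ⟨x, hx⟩ := x
  induction hx using Algebra.adjoin_induction with
  | mem x h' => obtain ⟨i, γ, rfl⟩ := h'; exact jj_mem (Set.mem_univ i) γ
  | algebraMap c => exact Subalgebra.algebraMap_mem _ c
  | add a b ha' hb' ha hb =>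
    exact add_mem (a := (⟨a, ha'⟩ : Al L ι)) (b := (⟨b, hb'⟩ : Al L ι)) ha hb
  | mul a b ha' hb' ha hb =>
    exact mul_mem (a := (⟨a, ha'⟩ : Al L ι)) (b := (⟨b, hb'⟩ : Al L ι)) ha hb

/-- normalized matrix trace -/
def nb (β : Matrix ι ι L) : L := (Fintype.card ι : L)⁻¹ * β.trace

lemma nb_smul (c : L) (β : Matrix ι ι L) : nb (c • β) = c * nb β := by
  simp [nb, Matrix.trace_smul]; ring

lemma nb_add (β γ : Matrix ι ι L) : nb (β + γ) = nb β + nb γ := by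
  simp [nb, Matrix.trace_add, mul_add]

lemma nb_one : nb (1 : Matrix ι ι L) = 1 := by
  simp [nb, Matrix.trace_one, card_ne]

lemma nu_mul_j' {k : ℕ} {x : Al L ι} (hx : ∀ γ, Commute x (jj k γ)) (β : Matrix ι ι L) :
    nu (x * jj k β) = nu x * nb β := by
  have hoff : ∀ a b : ι, a ≠ b → nu (x * jj k (Matrix.single a b 1)) = 0 := by
    intro a b hab
    have e : (Matrix.single a b 1 : Matrix ι ι L) = Matrix.single a a 1 * Matrix.single a b 1 := by simp
    rw [e, map_mul (jj k), ← mul_assoc, nu_comm, ← mul_assoc, ← (hx _).eq, mul_assoc, ← map_mul (jj k),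
      Matrix.single_mul_single_of_ne _ _ _ _ hab.symm]
    simp
  have hdiag : ∀ a b : ι, nu (x * jj k (Matrix.single a a 1)) = nu (x * jj k (Matrix.single b b 1)) := by
    intro a b
    have e : (Matrix.single a a 1 : Matrix ι ι L) = Matrix.single a b 1 * Matrix.single b a 1 := by simp
    rw [e, map_mul (jj k), ← mul_assoc, nu_comm, ← mul_assoc, ← (hx _).eq, mul_assoc, ← map_mul (jj k)]
    simp
  have hd : ∀ a : ι, nu (x * jj k (Matrix.single a a 1)) = (Fintype.card ι : L)⁻¹ * nu x := by
    intro a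
    have : nu x = ∑ b, nu (x * jj k (Matrix.single b b 1)) := by
      rw [← map_sum, ← Finset.mul_sum, ← map_sum]
      have : ∑ b : ι, (Matrix.single b b (1:L)) = 1 := by
        ext u v
        rw [Matrix.sum_apply, Finset.sum_eq_single u (fun b _ hb => by simp [Matrix.single_apply, hb]) (by simp)]
        simp [Matrix.single_apply, Matrix.one_apply]
      rw [this, map_one, mul_one]
    rw [this, Finset.sum_congr rfl (fun b _ => hdiag b a)]
    have := card_ne (L := L) (ι := ι)
    simp [this]
  conv_lhs => rw [Matrix.matrix_eq_sum_single β]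
  simp only [map_sum, Finset.mul_sum]
  have : ∀ a b : ι, nu (x * jj k (Matrix.single a b (β a b))) =
      if a = b then β a b * ((Fintype.card ι : L)⁻¹ * nu x) else 0 := by
    intro a b
    have e : (Matrix.single a b (β a b) : Matrix ι ι L) = β a b • Matrix.single a b 1 := by simp
    rw [e, map_smul, mul_smul_comm, map_smul, smul_eq_mul]
    split_ifs with h
    · subst h; rw [hd]
    · rw [hoff a b h, mul_zero]
  simp only [this]
  simp [nb, Matrix.trace, Finset.mul_sum]
  exact Finset.sum_congr rfl fun _ _ => by ring

lemma nu_mul_j {S : Set ℕ} {k : ℕ} (hk : k ∉ S) {x : Al L ι} (hx : x ∈ Str L ι S) (β : Matrix ι ι L) :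
    nu (x * jj k β) = nu x * nb β := nu_mul_j' (fun γ => Str_comm_j hk hx γ) β

lemma nu_jj (k : ℕ) (β : Matrix ι ι L) : nu (jj k β) = nb β := by
  have := nu_mul_j (S := ∅) (Set.notMem_empty k) (one_mem (Str L ι ∅)) β
  simpa [nu_one] using this

/-- every element of Str (insert) expands. -/
lemma Str_insert {S : Set ℕ} {k : ℕ} (hk : k ∉ S) {x : Al L ι} (hx : x ∈ Str L ι (insert k S)) :
    x ∈ Submodule.span L {y | ∃ β, ∃ z ∈ Str L ι S, y = z * jj k β} := by
  have hmul : ∀ a b : Al L ι, a ∈ Submodule.span L {y | ∃ β, ∃ z ∈ Str L ι S, y = z * jj k β} →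
      b ∈ Submodule.span L {y | ∃ β, ∃ z ∈ Str L ι S, y = z * jj k β} →
      a * b ∈ Submodule.span L {y | ∃ β, ∃ z ∈ Str L ι S, y = z * jj k β} := by
    intro a b ha hb
    have := Submodule.mul_mem_mul ha hb
    rw [Submodule.span_mul_span] at this
    refine Submodule.span_mono ?_ this
    rintro _ ⟨_, ⟨β, z, hz, rfl⟩, _, ⟨γ, w, hw, rfl⟩, rfl⟩
    refine ⟨β * γ, z * w, mul_mem hz hw, ?_⟩
    simp only [map_mul]
    calc z * jj k β * (w * jj k γ) = z * (jj k β * w) * jj k γ := by simp only [mul_assoc]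
      _ = _ := by rw [← (Str_comm_j hk hw β).eq]; simp only [mul_assoc]
  induction hx using Algebra.adjoin_induction with
  | mem x h' =>
    obtain ⟨i, hi, γ, rfl⟩ := h'
    rcases hi with rfl | hi
    · exact Submodule.subset_span ⟨γ, 1, one_mem _, by simp⟩
    · exact Submodule.subset_span ⟨1, _, jj_mem hi γ, by simp⟩
  | algebraMap c => exact Submodule.subset_span ⟨1, _, Subalgebra.algebraMap_mem _ c, by simp⟩
  | add a b _ _ ha hb => exact add_mem ha hb
  | mul a b _ _ ha hb => exact hmul _ _ ha hb

/-- functional factorization on disjoint finite strands -/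
lemma nu_disj_aux {S : Set ℕ} : ∀ (F : Finset ℕ), Disjoint S (F : Set ℕ) → ∀ x ∈ Str L ι S,
    ∀ y ∈ Str L ι (F : Set ℕ), nu (x * y) = nu x * nu y := by
  intro F
  induction F using Finset.induction_on with
  | empty =>
    intro _ x hx y hy
    have : y ∈ (⊥ : Subalgebra L (Al L ι)) := by
      have h0 : {x | ∃ i ∈ ((∅ : Finset ℕ) : Set ℕ), ∃ β, x = jj (L := L) (ι := ι) i β} = ∅ := by ext; simp
      rw [Str, h0, Algebra.adjoin_empty] at hy; exact hy
    obtain ⟨c, rfl⟩ := Algebra.mem_bot.1 this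
    rw [Algebra.algebraMap_eq_smul_one, mul_smul_comm, map_smul, map_smul, nu_one, mul_one]
    simp [mul_comm]
  | insert k F hk ih =>
    intro hd x hx y hy
    rw [Finset.coe_insert] at hy hd
    have hy' := Str_insert (by simpa using hk) hy
    have hkS : k ∉ S := fun h => Set.disjoint_left.1 hd h (Set.mem_insert _ _)
    have hd' : Disjoint S (F : Set ℕ) := hd.mono_right (Set.subset_insert _ _)
    induction hy' using Submodule.span_induction with
    | zero => simp
    | add a b ha' hb' ha hb =>
      have hm : ∀ a, a ∈ Submodule.span L {y | ∃ β, ∃ z ∈ Str L ι (F : Set ℕ), y = z * jj k β} →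
          a ∈ Str L ι (insert k (F : Set ℕ)) := by
        intro a ha
        have : Submodule.span L {y | ∃ β, ∃ z ∈ Str L ι (F : Set ℕ), y = z * jj k β} ≤
            Subalgebra.toSubmodule (Str L ι (insert k (F : Set ℕ))) := by
          refine Submodule.span_le.2 ?_
          rintro _ ⟨β, z, hz, rfl⟩
          show _ ∈ Str L ι (insert k (F : Set ℕ))
          exact mul_mem (Str_mono (Set.subset_insert _ _) hz) (jj_mem (Set.mem_insert _ _) β)
        exact this ha
      rw [mul_add, map_add, map_add, ha (hm a ha'), hb (hm b hb'), mul_add]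
    | smul c a ha' ha =>
      have hm : ∀ a, a ∈ Submodule.span L {y | ∃ β, ∃ z ∈ Str L ι (F : Set ℕ), y = z * jj k β} →
          a ∈ Str L ι (insert k (F : Set ℕ)) := by
        intro a ha
        have : Submodule.span L {y | ∃ β, ∃ z ∈ Str L ι (F : Set ℕ), y = z * jj k β} ≤
            Subalgebra.toSubmodule (Str L ι (insert k (F : Set ℕ))) := by
          refine Submodule.span_le.2 ?_
          rintro _ ⟨β, z, hz, rfl⟩
          show _ ∈ Str L ι (insert k (F : Set ℕ))
          exact mul_mem (Str_mono (Set.subset_insert _ _) hz) (jj_mem (Set.mem_insert _ _) β)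
        exact this ha
      rw [mul_smul_comm, map_smul, map_smul, ha (hm a ha')]; simp; ring
    | mem a h =>
      obtain ⟨β, z, hz, rfl⟩ := h
      rw [← mul_assoc, nu_mul_j (S := S ∪ F) (by simp [hkS, hk])
        (mul_mem (Str_mono Set.subset_union_left hx) (Str_mono Set.subset_union_right hz)),
        ih hd' x hx z hz, nu_mul_j (by simpa using hk) hz]
      ring

/-- ν is invariant under relabelling -/
lemma nu_al_aux (p : ℕ → ℕ) (hp : Function.Injective p) : ∀ (F : Finset ℕ), ∀ y ∈ Str L ι (F : Set ℕ),
    nu (al p hp y) = nu y := by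
  intro F
  induction F using Finset.induction_on with
  | empty =>
    intro y hy
    have : y ∈ (⊥ : Subalgebra L (Al L ι)) := by
      have h0 : {x | ∃ i ∈ ((∅ : Finset ℕ) : Set ℕ), ∃ β, x = jj (L := L) (ι := ι) i β} = ∅ := by ext; simp
      rw [Str, h0, Algebra.adjoin_empty] at hy; exact hy
    obtain ⟨c, rfl⟩ := Algebra.mem_bot.1 this
    rw [AlgHom.commutes]
  | insert k F hk ih =>
    intro y hy
    rw [Finset.coe_insert] at hy
    have hy' := Str_insert (by simpa using hk) hy
    have key : ∀ y ∈ Submodule.span L {y | ∃ β, ∃ z ∈ Str L ι (F : Set ℕ), y = z * jj k β},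
        nu (al p hp y) = nu y := by
      intro y hy'
      induction hy' using Submodule.span_induction with
      | zero => simp
      | add a b _ _ ha hb => rw [map_add, map_add, map_add, ha, hb]
      | smul c a _ ha => rw [map_smul, map_smul, map_smul, ha]
      | mem a h =>
        obtain ⟨β, z, hz, rfl⟩ := h
        rw [map_mul, al_jj, nu_mul_j (S := p '' (F : Set ℕ)) (k := p k) (fun h => by
          obtain ⟨i, hi, e⟩ := h
          have e := hp e
          subst e
          exact hk (by exact_mod_cast hi)) (al_mem p hp (S := (F : Set ℕ)) (S' := p '' (F : Set ℕ)) (fun i hi => ⟨i, hi, rfl⟩) hz),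
          ih z hz, nu_mul_j (by simpa using hk) hz]
    exact key y hy'

end
end HS

set_option linter.all false
namespace HS
open Matrix Kronecker

noncomputable section

section tens
variable {L A ι κ : Type*} [Field L] [Ring A] [Algebra L A] [Fintype ι] [DecidableEq ι] [Fintype κ] [DecidableEq κ]

/-- product of two commuting matrix units systems -/
def tens (f : Matrix ι ι L →ₐ[L] A) (g : Matrix κ κ L →ₐ[L] A) : Matrix (ι × κ) (ι × κ) L →ₗ[L] A where
  toFun M := ∑ p, ∑ r, M p r • (f (single p.1 r.1 1) * g (single p.2 r.2 1))
  map_add' M N := by simp [add_smul, Finset.sum_add_distrib]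
  map_smul' c M := by simp [Finset.smul_sum, mul_smul]

lemma tens_apply (f : Matrix ι ι L →ₐ[L] A) (g : Matrix κ κ L →ₐ[L] A) (M : Matrix (ι × κ) (ι × κ) L) :
    tens f g M = ∑ p, ∑ r, M p r • (f (single p.1 r.1 1) * g (single p.2 r.2 1)) := rfl

lemma tens_single (f : Matrix ι ι L →ₐ[L] A) (g : Matrix κ κ L →ₐ[L] A) (p r : ι × κ) :
    tens f g (single p r 1) = f (single p.1 r.1 1) * g (single p.2 r.2 1) := by
  rw [tens_apply, Finset.sum_eq_single p, Finset.sum_eq_single r]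
  · simp
  · intro b _ hb; rw [single_apply_of_col_ne _ _ hb.symm]; simp
  · simp
  · intro b _ hb
    refine Finset.sum_eq_zero fun x _ => ?_
    rw [single_apply_of_row_ne hb.symm]; simp
  · simp

lemma mat_ind {ι : Type*} [Fintype ι] [DecidableEq ι] (p : Matrix ι ι L → Prop) (h0 : p 0) (ha : ∀ M N, p M → p N → p (M + N))
    (hs : ∀ (c : L) M, p M → p (c • M)) (h1 : ∀ i j, p (single i j 1)) : ∀ M, p M := by
  intro M
  rw [matrix_eq_sum_single M]
  have hsum : ∀ (s : Finset ι) (F : ι → Matrix ι ι L), (∀ i, p (F i)) → p (∑ i ∈ s, F i) := by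
    intro s F hF
    exact Finset.sum_induction _ p (fun a b => ha a b) h0 (fun i _ => hF i)
  refine hsum _ _ fun i => hsum _ _ fun j => ?_
  have : (single i j (M i j) : Matrix ι ι L) = M i j • single i j 1 := by rw [smul_single]; simp
  rw [this]; exact hs _ _ (h1 i j)

lemma tens_kron (f : Matrix ι ι L →ₐ[L] A) (g : Matrix κ κ L →ₐ[L] A) (α : Matrix ι ι L) (β : Matrix κ κ L) :
    tens f g (α ⊗ₖ β) = f α * g β := by
  refine mat_ind (fun α => tens f g (α ⊗ₖ β) = f α * g β) (by simp)
    (fun a b ha hb => by simp only [add_kronecker, map_add, ha, hb, add_mul])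
    (fun c a ha => by simp only [smul_kronecker, smul_mul_assoc, map_smul, ha]) (fun i j => ?_) α
  refine mat_ind (fun β => tens f g (single i j 1 ⊗ₖ β) = f (single i j 1) * g β) (by simp)
    (fun a b ha hb => by simp only [kronecker_add, map_add, ha, hb, mul_add])
    (fun c a ha => by simp only [kronecker_smul, mul_smul_comm, map_smul, ha]) (fun k l => ?_) β
  rw [single_kronecker_single, mul_one, tens_single]

lemma tens_one (f : Matrix ι ι L →ₐ[L] A) (g : Matrix κ κ L →ₐ[L] A) : tens f g 1 = 1 := by
  rw [← one_kronecker_one, tens_kron, map_one, map_one, one_mul]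

lemma tens_mul (f : Matrix ι ι L →ₐ[L] A) (g : Matrix κ κ L →ₐ[L] A)
    (hfg : ∀ a b, Commute (f a) (g b)) (M N : Matrix (ι × κ) (ι × κ) L) :
    tens f g (M * N) = tens f g M * tens f g N := by
  refine mat_ind (fun M => tens f g (M * N) = tens f g M * tens f g N) (by simp)
    (fun a b ha hb => by simp only [add_mul, map_add, ha, hb])
    (fun c a ha => by simp only [smul_mul_assoc, map_smul, ha]) (fun i j => ?_) M
  refine mat_ind (fun N => tens f g (single i j 1 * N) = tens f g (single i j 1) * tens f g N) (by simp)
    (fun a b ha hb => by simp only [mul_add, map_add, ha, hb])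
    (fun c a ha => by simp only [mul_smul_comm, map_smul, ha]) (fun k l => ?_) N
  have e : f (single i.1 j.1 1) * g (single i.2 j.2 1) * (f (single k.1 l.1 1) * g (single k.2 l.2 1))
      = f (single i.1 j.1 1 * single k.1 l.1 1) * g (single i.2 j.2 1 * single k.2 l.2 1) := by
    rw [map_mul, map_mul, mul_assoc, ← mul_assoc (g _) (f _), ← (hfg _ _).eq]; simp only [mul_assoc]
  rw [tens_single, tens_single, e]
  by_cases h : j = k
  · subst h; simp [tens_single]
  · rw [single_mul_single_of_ne _ _ _ _ h, map_zero]
    by_cases h1 : j.1 = k.1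
    · have h2 : j.2 ≠ k.2 := fun h2 => h (Prod.ext h1 h2)
      rw [single_mul_single_of_ne (i := i.2) (h := h2), map_zero, mul_zero]
    · rw [single_mul_single_of_ne (i := i.1) (h := h1), map_zero, zero_mul]

def tensA (f : Matrix ι ι L →ₐ[L] A) (g : Matrix κ κ L →ₐ[L] A) (hfg : ∀ a b, Commute (f a) (g b)) :
    Matrix (ι × κ) (ι × κ) L →ₐ[L] A :=
  AlgHom.ofLinearMap (tens f g) (tens_one f g) (tens_mul f g hfg)

lemma tensA_apply (f : Matrix ι ι L →ₐ[L] A) (g : Matrix κ κ L →ₐ[L] A) (hfg : ∀ a b, Commute (f a) (g b)) (M) :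
   tensA f g hfg M = tens f g M := rfl

end tens

variable {L ι : Type*} [Field L] [Fintype ι] [DecidableEq ι]

def R1 (R : Matrix (ι × ι) (ι × ι) L) : Matrix (ι × ι × ι) (ι × ι × ι) L :=
  (R ⊗ₖ (1 : Matrix ι ι L)).submatrix (Equiv.prodAssoc ι ι ι).symm (Equiv.prodAssoc ι ι ι).symm
def R2 (R : Matrix (ι × ι) (ι × ι) L) : Matrix (ι × ι × ι) (ι × ι × ι) L := (1 : Matrix ι ι L) ⊗ₖ R

variable [CharZero L] [Nonempty ι]
def tw (i k : ℕ) : Matrix (ι × ι) (ι × ι) L →ₗ[L] Al L ι := tens (jj i) (jj k)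

lemma tw_mul {i k : ℕ} (h : i ≠ k) (M N : Matrix (ι × ι) (ι × ι) L) : tw i k (M * N) = tw i k M * tw i k N :=
  tens_mul _ _ (jj_comm h) M N

lemma tw_one (i k : ℕ) : tw i k (1 : Matrix (ι × ι) (ι × ι) L) = 1 := tens_one _ _

lemma tw_kron (i k : ℕ) (α β : Matrix ι ι L) : tw i k (α ⊗ₖ β) = jj i α * jj k β := tens_kron _ _ _ _

lemma tw_mem {S : Set ℕ} {i k : ℕ} (hi : i ∈ S) (hk : k ∈ S) (M : Matrix (ι × ι) (ι × ι) L) : tw i k M ∈ Str L ι S := by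
  rw [tw, tens_apply]
  exact sum_mem fun p _ => sum_mem fun r _ => Subalgebra.smul_mem _ (mul_mem (jj_mem hi _) (jj_mem hk _)) _

lemma al_tw (p : ℕ → ℕ) (hp : Function.Injective p) (i k : ℕ) (M : Matrix (ι × ι) (ι × ι) L) :
    al p hp (tw i k M) = tw (p i) (p k) M := by
  simp only [tw, tens_apply, map_sum, map_smul, map_mul, al_jj]

lemma tw_swap {i k : ℕ} (h : i ≠ k) (M : Matrix (ι × ι) (ι × ι) L) :
    tw i k M = tw k i (M.submatrix Prod.swap Prod.swap) := by
  simp only [tw, tens_apply]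
  rw [← (Equiv.prodComm ι ι).sum_comp]
  refine Finset.sum_congr rfl fun p _ => ?_
  rw [← (Equiv.prodComm ι ι).sum_comp]
  refine Finset.sum_congr rfl fun r _ => ?_
  simp only [Equiv.prodComm_apply, Prod.fst_swap, Prod.snd_swap, submatrix_apply]
  rw [(jj_comm h _ _).eq]

lemma kron_comm {f : ℕ → ℕ} {i k : ℕ} (h : i ≠ k) {t : Matrix ι ι L} {R : Matrix (ι × ι) (ι × ι) L}
    (ht : Commute R (t ⊗ₖ t)) : Commute (tw i k R) (jj i t * jj k t) := by
  rw [← tw_kron]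
  show _ * _ = _ * _
  rw [← tw_mul h, ← tw_mul h, ht.eq]

lemma tens_R1 {i j k : ℕ} (hij : i ≠ j) (hik : i ≠ k) (hjk : j ≠ k) (R : Matrix (ι × ι) (ι × ι) L) :
    tens (jj i) (tensA (jj j) (jj k) (jj_comm hjk)) (R1 R) = tw i j R := by
  have e : R1 R = ∑ p, ∑ r, R p r • (single p.1 r.1 1 ⊗ₖ (single p.2 r.2 1 ⊗ₖ (1 : Matrix ι ι L))) := by
    ext ⟨a, b, c⟩ ⟨x, y, z⟩
    simp only [R1, submatrix_apply, Equiv.prodAssoc_symm_apply, kroneckerMap_apply, Matrix.sum_apply, Matrix.smul_apply, smul_eq_mul]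
    rw [Finset.sum_eq_single (a, b), Finset.sum_eq_single (x, y)]
    · simp
    · rintro ⟨x', y'⟩ _ hb
      by_cases h : x' = x
      · subst h
        have : y' ≠ y := fun h' => hb (by rw [h'])
        rw [single_apply_of_col_ne (hj := this)]; simp
      · rw [single_apply_of_col_ne (hj := h)]; simp
    · simp
    · rintro ⟨x', y'⟩ _ hb
      refine Finset.sum_eq_zero fun u _ => ?_
      by_cases h : x' = a
      · subst h
        have : y' ≠ b := fun h' => hb (by rw [h'])
        rw [single_apply_of_row_ne (hi := this)]; simp
      · rw [single_apply_of_row_ne (hi := h)]; simp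
    · simp
  rw [e, tw, tens_apply (jj i) (jj j)]
  simp only [map_sum, map_smul, tens_kron, tensA_apply, map_one, mul_one]

lemma tens_R2 {i j k : ℕ} (hij : i ≠ j) (hik : i ≠ k) (hjk : j ≠ k) (R : Matrix (ι × ι) (ι × ι) L) :
    tens (jj i) (tensA (jj j) (jj k) (jj_comm hjk)) (R2 R) = tw j k R := by
  rw [R2, tens_kron, map_one, one_mul, tensA_apply]; rfl

lemma tw_braid {i j k : ℕ} (hij : i ≠ j) (hik : i ≠ k) (hjk : j ≠ k) {R : Matrix (ι × ι) (ι × ι) L}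
    (hb : R1 R * R2 R * R1 R = R2 R * R1 R * R2 R) :
    tw i j R * tw j k R * tw i j R = tw j k R * tw i j R * tw j k R := by
  have hc : ∀ a b, Commute (jj i a) (tensA (jj j) (jj k) (jj_comm (L := L) (ι := ι) hjk) b) := by
    intro a b
    refine (Str_comm_j (S := {j, k}) (by simp [hij, hik]) ?_ a).symm
    exact tw_mem (by simp) (by simp) b
  have := congrArg (tens (jj i) (tensA (jj j) (jj k) (jj_comm hjk))) hb
  simpa only [tens_mul _ _ hc, tens_R1 hij hik hjk, tens_R2 hij hik hjk] using this

def Tn (R : Matrix (ι × ι) (ι × ι) L) (i : ℕ) : Al L ι := tw i (i+1) R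

lemma Tn_hecke {R : Matrix (ι × ι) (ι × ι) L} {q : L} (hb : R1 R * R2 R * R1 R = R2 R * R1 R * R2 R)
    (hquad : R * R = (q - 1) • R + q • 1) : IsHecke q (Tn R) where
  quad i := by rw [Tn, ← tw_mul (by omega), hquad, map_add, map_smul, map_smul, tw_one]
  braid i := tw_braid (by omega) (by omega) (by omega) hb
  comm i j h := by
    refine Str_comm (S := {i, i+1}) (S' := {j, j+1}) ?_ (tw_mem (by simp) (by simp) R) (tw_mem (by simp) (by simp) R)
    rw [Set.disjoint_left]; simp; omega

lemma HH_Str {R : Matrix (ι × ι) (ι × ι) L} {r : ℕ} {x} (hx : x ∈ HH L (Tn R) r) : x ∈ Str L ι (Set.Iio (r+1)) := by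
  refine Algebra.adjoin_le ?_ hx
  rintro _ ⟨i, hi, rfl⟩
  exact tw_mem (by simp; omega) (by simp; omega) R

/-- partial closure -/
def ph (R : Matrix (ι × ι) (ι × ι) L) (β : Matrix ι ι L) : Matrix ι ι L :=
  of fun a c => (Fintype.card ι : L)⁻¹ * ∑ b, ∑ d, R (a, b) (c, d) * β d b

def ph' (R : Matrix (ι × ι) (ι × ι) L) (β : Matrix ι ι L) : Matrix ι ι L := ph (R.submatrix Prod.swap Prod.swap) β

lemma Str_finite {S : Set ℕ} {x : Al L ι} (hx : x ∈ Str L ι S) : ∃ F : Finset ℕ, (F : Set ℕ) ⊆ S ∧ x ∈ Str L ι (F : Set ℕ) := by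
  induction hx using Algebra.adjoin_induction with
  | mem x h => obtain ⟨i, hi, γ, rfl⟩ := h; exact ⟨{i}, by simpa using hi, jj_mem (by simp) _⟩
  | algebraMap c => exact ⟨∅, by simp, Subalgebra.algebraMap_mem _ c⟩
  | add a b _ _ ha hb =>
    obtain ⟨F, h1, h2⟩ := ha; obtain ⟨G, h3, h4⟩ := hb
    exact ⟨F ∪ G, by simp [h1, h3], add_mem (Str_mono (by simp) h2) (Str_mono (by simp) h4)⟩
  | mul a b _ _ ha hb =>
    obtain ⟨F, h1, h2⟩ := ha; obtain ⟨G, h3, h4⟩ := hb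
    exact ⟨F ∪ G, by simp [h1, h3], mul_mem (Str_mono (by simp) h2) (Str_mono (by simp) h4)⟩

lemma nu_disj {S S' : Set ℕ} (h : Disjoint S S') {x y : Al L ι} (hx : x ∈ Str L ι S) (hy : y ∈ Str L ι S') :
    nu (x * y) = nu x * nu y := by
  obtain ⟨F, h1, h2⟩ := Str_finite hy
  exact nu_disj_aux F (h.mono_right h1) x hx y h2

lemma nu_al (p : ℕ → ℕ) (hp : Function.Injective p) (x : Al L ι) : nu (al p hp x) = nu x := by
  obtain ⟨F, h1, h2⟩ := Str_finite (Str_univ x)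
  exact nu_al_aux p hp F x h2

/-- close the second strand -/
lemma nu_close {S : Set ℕ} {i k : ℕ} (h : i ≠ k) (hk : k ∉ S) {A : Al L ι} (hA : A ∈ Str L ι S)
    (R : Matrix (ι × ι) (ι × ι) L) (β : Matrix ι ι L) :
    nu (A * tw i k R * jj k β) = nu (A * jj i (ph R β)) := by
  have hk' : k ∉ insert i S := by simp [hk, h.symm]
  have hr : ph R β = ∑ p : ι × ι, ∑ r : ι × ι, (R p r * ((Fintype.card ι : L)⁻¹ * β r.2 p.2)) • single p.1 r.1 1 := by
    ext a c
    simp only [ph, of_apply, Matrix.sum_apply, Matrix.smul_apply, smul_eq_mul]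
    symm
    rw [Fintype.sum_prod_type, Finset.sum_eq_single (a := a), Finset.mul_sum]
    · refine Finset.sum_congr rfl fun b _ => ?_
      rw [Fintype.sum_prod_type, Finset.sum_eq_single c, Finset.mul_sum]
      · refine Finset.sum_congr rfl fun d _ => ?_
        simp; ring
      · intro x _ hx; simp [single_apply_of_col_ne _ _ hx]
      · simp
    · intro x _ hx; simp [single_apply_of_row_ne hx]
    · simp
  rw [hr, tw, tens_apply]
  simp only [Finset.mul_sum, Finset.sum_mul, map_sum, mul_smul_comm, smul_mul_assoc, map_smul]
  refine Finset.sum_congr rfl fun p _ => Finset.sum_congr rfl fun r _ => ?_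
  have e1 : A * (jj i (single p.1 r.1 1) * jj k (single p.2 r.2 1)) * jj k β
      = A * jj i (single p.1 r.1 1) * jj k (single p.2 r.2 1 * β) := by
    rw [map_mul]; simp only [mul_assoc]
  rw [e1, nu_mul_j hk' (mul_mem (Str_mono (Set.subset_insert _ _) hA) (jj_mem (Set.mem_insert _ _) _))]
  have e2 : nb (single p.2 r.2 1 * β) = (Fintype.card ι : L)⁻¹ * β r.2 p.2 := by
    rw [nb, trace]
    simp only [diag_apply]
    rw [Finset.sum_eq_single p.2]
    · simp
    · intro b _ hb; rw [single_mul_apply_of_ne]; exact hb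
    · simp
  rw [e2, smul_eq_mul, smul_eq_mul]; ring

lemma nu_close' {S : Set ℕ} {i k : ℕ} (h : i ≠ k) (hi : i ∉ S) {A : Al L ι} (hA : A ∈ Str L ι S)
    (R : Matrix (ι × ι) (ι × ι) L) (α : Matrix ι ι L) :
    nu (A * tw i k R * jj i α) = nu (A * jj k (ph' R α)) := by
  rw [tw_swap h, nu_close h.symm hi hA]; rfl

lemma nb_adj (R : Matrix (ι × ι) (ι × ι) L) (α β : Matrix ι ι L) : nb (α * ph R β) = nb (β * ph' R α) := by
  have h1 := nu_close (S := {0}) (i := 0) (k := 1) (by simp) (by simp) (jj_mem (i := 0) (by simp) α) R β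
  have h2 := nu_close' (S := {1}) (i := 0) (k := 1) (by simp) (by simp) (jj_mem (i := 1) (by simp) β) R α
  rw [← map_mul, nu_jj] at h1 h2
  rw [← h1, ← h2, mul_assoc (jj 1 β), nu_comm (jj 1 β), mul_assoc, nu_comm (jj 0 α), mul_assoc, mul_assoc,
    (jj_comm (by simp) _ _).eq]

end
end HS

set_option linter.all false
namespace HS
open Matrix Kronecker

noncomputable section
variable {L ι : Type*} [Field L] [Fintype ι] [DecidableEq ι] [CharZero L] [Nonempty ι]

/-- product over strands [a,a+n) -/
def tp (t : Matrix ι ι L) (a : ℕ) : ℕ → Al L ι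
  | 0 => 1
  | n+1 => tp t a n * jj (a+n) t

lemma tp_mem (t : Matrix ι ι L) (a n : ℕ) {S : Set ℕ} (h : ∀ i, a ≤ i → i < a + n → i ∈ S) : tp t a n ∈ Str L ι S := by
  induction n with
  | zero => exact one_mem _
  | succ n ih => exact mul_mem (ih fun i h1 h2 => h i h1 (by omega)) (jj_mem (h _ (by omega) (by omega)) _)

lemma tp_add (t : Matrix ι ι L) (a n m : ℕ) : tp t a (n+m) = tp t a n * tp t (a+n) m := by
  induction m with
  | zero => simp [tp]
  | succ m ih => rw [← add_assoc, tp, ih, tp, mul_assoc, add_assoc]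

lemma tp_succ' (t : Matrix ι ι L) (a n : ℕ) : tp t a (n+1) = jj a t * tp t (a+1) n := by
  rw [add_comm, tp_add]; simp [tp]

lemma tp_mul (t u : Matrix ι ι L) (a n : ℕ) : tp (t * u) a n = tp t a n * tp u a n := by
  induction n with
  | zero => simp [tp]
  | succ n ih =>
    have hc : Commute (tp u a n) (jj (a+n) t) :=
      Str_comm_j (S := Set.Iio (a+n)) (by simp) (tp_mem _ _ _ (fun i _ h => h)) _
    rw [tp, tp, tp, ih, map_mul]
    simp only [mul_assoc]
    rw [← mul_assoc (tp u a n), hc.eq, mul_assoc]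

lemma tp_smul (c : L) (t : Matrix ι ι L) (a n : ℕ) : tp (c • t) a n = c ^ n • tp t a n := by
  induction n with
  | zero => simp [tp]
  | succ n ih => rw [tp, tp, ih, map_smul, smul_mul_smul_comm, pow_succ]

lemma tp_one (a n : ℕ) : tp (1 : Matrix ι ι L) a n = 1 := by
  induction n with
  | zero => simp [tp]
  | succ n ih => rw [tp, ih, map_one, one_mul]

lemma al_tp (p : ℕ → ℕ) (hp : Function.Injective p) (t : Matrix ι ι L) (a b n : ℕ) (h : ∀ i, p (a + i) = b + i) :
    al p hp (tp t a n) = tp t b n := by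
  induction n with
  | zero => simp [tp]
  | succ n ih => rw [tp, tp, map_mul, ih, al_jj, h]

lemma T_tp {R : Matrix (ι × ι) (ι × ι) L} {t : Matrix ι ι L} (ht : Commute R (t ⊗ₖ t)) {a n i : ℕ} (h1 : a ≤ i) (h2 : i + 1 < a + n) :
    Commute (Tn R i) (tp t a n) := by
  induction n with
  | zero => omega
  | succ n ih =>
    by_cases h : i + 1 < a + n
    · refine (ih h).mul_right ?_
      exact Str_comm_j (S := Set.Iio (a+n)) (by simp) (tw_mem (by simp; omega) (by simp; omega) _) _
    · obtain ⟨n, rfl⟩ : ∃ n', n = n' + 1 := ⟨n - 1, by omega⟩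
      obtain rfl : i = a + n := by omega
      rw [tp, tp, mul_assoc]
      refine Commute.mul_right ?_ ?_
      · exact (Str_comm (S := Set.Iio (a+n)) (S' := Set.Ici (a+n)) (by
          rw [Set.disjoint_left]; simp) (tp_mem _ _ _ (fun i _ h => h)) (tw_mem (by simp) (by simp) _)).symm
      · exact kron_comm (f := id) (by omega) ht

/-- Hecke algebra on shifted window: generators T i, a ≤ i, i+1 < b. -/
def Hs {P : Type*} [Ring P] [Algebra L P] (T : ℕ → P) (a b : ℕ) : Subalgebra L P :=
  Algebra.adjoin L {x | ∃ i, a ≤ i ∧ i + 1 < b ∧ x = T i}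

lemma Hs_mono {P : Type*} [Ring P] [Algebra L P] {T : ℕ → P} {a b a' b' : ℕ} (h : a' ≤ a) (h' : b ≤ b') :
    Hs (L := L) T a b ≤ Hs (L := L) T a' b' :=
  Algebra.adjoin_mono fun _ ⟨i, h1, h2, h3⟩ => ⟨i, by omega, by omega, h3⟩

lemma Hs_map {P Q : Type*} [Ring P] [Algebra L P] [Ring Q] [Algebra L Q] {T : ℕ → P} {T' : ℕ → Q} (π : P →ₐ[L] Q) (o : ℕ)
    (hπ : ∀ i, π (T i) = T' (i + o)) {a b : ℕ} {x : P} (hx : x ∈ Hs (L := L) T a b) :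
    π x ∈ Hs (L := L) T' (a+o) (b+o) := by
  induction hx using Algebra.adjoin_induction with
  | mem x h => obtain ⟨i, h1, h2, rfl⟩ := h; exact Algebra.subset_adjoin ⟨i+o, by omega, by omega, hπ i⟩
  | algebraMap c => rw [AlgHom.commutes]; exact Subalgebra.algebraMap_mem _ c
  | add a b _ _ ha hb => rw [map_add]; exact add_mem ha hb
  | mul a b _ _ ha hb => rw [map_mul]; exact mul_mem ha hb

lemma HH_map {P Q : Type*} [Ring P] [Algebra L P] [Ring Q] [Algebra L Q] {T : ℕ → P} {T' : ℕ → Q} (π : P →ₐ[L] Q)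
    (hπ : ∀ i, π (T i) = T' i) {r : ℕ} {x : P} (hx : x ∈ HH L T r) : π x ∈ HH L T' r := by
  induction hx using Algebra.adjoin_induction with
  | mem x h => obtain ⟨i, h1, rfl⟩ := h; exact Algebra.subset_adjoin ⟨i, by omega, hπ i⟩
  | algebraMap c => rw [AlgHom.commutes]; exact Subalgebra.algebraMap_mem _ c
  | add a b _ _ ha hb => rw [map_add]; exact add_mem ha hb
  | mul a b _ _ ha hb => rw [map_mul]; exact mul_mem ha hb

lemma HH_eq_Hs {P : Type*} [Ring P] [Algebra L P] {T : ℕ → P} (r : ℕ) : HH L T r = Hs (L := L) T 0 (r+1) := by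
  rw [HH, Hs]; congr 1; ext x; simp

lemma Hs_Str {R : Matrix (ι × ι) (ι × ι) L} {a b : ℕ} {x} (hx : x ∈ Hs (L := L) (Tn R) a b) : x ∈ Str L ι (Set.Ico a b) := by
  refine Algebra.adjoin_le ?_ hx
  rintro _ ⟨i, hi, hi', rfl⟩
  exact tw_mem (by simp; omega) (by simp; omega) R

lemma Hs_tp {R : Matrix (ι × ι) (ι × ι) L} {t : Matrix ι ι L} (ht : Commute R (t ⊗ₖ t)) {a n b m : ℕ} (h1 : a ≤ b) (h2 : m ≤ a + n)
    {x} (hx : x ∈ Hs (L := L) (Tn R) b m) : Commute x (tp t a n) := by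
  induction hx using Algebra.adjoin_induction with
  | mem x h => obtain ⟨i, h3, h4, rfl⟩ := h; exact T_tp ht (by omega) (by omega)
  | algebraMap c => exact Algebra.commutes c _
  | add a b _ _ ha hb => exact ha.add_left hb
  | mul a b _ _ ha hb => exact ha.mul_left hb

/-- chain T_i ... T_{i+j-1} -/
def Gc {P : Type*} [Ring P] (T : ℕ → P) (i : ℕ) : ℕ → P
  | 0 => 1
  | j+1 => Gc T i j * T (i+j)

lemma Gc_succ' {P : Type*} [Ring P] (T : ℕ → P) (i j : ℕ) : Gc T i (j+1) = T i * Gc T (i+1) j := by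
  induction j with
  | zero => simp [Gc]
  | succ j ih => rw [Gc, ih, Gc, mul_assoc]; congr 3; omega

lemma Gc_map {P Q : Type*} [Ring P] [Algebra L P] [Ring Q] [Algebra L Q] {T : ℕ → P} {T' : ℕ → Q} (π : P →ₐ[L] Q)
    (hπ : ∀ i, π (T i) = T' i) (i j : ℕ) : π (Gc T i j) = Gc T' i j := by
  induction j with
  | zero => simp [Gc]
  | succ j ih => rw [Gc, Gc, map_mul, ih, hπ]

lemma Gc_mem {P : Type*} [Ring P] [Algebra L P] (T : ℕ → P) (i j : ℕ) : Gc T i j ∈ Hs (L := L) T i (i+j+1) := by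
  induction j with
  | zero => exact one_mem _
  | succ j ih => exact mul_mem (Hs_mono le_rfl (by omega) ih) (Algebra.subset_adjoin ⟨i+j, by omega, by omega, rfl⟩)

/-- weighted closure -/
def psi (R : Matrix (ι × ι) (ι × ι) L) (t : Matrix ι ι L) (β : Matrix ι ι L) : Matrix ι ι L := ph R β * t

lemma chain (R : Matrix (ι × ι) (ι × ι) L) (t : Matrix ι ι L) (i : ℕ) {A : Al L ι} (hA : A ∈ Str L ι (Set.Iio i)) (j : ℕ) :
    ∀ β, nu (A * Gc (Tn R) i j * tp t i j * jj (i+j) β) = nu A * nb ((psi R t)^[j] β) := by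
  induction j with
  | zero => intro β; simp only [Gc, tp, mul_one]; exact nu_mul_j (by simp) hA β
  | succ j ih =>
    intro β
    have hT : tp t i (j+1) ∈ Str L ι (Set.Iio (i+j+1)) := tp_mem _ _ _ (fun k h1 h2 => by simp; omega)
    have hG : Gc (Tn R) i j ∈ Str L ι (Set.Iio (i+j+1)) := Str_mono (fun k => by simp) (Hs_Str (Gc_mem _ i j))
    have hA' : A ∈ Str L ι (Set.Iio (i+j+1)) := Str_mono (fun k => by simp; omega) hA
    have hc1 : Commute (tp t i (j+1)) (jj (i+j+1) β) := Str_comm_j (by simp) hT β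
    have hc2 : Commute (tp t i j) (jj (i+j) (ph R β)) :=
      Str_comm_j (S := Set.Iio (i+j)) (by simp) (tp_mem _ _ _ (fun k h1 h2 => by simp; omega)) _
    have e1 : nu (A * Gc (Tn R) i (j+1) * tp t i (j+1) * jj (i+(j+1)) β)
        = nu ((tp t i (j+1) * (A * Gc (Tn R) i j)) * tw (i+j) (i+j+1) R * jj (i+j+1) β) := by
      rw [← add_assoc, mul_assoc, hc1.eq, ← mul_assoc, nu_comm, Gc]
      simp only [mul_assoc]; rfl
    rw [e1, nu_close (by omega) (by simp) (mul_mem hT (mul_mem hA' hG)), mul_assoc, nu_comm, Function.iterate_succ_apply,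
      ← ih, psi, tp, map_mul (jj (i+j))]
    congr 1
    simp only [mul_assoc]
    rw [← mul_assoc (tp t i j) (jj _ (ph R β)), hc2.eq, mul_assoc]

/-- a system -/
structure Sys (L ι : Type*) [Field L] [Fintype ι] [DecidableEq ι] (q : L) where
  R : Matrix (ι × ι) (ι × ι) L
  braid : R1 R * R2 R * R1 R = R2 R * R1 R * R2 R
  quad : R * R = (q - 1) • R + q • 1
  h : Matrix ι ι L
  g : Matrix ι ι L
  hh : ph R h = 1
  hg : ph' R g = 1
  surj : ∀ η, ∃ c, ph R c = η
  q0 : q ≠ 0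

namespace Sys
variable {q : L} (σ : Sys L ι q)

lemma hecke : IsHecke q (Tn σ.R) := Tn_hecke σ.braid σ.quad

def del : L := nb σ.h

lemma nb_c (c : Matrix ι ι L) : nb c = nb (σ.g * ph σ.R c) := by
  rw [nb_adj, σ.hg, mul_one]

lemma nb_g : nb σ.g = σ.del := by
  rw [del, σ.nb_c σ.h, σ.hh, mul_one]

def thb : L := (Fintype.card ι : L)^2 * (q⁻¹ * (1 - (q - 1) * σ.del))

lemma close_h {S : Set ℕ} {i k : ℕ} (h : i ≠ k) (hk : k ∉ S) {A : Al L ι} (hA : A ∈ Str L ι S) :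
    nu (A * tw i k σ.R * jj k σ.h) = nu A := by
  rw [nu_close h hk hA, σ.hh, map_one, mul_one]

lemma key1 (α η : Matrix ι ι L) :
    nu (Tinv q (Tn σ.R) 0 * jj 0 σ.g * jj 1 α * Tn σ.R 0 * jj 1 η) = nb α * nb (σ.g * η) := by
  obtain ⟨c, rfl⟩ := σ.surj η
  rw [← σ.nb_c]
  have H := σ.hecke
  have hi0 : Tinv q (Tn σ.R) 0 ∈ Str L ι (Set.Iio 2) := HH_Str (Tinv_mem (by omega))
  have hT0 : Tn σ.R 0 ∈ Str L ι (Set.Iio 2) := tw_mem (by simp) (by simp) _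
  have hi1 : Tinv q (Tn σ.R) 1 ∈ Str L ι ({1, 2}) := by
    rw [Tinv]
    exact Subalgebra.smul_mem _ (sub_mem (tw_mem (by simp) (by simp) _) (Subalgebra.smul_mem _ (one_mem _) _)) _
  have hT1 : Tn σ.R 1 ∈ Str L ι ({1, 2}) := tw_mem (by simp) (by simp) _
  have s1 := nu_close (S := Set.Iio 2) (i := 1) (k := 2) (by omega) (by simp)
    (A := Tinv q (Tn σ.R) 0 * jj 0 σ.g * jj 1 α * Tn σ.R 0)
    (mul_mem (mul_mem (mul_mem hi0 (jj_mem (by simp) _)) (jj_mem (by simp) _)) hT0) σ.R c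
  rw [← s1]
  -- T0 T1 T0⁻¹ = T1⁻¹ T0 T1
  have b := H.braid 0
  have e : Tn σ.R 0 * Tn σ.R 1 * Tinv q (Tn σ.R) 0 = Tinv q (Tn σ.R) 1 * Tn σ.R 0 * Tn σ.R 1 := by
    have h1 := H.inv_mul_T σ.q0 1
    have h2 := H.T_mul_inv σ.q0 0
    calc Tn σ.R 0 * Tn σ.R 1 * Tinv q (Tn σ.R) 0
        = (Tinv q (Tn σ.R) 1 * Tn σ.R 1) * Tn σ.R 0 * Tn σ.R 1 * Tinv q (Tn σ.R) 0 := by rw [h1, one_mul]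
      _ = Tinv q (Tn σ.R) 1 * (Tn σ.R (0+1) * Tn σ.R 0 * Tn σ.R (0+1)) * Tinv q (Tn σ.R) 0 := by simp only [mul_assoc, zero_add]
      _ = Tinv q (Tn σ.R) 1 * Tn σ.R 0 * Tn σ.R 1 * (Tn σ.R 0 * Tinv q (Tn σ.R) 0) := by rw [← b]; simp only [mul_assoc, zero_add]
      _ = _ := by rw [h2, mul_one]
  have c2 : Commute (jj 2 c) (Tinv q (Tn σ.R) 0) := (Str_comm_j (by simp) hi0 c).symm
  have e2 : nu (Tinv q (Tn σ.R) 0 * jj 0 σ.g * jj 1 α * Tn σ.R 0 * tw 1 2 σ.R * jj 2 c)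
      = nu ((Tn σ.R 0 * Tn σ.R 1 * Tinv q (Tn σ.R) 0) * (jj 2 c * jj 0 σ.g * jj 1 α)) := by
    rw [nu_comm _ (jj 2 c * _ * _), mul_assoc, mul_assoc, mul_assoc, mul_assoc, nu_comm (Tinv q (Tn σ.R) 0)]
    have : tw 1 2 σ.R = Tn σ.R 1 := rfl
    rw [this]
    have x1 : jj 2 c * jj 0 σ.g * jj 1 α * (Tn σ.R 0 * Tn σ.R 1 * Tinv q (Tn σ.R) 0)
      = jj 2 c * (jj 0 σ.g * (jj 1 α * (Tn σ.R 0 * (Tn σ.R 1 * Tinv q (Tn σ.R) 0)))) := by simp only [mul_assoc]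
    rw [x1, nu_comm (jj 2 c)]
    simp only [mul_assoc]
    rw [c2.eq]
  rw [e2, e]
  have x2 : Commute (jj 0 σ.g) (jj 1 α * Tinv q (Tn σ.R) 1) :=
    (Str_comm_j (S := {1,2}) (by simp) (mul_mem (jj_mem (by simp) _) hi1) σ.g).symm
  have x3 : Commute (jj 2 c) (jj 0 σ.g) := jj_comm (by simp) _ _
  have x4 : Commute (Tn σ.R 1 * jj 2 c) (jj 0 σ.g) := Str_comm_j (S := {1,2}) (by simp) (mul_mem hT1 (jj_mem (by simp) _)) σ.g
  have e3 : nu (Tinv q (Tn σ.R) 1 * Tn σ.R 0 * Tn σ.R 1 * (jj 2 c * jj 0 σ.g * jj 1 α))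
     = nu ((Tn σ.R 1 * jj 2 c * jj 1 α * Tinv q (Tn σ.R) 1) * tw 0 1 σ.R * jj 0 σ.g) := by
    have a1 : Tinv q (Tn σ.R) 1 * Tn σ.R 0 * Tn σ.R 1 * (jj 2 c * jj 0 σ.g * jj 1 α)
      = Tinv q (Tn σ.R) 1 * Tn σ.R 0 * ((Tn σ.R 1 * jj 2 c) * jj 0 σ.g) * jj 1 α := by simp only [mul_assoc]
    rw [a1, x4.eq]
    have a2 : Tinv q (Tn σ.R) 1 * Tn σ.R 0 * (jj 0 σ.g * (Tn σ.R 1 * jj 2 c)) * jj 1 α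
      = (Tinv q (Tn σ.R) 1 * Tn σ.R 0 * jj 0 σ.g) * (Tn σ.R 1 * jj 2 c * jj 1 α) := by simp only [mul_assoc]
    rw [a2, nu_comm]
    simp only [mul_assoc]; rfl
  rw [e3, nu_close' (S := {1,2}) (by omega) (by simp)
    (mul_mem (mul_mem (mul_mem hT1 (jj_mem (by simp) _)) (jj_mem (by simp) _)) hi1), σ.hg, map_one, mul_one, nu_comm,
    ← mul_assoc, ← mul_assoc, H.inv_mul_T σ.q0 1, one_mul, nu_mul_j (S := {2}) (by simp) (jj_mem (by simp) _), nu_jj, mul_comm]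

lemma sandwich (M : Matrix (ι × ι) (ι × ι) L) (v r : ι) (hc : Matrix ι ι L) :
    ∑ v', ∑ i, hc i v' • (jj 1 (single v v' 1) * tw 0 1 M * jj 1 (single i r 1))
      = (Fintype.card ι : L) • (jj 0 (ph M hc) * jj 1 (single v r 1)) := by
  refine mat_ind (fun M => ∑ v', ∑ i, hc i v' • (jj 1 (single v v' 1) * tw 0 1 M * jj 1 (single i r 1))
      = (Fintype.card ι : L) • (jj 0 (ph M hc) * jj 1 (single v r 1))) ?_ ?_ ?_ ?_ M
  · have : ph (0 : Matrix (ι × ι) (ι × ι) L) hc = 0 := by ext; simp [ph]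
    simp [this]
  · intro M N hM hN
    have : ph (M + N) hc = ph M hc + ph N hc := by
      ext; simp [ph, add_mul, Finset.sum_add_distrib, mul_add]
    simp only [this, map_add, mul_add, add_mul, smul_add, Finset.sum_add_distrib, hM, hN]
  · intro c M hM
    have : ph (c • M) hc = c • ph M hc := by
      ext; simp only [ph, of_apply, Matrix.smul_apply, smul_eq_mul, Finset.mul_sum]
      refine Finset.sum_congr rfl fun _ _ => Finset.sum_congr rfl fun _ _ => by ring
    rw [this]
    simp only [map_smul, mul_smul_comm, smul_mul_assoc, smul_comm _ c, ← Finset.smul_sum, hM]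
  · rintro ⟨a, b⟩ ⟨x, y⟩
    have hp : (Fintype.card ι : L) • ph (single (a,b) (x,y) (1:L)) hc = hc y b • single a x 1 := by
      ext a' x'
      simp only [ph, Matrix.smul_apply, smul_eq_mul, of_apply, ← mul_assoc, mul_inv_cancel₀ (card_ne (L := L) (ι := ι)), one_mul]
      rw [Finset.sum_eq_single b, Finset.sum_eq_single y]
      · by_cases h1 : a = a' <;> by_cases h2 : x = x' <;> simp [single_apply, h1, h2]
      · intro u _ hu; simp [single_apply, hu.symm]
      · simp
      · intro u _ hu; simp [single_apply, hu.symm]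
      · simp
    rw [← smul_mul_assoc, ← map_smul, hp, Finset.sum_eq_single b, Finset.sum_eq_single y, map_smul, smul_mul_assoc]
    · congr 1
      rw [tw, tens_single]
      simp only
      rw [← mul_assoc, (jj_comm (i := 1) (k := 0) (by simp) _ _).eq, mul_assoc, mul_assoc, ← map_mul (jj 1), ← map_mul (jj 1)]
      simp
    · intro u _ hu
      rw [tw, tens_single]
      simp only
      rw [mul_assoc, mul_assoc, ← map_mul (jj 1), single_mul_single_of_ne (h := hu.symm)]; simp
    · simp
    · intro u _ hu
      refine Finset.sum_eq_zero fun i _ => ?_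
      rw [tw, tens_single]
      simp only
      rw [← mul_assoc, (jj_comm (i := 1) (k := 0) (by simp) _ _).eq, mul_assoc (jj 0 _), ← map_mul (jj 1), single_mul_single_of_ne (h := hu)]; simp
    · simp

lemma gh : σ.g * σ.h = σ.thb • 1 := by
  ext r v
  have h1 : ∑ v', ∑ i, σ.h i v' * nu (Tinv q (Tn σ.R) 0 * jj 0 σ.g * jj 1 (single v v' 1) * Tn σ.R 0 * jj 1 (single i r 1))
     = (Fintype.card ι : L) * nu (Tinv q (Tn σ.R) 0 * jj 0 σ.g * jj 1 (single v r 1)) := by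
    have := congrArg (fun z => nu (Tinv q (Tn σ.R) 0 * jj 0 σ.g * z)) (sandwich σ.R v r σ.h)
    simp only [Finset.mul_sum, map_sum, mul_smul_comm, map_smul, smul_eq_mul, σ.hh, map_one, one_mul] at this
    rw [← this]
    refine Finset.sum_congr rfl fun _ _ => Finset.sum_congr rfl fun _ _ => ?_
    simp only [mul_assoc]; rfl
  simp only [key1] at h1
  have hd := card_ne (L := L) (ι := ι)
  have h2 : nu (Tinv q (Tn σ.R) 0 * jj 0 σ.g * jj 1 (single v r 1))
      = q⁻¹ * (1 - (q - 1) * σ.del) * nb (single v r 1) := by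
    rw [Tinv]
    simp only [smul_mul_assoc, sub_mul, map_smul, map_sub, one_mul, smul_eq_mul]
    rw [nu_mul_j (S := {0}) (by simp) (jj_mem (by simp) _), nu_jj, nb_g]
    have h3 := nu_close' (S := {1}) (i := 0) (k := 1) (by omega) (by simp) (jj_mem (i := 1) (by simp) (single v r 1)) σ.R σ.g
    rw [σ.hg, map_one, mul_one, nu_jj, mul_assoc, nu_comm] at h3
    have h4 : nu (Tn σ.R 0 * jj 0 σ.g * jj 1 (single v r 1)) = nb (single v r 1) := h3
    rw [h4]; ring
  rw [h2, Finset.sum_eq_single v] at h1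
  · have e1 : nb (single v v (1:L)) = (Fintype.card ι : L)⁻¹ := by simp [nb]
    have e2 : ∀ i, nb (σ.g * single i r 1) = (Fintype.card ι : L)⁻¹ * σ.g r i := by
      intro i; rw [nb, trace_mul_comm, trace_single_mul]; simp
    simp only [e1, e2] at h1
    have e3 : nb (single v r (1:L)) = (Fintype.card ι : L)⁻¹ * (1 : Matrix ι ι L) r v := by
      rw [nb]
      by_cases h : r = v
      · subst h; simp
      · rw [one_apply_ne h, trace_single_eq_of_ne _ _ _ (Ne.symm h)]
    rw [e3] at h1
    have e4 : (σ.g * σ.h) r v = ∑ i, σ.g r i * σ.h i v := rfl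
    rw [e4, Matrix.smul_apply, smul_eq_mul, thb]
    have e5 : ∑ i, σ.h i v * ((Fintype.card ι : L)⁻¹ * ((Fintype.card ι : L)⁻¹ * σ.g r i))
       = (Fintype.card ι : L)⁻¹ ^ 2 * ∑ i, σ.g r i * σ.h i v := by
      rw [Finset.mul_sum]; exact Finset.sum_congr rfl fun _ _ => by ring
    rw [e5] at h1
    field_simp at h1 ⊢
    linear_combination h1
  · intro v' _ hv
    have : nb (single v v' (1:L)) = 0 := by rw [nb, trace_single_eq_of_ne _ _ _ hv.symm, mul_zero]
    simp [this]
  · simp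

lemma hg_mul (h0 : σ.thb ≠ 0) : σ.h * σ.g = σ.thb • 1 := by
  have h1 : (σ.thb⁻¹ • σ.g) * σ.h = 1 := by rw [smul_mul_assoc, σ.gh, smul_smul, inv_mul_cancel₀ h0, one_smul]
  have h2 := mul_eq_one_comm.1 h1
  rw [mul_smul_comm] at h2
  rw [← h2, smul_smul, mul_inv_cancel₀ h0, one_smul]

end Sys
end
end HS

set_option linter.all false
namespace HS
open Matrix Kronecker

noncomputable section
variable {L ι ι' : Type*} [Field L] [CharZero L] [Fintype ι] [DecidableEq ι] [Nonempty ι]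
  [Fintype ι'] [DecidableEq ι'] [Nonempty ι'] {q : L}

namespace Sys

lemma E_close (σ : Sys L ι q) {r : ℕ} {S : Set ℕ} (hS : r + 1 ∉ S) {A : Al L ι} (hA : A ∈ Str L ι S)
    {a : Al L ι} (ha : a ∈ HH L (Tn σ.R) r) {k : ℕ} {b c : Fin k → Al L ι} (hb : ∀ i, b i ∈ HH L (Tn σ.R) r)
    (hc : ∀ i, c i ∈ HH L (Tn σ.R) r) :
    nu ((a + ∑ i, b i * Tn σ.R r * c i) * A * jj (r+1) σ.h) = σ.del * nu (a * A) + nu ((∑ i, b i * c i) * A) := by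
  have hA' : A ∈ Str L ι ({r+1}ᶜ) := Str_mono (S := S) (S' := {r+1}ᶜ) (fun i hi => by
    intro h; rw [Set.mem_singleton_iff] at h; subst h; exact hS hi) hA
  have hh : ∀ x ∈ HH L (Tn σ.R) r, x ∈ Str L ι ({r+1}ᶜ) := fun x hx =>
    Str_mono (S := Set.Iio (r+1)) (S' := {r+1}ᶜ) (fun i hi => by
      intro h; rw [Set.mem_singleton_iff] at h; subst h; simp at hi) (HH_Str hx)
  rw [add_mul, add_mul, map_add, nu_mul_j (by simp) (mul_mem (hh a ha) hA'), mul_comm]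
  congr 1
  simp only [Finset.sum_mul, map_sum]
  refine Finset.sum_congr rfl fun i _ => ?_
  have hcA := mul_mem (hh _ (hc i)) hA'
  have c1 : Commute (c i * A) (jj (r+1) σ.h) := Str_comm_j (by simp) hcA _
  have e1 : b i * Tn σ.R r * c i * A * jj (r+1) σ.h = (b i * Tn σ.R r * jj (r+1) σ.h) * (c i * A) := by
    simp only [mul_assoc]; rw [← mul_assoc (c i) A, c1.eq]
  have e2 : (c i * A) * (b i * Tn σ.R r * jj (r+1) σ.h) = (c i * A * b i) * tw r (r+1) σ.R * jj (r+1) σ.h := by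
    simp only [mul_assoc]; rfl
  rw [e1, nu_comm, e2, σ.close_h (by omega) (S := {r+1}ᶜ) (by simp) (mul_mem hcA (hh _ (hb i))), nu_comm, mul_assoc]

/-- (†) -/
lemma dagger (σ : Sys L ι q) {s : ℕ} {n : ℕ} {F E : Al L ι} (hF : F ∈ Str L ι (Set.Iio n)) {k : ℕ} {a b : Fin k → Al L ι}
    (ha : ∀ i, a i ∈ Str L ι (Set.Iio (s+1))) (hb : ∀ i, b i ∈ Str L ι (Set.Iio (s+1))) (hE : E ∈ Str L ι (Set.Iio (s+1)))
    (hs : s < n) (he : E = ∑ i, a i * Tn σ.R s * b i) (η : Matrix ι ι L) :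
    nu (F * E) * nb (σ.g * η) = ∑ i, nu (b i * F * a i * jj s η) := by
  obtain ⟨c, rfl⟩ := σ.surj η
  rw [← σ.nb_c]
  let p : ℕ → ℕ := Equiv.swap (s+1) (n+1)
  have hp : Function.Injective p := (Equiv.swap (s+1) (n+1)).injective
  have hfix : ∀ i ∈ Set.Iio (s+1), p i = i := fun i hi => by
    simp at hi; exact Equiv.swap_apply_of_ne_of_ne (by omega) (by omega)
  have e1 : E = ∑ i, a i * tw s (n+1) σ.R * b i := by
    have := congrArg (al p hp) he
    rw [al_fix p hp hfix hE] at this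
    simp only [map_sum, map_mul, al_fix p hp hfix (ha _), al_fix p hp hfix (hb _)] at this
    have h2 : al p hp (Tn σ.R s) = tw s (n+1) σ.R := by
      have hps : p (s+1) = n+1 := Equiv.swap_apply_left (s+1) (n+1)
      rw [Tn, al_tw, hfix s (by simp), hps]
    rw [h2] at this; exact this
  have up : ∀ x ∈ Str L ι (Set.Iio (s+1)), x ∈ Str L ι (Set.Iio (n+1)) := fun x hx =>
    Str_mono (fun i hi => by simp at hi ⊢; omega) hx
  have hF' : F ∈ Str L ι (Set.Iio (n+1)) := Str_mono (fun i hi => by simp at hi ⊢; omega) hF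
  rw [← nu_mul_j (S := Set.Iio (n+1)) (k := n+1) (by simp) (mul_mem hF' (up _ hE)), e1]
  simp only [Finset.mul_sum, Finset.sum_mul, map_sum]
  refine Finset.sum_congr rfl fun i _ => ?_
  have c1 : Commute (b i) (jj (n+1) c) := Str_comm_j (by simp) (up _ (hb i)) _
  have e2 : F * (a i * tw s (n+1) σ.R * b i) * jj (n+1) c = (F * a i * tw s (n+1) σ.R * jj (n+1) c) * b i := by
    simp only [mul_assoc]; rw [c1.eq]
  rw [e2, nu_comm, ← nu_close (S := Set.Iio (n+1)) (k := n+1) (by omega) (by simp)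
    (mul_mem (mul_mem (up _ (hb i)) hF') (up _ (ha i)))]
  simp only [mul_assoc]

lemma step (σ : Sys L ι q) {t ti : Matrix ι ι L} (hti : t * ti = 1) {o r m k : ℕ} {E D : Al L ι} {K : L}
    (hE : E ∈ Str L ι (Set.Ico o (o+r+1))) {n : ℕ} {a b : Fin n → Al L ι}
    (ha : ∀ i, a i ∈ Str L ι (Set.Ico o (o+r+m+1))) (hb : ∀ i, b i ∈ Str L ι (Set.Ico o (o+r+m+1)))
    (hat : ∀ i, Commute (a i) (tp t o (r+m+1)))
    (he : E = ∑ i, a i * Tn σ.R (o+r+m) * b i)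
    (hD : D ∈ Str L ι (Set.Ico (o+r+1) (o+r+1+m+k)))
    (hY : ∀ Y ∈ Str L ι (Set.Ico (o+r+1+m) (o+r+1+m+k)),
      nu (D * tp t (o+r+1) m * Y) = K * nu (tp (σ.g * ti) (o+r+1+m) k * Y)) :
    ∀ Y ∈ Str L ι (Set.Ico (o+r+m) (o+r+m+1+k)),
      nu ((∑ i, b i * D * a i) * tp t o (r+m) * Y)
        = K * nu (E * tp t o (r+1)) * nu (tp (σ.g * ti) (o+r+m) (k+1) * Y) := by
  intro Y hY'
  have hins : Set.Ico (o+r+m) (o+r+m+1+k) = insert (o+r+m) (Set.Ico (o+r+1+m) (o+r+1+m+k)) := by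
    ext i; simp; omega
  rw [hins] at hY'
  have hY'' := Str_insert (k := o+r+m) (by simp) hY'
  clear hY'
  induction hY'' using Submodule.span_induction with
  | zero => simp
  | add a b _ _ ha hb => simp only [mul_add, map_add, ha, hb]
  | smul c a _ ha => simp only [mul_smul_comm, map_smul, ha, smul_eq_mul]; ring
  | mem Y h =>
    obtain ⟨η, Y', hY', rfl⟩ := h
    set s := o + r + m with hs
    have hti' : ti * t = 1 := mul_eq_one_comm.1 hti
    have x1 : tp t o (r+m) * (jj s t) = tp t o (r+m+1) := by rw [tp, hs, add_assoc]
    have cY : Commute Y' (jj s η) := Str_comm_j (by simp; omega) hY' _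
    have caY : ∀ i, Commute (a i) Y' := fun i => Str_comm (by
      rw [Set.disjoint_left]; intro j; simp; omega) (ha i) hY'
    have x2 : tp t o (r+m) * (Y' * jj s η) = tp t o (r+m+1) * jj s (ti * η) * Y' := by
      rw [cY.eq, ← x1]
      have : jj s η = jj s t * jj s (ti * η) := by rw [← map_mul, ← mul_assoc, hti, one_mul]
      rw [this]; simp only [mul_assoc]
    set F := D * tp t o (r+m+1) * Y' with hFdef
    have cY2 : Commute (jj s (ti * η)) Y' := (Str_comm_j (by simp; omega) hY' _).symm
    have hF : F ∈ Str L ι (Set.Iio (s+1+k)) := by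
      refine mul_mem (mul_mem (Str_mono ?_ hD) (tp_mem _ _ _ ?_)) (Str_mono ?_ hY')
      · intro i; simp; omega
      · intro i; simp; omega
      · intro i; simp; omega
    have dg := σ.dagger (s := s) (n := s+1+k) (F := F) (E := E) hF (a := a) (b := b)
      (fun i => Str_mono (fun j => by simp) (ha i)) (fun i => Str_mono (fun j => by simp) (hb i))
      (Str_mono (fun j => by simp; omega) hE) (by omega) he (ti * η)
    have x3 : nu ((∑ i, b i * D * a i) * tp t o (r+m) * (Y' * jj s η)) = ∑ i, nu (b i * F * a i * jj s (ti * η)) := by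
      rw [mul_assoc, x2]
      simp only [Finset.sum_mul, map_sum]
      refine Finset.sum_congr rfl fun i _ => ?_
      congr 1
      rw [mul_assoc (tp t o (r+m+1)), cY2.eq]
      simp only [hFdef, mul_assoc]
      rw [← mul_assoc Y' (a i), ← (caY i).eq]
      simp only [← mul_assoc]
      congr 1
      congr 1
      simp only [mul_assoc]
      rw [(hat i).eq]
    rw [x3, ← dg]
    -- nu (F E)
    have cE : Commute (tp t (o+r+1) m * Y') (tp t o (r+1) * E) := by
      refine Str_comm (S := Set.Ici (o+r+1)) (S' := Set.Iio (o+r+1)) ?_ (mul_mem (tp_mem _ _ _ ?_) (Str_mono ?_ hY'))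
        (mul_mem (tp_mem _ _ _ ?_) (Str_mono ?_ hE))
      · rw [Set.disjoint_left]; simp
      all_goals intro i; simp
      all_goals omega
    have x4 : nu (F * E) = nu (D * tp t (o+r+1) m * Y') * nu (E * tp t o (r+1)) := by
      rw [nu_comm E, ← nu_disj (S := Set.Ici (o+r+1)) (S' := Set.Iio (o+r+1))]
      · congr 1
        rw [hFdef, show r + m + 1 = (r+1) + m by omega, tp_add, ← add_assoc, mul_assoc D _ Y', mul_assoc D,
          mul_assoc D, mul_assoc D, cE.eq.symm.symm]
        have c3 : Commute (tp t (o+r+1) m * Y') E := by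
          refine Str_comm (S := Set.Ici (o+r+1)) (S' := Set.Iio (o+r+1)) ?_ (mul_mem (tp_mem _ _ _ ?_) (Str_mono ?_ hY')) (Str_mono ?_ hE)
          · rw [Set.disjoint_left]; simp
          all_goals intro i; simp
          all_goals omega
        rw [mul_assoc (tp t o (r+1)), mul_assoc (tp t o (r+1)), c3.eq, mul_assoc (tp t o (r+1))]
      · rw [Set.disjoint_left]; simp
      · refine mul_mem (mul_mem (Str_mono ?_ hD) (tp_mem _ _ _ ?_)) (Str_mono ?_ hY')
        all_goals intro i; simp
        all_goals omega
      · refine mul_mem (tp_mem _ _ _ ?_) (Str_mono ?_ hE)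
        all_goals intro i; simp
        all_goals omega
    rw [x4, hY Y' hY', tp_succ' (σ.g * ti) s k]
    have hJ : tp (σ.g * ti) (s+1) k * Y' ∈ Str L ι (Set.Ioi s) := by
      refine mul_mem (tp_mem _ _ _ ?_) (Str_mono ?_ hY')
      all_goals intro i; simp
      all_goals omega
    have x5 : nu (jj s (σ.g * ti) * tp (σ.g * ti) (s+1) k * (Y' * jj s η))
        = nu (tp (σ.g * ti) (s+1) k * Y') * nb (σ.g * (ti * η)) := by
      rw [mul_assoc, nu_comm, ← mul_assoc, mul_assoc, ← map_mul, nu_mul_j (S := Set.Ioi s) (by simp) hJ]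
      congr 1
      rw [nb, nb, trace_mul_comm, mul_assoc]
    rw [x5, show o + r + 1 + m = s + 1 by omega]
    ring

end Sys
end
end HS

set_option linter.all false
namespace HS
open Matrix Kronecker

noncomputable section
variable {L ι ι' : Type*} [Field L] [CharZero L] [Fintype ι] [DecidableEq ι] [Nonempty ι]
  [Fintype ι'] [DecidableEq ι'] [Nonempty ι'] {q : L}

lemma IsHecke.ext_NN {P : Type*} [Ring P] [Algebra L P] {T : ℕ → P} (H : IsHecke q T) (hq : q ≠ 0) {r : ℕ} {e : P}
    (h1 : e ∈ HH L T r) (h2 : e ∈ NN L T r) : e ∈ NN L T (r+1) := by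
  have hc : Commute e (T (r+1)) := H.commT (by omega) h1
  have : e = q⁻¹ • (T (r+1) * e * T (r+1) - (q-1) • (1 * T (r+1) * e)) := by
    calc e = (T (r+1) * Tinv q T (r+1)) * e := by rw [H.T_mul_inv hq, one_mul]
      _ = q⁻¹ • (T (r+1) * (T (r+1) * e) - (q-1) • (1 * T (r+1) * e)) := by
        rw [Tinv, mul_smul_comm, smul_mul_assoc, mul_sub, sub_mul]; simp [mul_assoc]
      _ = _ := by rw [← hc.eq, ← mul_assoc (T (r+1)) e, ← hc.eq] <;> simp only [mul_assoc]
  rw [this]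
  refine Submodule.smul_mem _ _ (Submodule.sub_mem _ (H.NN_step h2) (Submodule.smul_mem _ _ ?_))
  exact NN_mem (one_mem _) (HH_mono (by omega) h1)

lemma IsHecke.ext_NN' {P : Type*} [Ring P] [Algebra L P] {T : ℕ → P} (H : IsHecke q T) (hq : q ≠ 0) {r : ℕ} {e : P}
    (h1 : e ∈ HH L T r) (h2 : e ∈ NN L T r) (s : ℕ) : e ∈ NN L T (r+s) := by
  induction s with
  | zero => exact h2
  | succ s ih => exact H.ext_NN hq (HH_mono (Nat.le_add_right r s) h1) ih

namespace Sys

lemma HH_tp (σ : Sys L ι q) {t : Matrix ι ι L} (ht : Commute σ.R (t ⊗ₖ t)) {r n : ℕ} (h : r + 1 ≤ n) {x}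
    (hx : x ∈ HH L (Tn σ.R) r) : Commute x (tp t 0 n) := by
  rw [HH_eq_Hs] at hx; exact Hs_tp ht le_rfl (by omega) hx

lemma uni_a (σ : Sys L ι q) {t : Matrix ι ι L} (ht : Commute σ.R (t ⊗ₖ t)) {r : ℕ} (j : ℕ) {a} (ha : a ∈ HH L (Tn σ.R) r) :
    nu (a * Gc (Tn σ.R) (r+1) j * tp t 0 (r+1+j+1)) = nu (a * tp t 0 (r+1)) * nb ((psi σ.R t)^[j] t) := by
  have h1 : a * tp t 0 (r+1) ∈ Str L ι (Set.Iio (r+1)) := mul_mem (HH_Str ha) (tp_mem _ _ _ (by simp))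
  rw [← chain σ.R t (r+1) h1 j t, show r+1+j+1 = (r+1)+(j+1) by omega, tp_add, zero_add, tp.eq_2 _ _ j]
  congr 1
  have hc : Commute (Gc (Tn σ.R) (r+1) j) (tp t 0 (r+1)) :=
    Str_comm (S := Set.Ici (r+1)) (S' := Set.Iio (r+1)) (by rw [Set.disjoint_left]; simp)
      (Str_mono (fun i => by simp; omega) (Hs_Str (Gc_mem _ _ _))) (tp_mem _ _ _ (by simp))
  simp only [mul_assoc]
  rw [← mul_assoc (Gc _ _ _), hc.eq, mul_assoc]

lemma uni_b (σ : Sys L ι q) {t : Matrix ι ι L} (ht : Commute σ.R (t ⊗ₖ t)) {r : ℕ} (j : ℕ) {b c}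
    (hb : b ∈ HH L (Tn σ.R) r) (hc : c ∈ HH L (Tn σ.R) r) :
    nu (b * Tn σ.R r * c * Gc (Tn σ.R) (r+1) j * tp t 0 (r+1+j+1)) = nu (c * b * Gc (Tn σ.R) r (j+1) * tp t 0 (r+(j+1)+1)) := by
  have c1 : Commute c (Gc (Tn σ.R) (r+1) j) :=
    Str_comm (S := Set.Iio (r+1)) (S' := Set.Ici (r+1)) (by rw [Set.disjoint_left]; simp) (HH_Str hc)
      (Str_mono (fun i => by simp; omega) (Hs_Str (Gc_mem _ _ _)))
  have c2 : Commute c (tp t 0 (r+1+j+1)) := σ.HH_tp ht (by omega) hc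
  have e1 : b * Tn σ.R r * c * Gc (Tn σ.R) (r+1) j * tp t 0 (r+1+j+1)
    = (b * Tn σ.R r * Gc (Tn σ.R) (r+1) j * tp t 0 (r+1+j+1)) * c := by
    simp only [mul_assoc]
    rw [← c2.eq, ← mul_assoc c, c1.eq, mul_assoc]
  rw [e1, nu_comm, Gc_succ', show r + (j+1) + 1 = r+1+j+1 by omega]
  simp only [mul_assoc]

end Sys

/-- paired generators -/
def Tp (σ : Sys L ι q) (σ' : Sys L ι' q) (i : ℕ) : Al L ι × Al L ι' := (Tn σ.R i, Tn σ'.R i)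

section
variable (σ : Sys L ι q) (σ' : Sys L ι' q)

lemma Tp_hecke : IsHecke q (Tp σ σ') where
  quad i := Prod.ext (σ.hecke.quad i) (σ'.hecke.quad i)
  braid i := Prod.ext (σ.hecke.braid i) (σ'.hecke.braid i)
  comm i j h := Prod.ext (σ.hecke.comm i j h) (σ'.hecke.comm i j h)

lemma Tp_fst (i : ℕ) : (AlgHom.fst L (Al L ι) (Al L ι')) (Tp σ σ' i) = Tn σ.R i := by
  rw [AlgHom.fst_apply, Tp]
lemma Tp_snd (i : ℕ) : (AlgHom.snd L (Al L ι) (Al L ι')) (Tp σ σ' i) = Tn σ'.R i := by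
  rw [AlgHom.snd_apply, Tp]

variable {σ σ'}
lemma HH1 {r : ℕ} {x} (hx : x ∈ HH L (Tp σ σ') r) : x.1 ∈ HH L (Tn σ.R) r :=
  HH_map (T := Tp σ σ') (T' := Tn σ.R) (AlgHom.fst L (Al L ι) (Al L ι')) (Tp_fst σ σ') hx
lemma HH2 {r : ℕ} {x} (hx : x ∈ HH L (Tp σ σ') r) : x.2 ∈ HH L (Tn σ'.R) r :=
  HH_map (T := Tp σ σ') (T' := Tn σ'.R) (AlgHom.snd L (Al L ι) (Al L ι')) (Tp_snd σ σ') hx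
lemma Hs1 {a b : ℕ} {x} (hx : x ∈ Hs (L := L) (Tp σ σ') a b) : x.1 ∈ Hs (L := L) (Tn σ.R) a b :=
  Hs_map (T := Tp σ σ') (T' := Tn σ.R) (AlgHom.fst L (Al L ι) (Al L ι')) 0 (Tp_fst σ σ') hx
lemma Hs2 {a b : ℕ} {x} (hx : x ∈ Hs (L := L) (Tp σ σ') a b) : x.2 ∈ Hs (L := L) (Tn σ'.R) a b :=
  Hs_map (T := Tp σ σ') (T' := Tn σ'.R) (AlgHom.snd L (Al L ι) (Al L ι')) 0 (Tp_snd σ σ') hx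

variable {t ti : Matrix ι ι L} {t' ti' : Matrix ι' ι' L}

lemma universal (ht : Commute σ.R (t ⊗ₖ t)) (ht' : Commute σ'.R (t' ⊗ₖ t'))
    (hp : ∀ k, nb ((psi σ.R t)^[k] t) = nb ((psi σ'.R t')^[k] t')) : ∀ (r j : ℕ) (x) (hx : x ∈ HH L (Tp σ σ') r),
    nu (x.1 * Gc (Tn σ.R) r j * tp t 0 (r+j+1)) = nu (x.2 * Gc (Tn σ'.R) r j * tp t' 0 (r+j+1)) := by
  intro r
  induction r with
  | zero =>
    intro j x hx
    obtain ⟨c, rfl⟩ := HH_zero hx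
    have h1 := chain σ.R t 0 (Subalgebra.algebraMap_mem _ c) j t
    have h2 := chain σ'.R t' 0 (Subalgebra.algebraMap_mem _ c) j t'
    rw [Algebra.algebraMap_eq_smul_one, map_smul, nu_one, hp, mul_assoc, ← tp.eq_2] at h1
    rw [Algebra.algebraMap_eq_smul_one, map_smul, nu_one, mul_assoc, ← tp.eq_2, ← h1] at h2
    rw [Algebra.algebraMap_eq_smul_one, zero_add]
    exact h2.symm
  | succ r ih =>
    intro j x hx
    obtain ⟨a, ha, y, hy, rfl⟩ := (Tp_hecke σ σ').decomp r hx
    obtain ⟨n, b, c, hb, hc, rfl⟩ := NN_rep hy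
    have key : ∀ i, nu ((b i).1 * Tn σ.R r * (c i).1 * Gc (Tn σ.R) (r+1) j * tp t 0 (r+1+j+1))
       = nu ((b i).2 * Tn σ'.R r * (c i).2 * Gc (Tn σ'.R) (r+1) j * tp t' 0 (r+1+j+1)) := fun i => by
      rw [σ.uni_b ht j (HH1 (hb i)) (HH1 (hc i)), σ'.uni_b ht' j (HH2 (hb i)) (HH2 (hc i))]
      exact ih (j+1) (c i * b i) (mul_mem (hc i) (hb i))
    have key2 : nu (a.1 * Gc (Tn σ.R) (r+1) j * tp t 0 (r+1+j+1)) = nu (a.2 * Gc (Tn σ'.R) (r+1) j * tp t' 0 (r+1+j+1)) := by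
      rw [σ.uni_a ht j (HH1 ha), σ'.uni_a ht' j (HH2 ha), hp]
      congr 1
      have := ih 0 a ha
      simpa [Gc] using this
    simp only [Prod.fst_add, Prod.snd_add, Prod.fst_sum, Prod.snd_sum, Prod.fst_mul, Prod.snd_mul, add_mul, map_add,
      Finset.sum_mul, map_sum, key2]
    congr 1
    exact Finset.sum_congr rfl fun i _ => key i

lemma universal' (ht : Commute σ.R (t ⊗ₖ t)) (ht' : Commute σ'.R (t' ⊗ₖ t'))
    (hp : ∀ k, nb ((psi σ.R t)^[k] t) = nb ((psi σ'.R t')^[k] t')) (r : ℕ) (x) (hx : x ∈ HH L (Tp σ σ') r) :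
    nu (x.1 * tp t 0 (r+1)) = nu (x.2 * tp t' 0 (r+1)) := by
  simpa [Gc] using universal ht ht' hp r 0 x hx

lemma del_eq (ht : Commute σ.R (t ⊗ₖ t)) (ht' : Commute σ'.R (t' ⊗ₖ t'))
    (hp : ∀ k, nb ((psi σ.R t)^[k] t) = nb ((psi σ'.R t')^[k] t')) {r : ℕ} {e} (he : e ∈ HH L (Tp σ σ') r)
    (hn : e ∈ NN L (Tp σ σ') r) (hk : nu (e.1 * tp t 0 (r+1)) ≠ 0) : σ.del = σ'.del := by
  obtain ⟨n, b, c, hb, hc, hE⟩ := NN_rep hn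
  have e1 : e.1 = 0 + ∑ i, (b i).1 * Tn σ.R r * (c i).1 := by
    rw [hE]; simp [Prod.fst_sum, Tp]
  have e2 : e.2 = 0 + ∑ i, (b i).2 * Tn σ'.R r * (c i).2 := by
    rw [hE]; simp [Prod.snd_sum, Tp]
  have m1 : e.1 * tp t 0 (r+1) ∈ Str L ι (Set.Iio (r+1)) := mul_mem (HH_Str (HH1 he)) (tp_mem _ _ _ (by simp))
  have m2 : e.2 * tp t' 0 (r+1) ∈ Str L ι' (Set.Iio (r+1)) := mul_mem (HH_Str (HH2 he)) (tp_mem _ _ _ (by simp))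
  have h1 := nu_mul_j (k := r+1) (by simp) m1 σ.h
  have h2 := nu_mul_j (k := r+1) (by simp) m2 σ'.h
  have g1 := σ.E_close (S := Set.Iio (r+1)) (by simp) (A := tp t 0 (r+1)) (tp_mem _ _ _ (by simp)) (zero_mem _)
    (fun i => HH1 (hb i)) (fun i => HH1 (hc i))
  have g2 := σ'.E_close (S := Set.Iio (r+1)) (by simp) (A := tp t' 0 (r+1)) (tp_mem _ _ _ (by simp)) (zero_mem _)
    (fun i => HH2 (hb i)) (fun i => HH2 (hc i))
  rw [← e1, h1] at g1
  rw [← e2, h2] at g2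
  have u1 := universal' ht ht' hp r e he
  have u2 := universal' ht ht' hp r (∑ i, b i * c i) (sum_mem fun i _ => mul_mem (hb i) (hc i))
  simp only [zero_mul, map_zero, mul_zero, zero_add, Prod.fst_sum, Prod.snd_sum, Prod.fst_mul, Prod.snd_mul] at g1 g2 u2
  rw [← g1, ← g2, ← u1] at u2
  exact mul_left_cancel₀ hk u2

lemma closing (hδ : σ.del = σ'.del) (M k : ℕ) : ∀ x ∈ HH L (Tp σ σ') (M+k), ∃ X ∈ HH L (Tp σ σ') M,
    nu (x.1 * tp t 0 (M+1) * tp σ.h (M+1) k) = nu (X.1 * tp t 0 (M+1)) ∧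
    nu (x.2 * tp t' 0 (M+1) * tp σ'.h (M+1) k) = nu (X.2 * tp t' 0 (M+1)) := by
  induction k with
  | zero => intro x hx; exact ⟨x, hx, by simp [tp], by simp [tp]⟩
  | succ k ih =>
    intro x hx
    obtain ⟨a, ha, y, hy, rfl⟩ := (Tp_hecke σ σ').decomp (M+k) hx
    obtain ⟨n, b, c, hb, hc, rfl⟩ := NN_rep hy
    obtain ⟨X, hX, h1, h2⟩ := ih (σ.del • a + ∑ i, b i * c i)
      (add_mem (Subalgebra.smul_mem _ ha _) (sum_mem fun i _ => mul_mem (hb i) (hc i)))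
    refine ⟨X, hX, ?_, ?_⟩
    · have g1 := σ.E_close (r := M+k) (S := Set.Iio (M+k+1)) (by simp) (A := tp t 0 (M+1) * tp σ.h (M+1) k)
        (mul_mem (tp_mem _ _ _ (fun i => by simp; omega)) (tp_mem _ _ _ (fun i => by simp; omega))) (HH1 ha)
        (fun i => HH1 (hb i)) (fun i => HH1 (hc i))
      rw [← h1, tp.eq_2 _ _ k, show M + 1 + k = M + k + 1 by omega]
      simp only [← mul_assoc] at g1 ⊢
      simp only [Prod.fst_add, Prod.fst_sum, Prod.fst_mul, Prod.smul_fst]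
      refine Eq.trans g1 ?_
      simp only [add_mul, map_add, smul_mul_assoc, map_smul, smul_eq_mul]
    · have g1 := σ'.E_close (r := M+k) (S := Set.Iio (M+k+1)) (by simp) (A := tp t' 0 (M+1) * tp σ'.h (M+1) k)
        (mul_mem (tp_mem _ _ _ (fun i => by simp; omega)) (tp_mem _ _ _ (fun i => by simp; omega))) (HH2 ha)
        (fun i => HH2 (hb i)) (fun i => HH2 (hc i))
      rw [← h2, tp.eq_2 _ _ k, show M + 1 + k = M + k + 1 by omega]
      simp only [← mul_assoc] at g1 ⊢
      simp only [Prod.snd_add, Prod.snd_sum, Prod.snd_mul, Prod.smul_snd, hδ]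
      refine Eq.trans g1 ?_
      simp only [add_mul, map_add, smul_mul_assoc, map_smul, smul_eq_mul]

lemma tower (ht : Commute σ.R (t ⊗ₖ t)) (ht' : Commute σ'.R (t' ⊗ₖ t')) (hti : t * ti = 1) (hti' : t' * ti' = 1)
    {r : ℕ} {e} (he : e ∈ HH L (Tp σ σ') r) (hn : e ∈ NN L (Tp σ σ') r) {κ : L} (hk : nu (e.1 * tp t 0 (r+1)) = κ)
    (hk' : nu (e.2 * tp t' 0 (r+1)) = κ) (k : ℕ) : ∀ o, ∃ D ∈ Hs (L := L) (Tp σ σ') o (o+k*r+k),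
      (∀ Y ∈ Str L ι (Set.Ico (o+k*r) (o+k*r+k)), nu (D.1 * tp t o (k*r) * Y) = κ^k * nu (tp (σ.g * ti) (o+k*r) k * Y)) ∧
      (∀ Y ∈ Str L ι' (Set.Ico (o+k*r) (o+k*r+k)), nu (D.2 * tp t' o (k*r) * Y) = κ^k * nu (tp (σ'.g * ti') (o+k*r) k * Y)) := by
  induction k with
  | zero => intro o; exact ⟨1, one_mem _, by simp [tp], by simp [tp]⟩
  | succ k ih =>
    intro o
    obtain ⟨D, hD, h1, h2⟩ := ih (o+r+1)
    obtain ⟨n, a, b, ha, hb, hE⟩ := NN_rep ((Tp_hecke σ σ').ext_NN' σ.q0 he hn (k*r))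
    have hp : Function.Injective (fun i : ℕ => i + o) := fun i j h => by simpa using h
    let π : (Al L ι × Al L ι') →ₐ[L] (Al L ι × Al L ι') := AlgHom.prodMap (al _ hp) (al _ hp)
    have hπ : ∀ i, π (Tp σ σ' i) = Tp σ σ' (i+o) := fun i => Prod.ext
      (by show al _ hp (Tn σ.R i) = Tn σ.R (i+o); rw [Tn, al_tw, Tn]; show tw (i+o) (i+1+o) _ = _; rw [add_right_comm])
      (by show al _ hp (Tn σ'.R i) = Tn σ'.R (i+o); rw [Tn, al_tw, Tn]; show tw (i+o) (i+1+o) _ = _; rw [add_right_comm])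
    have hsh : ∀ s x, x ∈ HH L (Tp σ σ') s → π x ∈ Hs (L := L) (Tp σ σ') o (o+s+1) := fun s x hx => by
      rw [HH_eq_Hs] at hx
      have := Hs_map π o hπ hx
      rw [zero_add, show s+1+o = o+s+1 by omega] at this; exact this
    have hE' := congrArg π hE
    simp only [map_sum, map_mul, hπ] at hE'
    rw [show r + k*r + o = o + r + k*r by omega] at hE'
    have ha' := fun i => hsh _ _ (ha i)
    have hb' := fun i => hsh _ _ (hb i)
    rw [← add_assoc] at ha' hb'
    have e1 : (π e).1 = ∑ i, (π (a i)).1 * Tn σ.R (o+r+k*r) * (π (b i)).1 := by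
      rw [hE']; simp [Prod.fst_sum, Tp]
    have e2 : (π e).2 = ∑ i, (π (a i)).2 * Tn σ'.R (o+r+k*r) * (π (b i)).2 := by
      rw [hE']; simp [Prod.snd_sum, Tp]
    have k1 : nu ((π e).1 * tp t o (r+1)) = κ := by
      rw [← hk, ← nu_al _ hp (e.1 * _), map_mul (al _ hp), al_tp _ hp t 0 o (r+1) (fun i => by omega)]; rfl
    have k2 : nu ((π e).2 * tp t' o (r+1)) = κ := by
      rw [← hk', ← nu_al _ hp (e.2 * _), map_mul (al _ hp), al_tp _ hp t' 0 o (r+1) (fun i => by omega)]; rfl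
    refine ⟨∑ i, π (b i) * D * π (a i), sum_mem fun i _ => mul_mem (mul_mem (Hs_mono le_rfl ?_ (hb' i)) (Hs_mono ?_ ?_ hD))
      (Hs_mono le_rfl ?_ (ha' i)), ?_, ?_⟩
    · rw [add_mul]; omega
    · omega
    · rw [add_mul]; omega
    · rw [add_mul]; omega
    · have h1' : ∀ Y ∈ Str L ι (Set.Ico (o+r+1+k*r) (o+r+1+k*r+k)),
        nu (D.1 * tp t (o+r+1) (k*r) * Y) = κ^k * nu (tp (σ.g * ti) (o+r+1+k*r) k * Y) := h1
      have st := σ.step hti (o := o) (r := r) (m := k*r) (k := k) (Hs_Str (Hs1 (hsh r e he)))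
        (fun i => Hs_Str (Hs1 (ha' i))) (fun i => Hs_Str (Hs1 (hb' i)))
        (fun i => Hs_tp ht le_rfl (by omega) (Hs1 (ha' i))) e1 (Hs_Str (Hs1 hD)) h1'
      rw [k1] at st
      simp only [Prod.fst_sum, Prod.fst_mul]
      rw [show (k+1)*r = r + k*r by ring, pow_succ, ← add_assoc, ← add_assoc, add_right_comm _ k 1]
      exact st
    · have st := σ'.step hti' (o := o) (r := r) (m := k*r) (k := k) (Hs_Str (Hs2 (hsh r e he)))
        (fun i => Hs_Str (Hs2 (ha' i))) (fun i => Hs_Str (Hs2 (hb' i)))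
        (fun i => Hs_tp ht' le_rfl (by omega) (Hs2 (ha' i))) e2 (Hs_Str (Hs2 hD)) h2
      rw [k2] at st
      simp only [Prod.snd_sum, Prod.snd_mul]
      rw [show (k+1)*r = r + k*r by ring, pow_succ, ← add_assoc, ← add_assoc, add_right_comm _ k 1]
      exact st

lemma transfer_aux (σ : Sys L ι q) (h0 : σ.thb ≠ 0) (ti : Matrix ι ι L) (M k : ℕ) :
    nu (tp (σ.g * ti) M (k+1) * (Gc (Tn σ.R) M k * tp σ.h M (k+1))) = σ.thb^(k+1) * nb ((psi σ.R ti)^[k] ti) := by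
  rw [nu_comm, mul_assoc, ← tp_mul, ← mul_assoc, σ.hg_mul h0, smul_mul_assoc, one_mul, tp_smul, mul_smul_comm, map_smul,
    smul_eq_mul]
  congr 1
  have := chain σ.R ti M (one_mem _) k ti
  rw [nu_one, one_mul, one_mul] at this
  rw [← this, tp, mul_assoc]

theorem transfer (ht : Commute σ.R (t ⊗ₖ t)) (ht' : Commute σ'.R (t' ⊗ₖ t')) (hti : t * ti = 1) (hti' : t' * ti' = 1)
    (h0 : σ.thb ≠ 0) (h0' : σ'.thb ≠ 0)
    (hp : ∀ k, nb ((psi σ.R t)^[k] t) = nb ((psi σ'.R t')^[k] t')) {r : ℕ} {e} (he : e ∈ HH L (Tp σ σ') r)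
    (hn : e ∈ NN L (Tp σ σ') r) (hk : nu (e.1 * tp t 0 (r+1)) ≠ 0) (hr : 1 ≤ r) (k : ℕ) :
    σ.thb^(k+1) * nb ((psi σ.R ti)^[k] ti) = σ'.thb^(k+1) * nb ((psi σ'.R ti')^[k] ti') := by
  have hδ := del_eq ht ht' hp he hn hk
  obtain ⟨D, hD, h1, h2⟩ := tower ht ht' hti hti' he hn rfl (universal' ht ht' hp r e he).symm (k+1) 0
  set κ := nu (e.1 * tp t 0 (r+1))
  simp only [zero_add] at h1 h2 hD
  obtain ⟨M, hM⟩ : ∃ M, (k+1)*r = M+1 := ⟨(k+1)*r-1, by have : 1 ≤ (k+1)*r := Nat.mul_pos (by omega) hr; omega⟩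
  rw [hM] at h1 h2 hD
  have y1 := h1 (Gc (Tn σ.R) (M+1) k * tp σ.h (M+1) (k+1)) (mul_mem (Str_mono (fun i => by simp; omega) (Hs_Str (Gc_mem _ _ _)))
    (tp_mem _ _ _ (fun i => by simp; omega)))
  have y2 := h2 (Gc (Tn σ'.R) (M+1) k * tp σ'.h (M+1) (k+1)) (mul_mem (Str_mono (fun i => by simp; omega) (Hs_Str (Gc_mem _ _ _)))
    (tp_mem _ _ _ (fun i => by simp; omega)))
  rw [transfer_aux σ h0] at y1
  rw [transfer_aux σ' h0'] at y2
  have hx : D * Gc (Tp σ σ') (M+1) k ∈ HH L (Tp σ σ') (M + (k+1)) := by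
    rw [HH_eq_Hs]
    exact mul_mem (Hs_mono le_rfl (by omega) hD) (Hs_mono (by omega) (by omega) (Gc_mem _ _ _))
  obtain ⟨X, hX, x1, x2⟩ := closing (t := t) (t' := t') hδ M (k+1) _ hx
  have u := universal' ht ht' hp M X hX
  rw [← x1, ← x2] at u
  have g1 : (D * Gc (Tp σ σ') (M+1) k).1 = D.1 * Gc (Tn σ.R) (M+1) k := by
    rw [Prod.fst_mul]; congr 1; exact Gc_map (AlgHom.fst L (Al L ι) (Al L ι')) (Tp_fst σ σ') _ _
  have g2 : (D * Gc (Tp σ σ') (M+1) k).2 = D.2 * Gc (Tn σ'.R) (M+1) k := by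
    rw [Prod.snd_mul]; congr 1; exact Gc_map (AlgHom.snd L (Al L ι) (Al L ι')) (Tp_snd σ σ') _ _
  have c1 : Commute (Gc (Tn σ.R) (M+1) k) (tp t 0 (M+1)) :=
    Str_comm (S := Set.Ici (M+1)) (S' := Set.Iio (M+1)) (by rw [Set.disjoint_left]; simp)
      (Str_mono (fun i => by simp; omega) (Hs_Str (Gc_mem _ _ _))) (tp_mem _ _ _ (by simp))
  have c2 : Commute (Gc (Tn σ'.R) (M+1) k) (tp t' 0 (M+1)) :=
    Str_comm (S := Set.Ici (M+1)) (S' := Set.Iio (M+1)) (by rw [Set.disjoint_left]; simp)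
      (Str_mono (fun i => by simp; omega) (Hs_Str (Gc_mem _ _ _))) (tp_mem _ _ _ (by simp))
  rw [g1, g2, mul_assoc D.1, mul_assoc D.2, c1.eq, c2.eq, ← mul_assoc, ← mul_assoc, mul_assoc (D.1 * _), mul_assoc (D.2 * _), y1, y2] at u
  exact mul_left_cancel₀ (pow_ne_zero _ hk) u

end
end
end HS

set_option linter.all false
namespace HS
open Matrix Kronecker

noncomputable section
variable {L ι : Type*} [Field L] [CharZero L] [Fintype ι] [DecidableEq ι] {q : L}

lemma ph_add (R : Matrix (ι × ι) (ι × ι) L) (a b : Matrix ι ι L) : ph R (a + b) = ph R a + ph R b := by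
  ext; simp [ph, mul_add, Finset.sum_add_distrib]

lemma ph_smul (R : Matrix (ι × ι) (ι × ι) L) (c : L) (a : Matrix ι ι L) : ph R (c • a) = c • ph R a := by
  ext
  simp only [ph, of_apply, Matrix.smul_apply, smul_eq_mul, Finset.mul_sum]
  exact Finset.sum_congr rfl fun _ _ => Finset.sum_congr rfl fun _ _ => by ring

def phL (R : Matrix (ι × ι) (ι × ι) L) : Matrix ι ι L →ₗ[L] Matrix ι ι L where
  toFun := ph R
  map_add' := ph_add R
  map_smul' := ph_smul R

lemma exists_sys [Nonempty ι] (R : Matrix (ι × ι) (ι × ι) L) (braid : R1 R * R2 R * R1 R = R2 R * R1 R * R2 R)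
    (quad : R * R = (q - 1) • R + q • 1) (surj : ∀ η, ∃ c, ph R c = η) (q0 : q ≠ 0) : ∃ σ : Sys L ι q, σ.R = R := by
  obtain ⟨h, hh⟩ := surj 1
  have inj : Function.Injective (phL (R.submatrix Prod.swap Prod.swap)) := by
    rw [injective_iff_map_eq_zero]
    intro a ha
    have h0 : ∀ b, nb (a * b) = 0 := fun b => by
      obtain ⟨c, rfl⟩ := surj b
      rw [nb_adj]
      have : ph' R a = 0 := ha
      rw [this, mul_zero]; simp [nb]
    ext i j
    have := h0 (single j i 1)
    rw [nb, trace_mul_comm, trace_single_mul] at this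
    simpa [card_ne (L := L) (ι := ι)] using this
  obtain ⟨g, hg⟩ := (LinearMap.injective_iff_surjective.1 inj) 1
  exact ⟨⟨R, braid, quad, h, g, hh, hg, surj, q0⟩, rfl⟩

section DJ
variable {N : ℕ}

def djP (q : L) (a b : (Fin N)) : L := if b < a then q - 1 else 0
def djQ (q : L) (c : (Fin N) → L) (a b : (Fin N)) : L := if a = b then c a else if a < b then 1 else q

def dj (q : L) (c : (Fin N) → L) : Matrix ((Fin N) × (Fin N)) ((Fin N) × (Fin N)) L := of fun x y =>
  (if x = y then djP q x.1 x.2 else 0) + (if x.swap = y then djQ q c x.1 x.2 else 0)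

lemma dj_mulVec (c : (Fin N) → L) (f : (Fin N) × (Fin N) → L) (a b : (Fin N)) :
    (dj q c *ᵥ f) (a, b) = djP q a b * f (a, b) + djQ q c a b * f (b, a) := by
  simp [mulVec, dotProduct, dj, add_mul, Finset.sum_add_distrib]

lemma R1_mulVec (c : (Fin N) → L) (f : (Fin N) × (Fin N) × (Fin N) → L) (x y z : (Fin N)) :
    (R1 (dj q c) *ᵥ f) (x, y, z) = djP q x y * f (x, y, z) + djQ q c x y * f (y, x, z) := by
  rw [← dj_mulVec c (fun p => f (p.1, p.2, z)) x y]
  simp only [mulVec, dotProduct, R1, submatrix_apply, kroneckerMap_apply, Fintype.sum_prod_type, Equiv.prodAssoc_symm_apply]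
  simp [one_apply]

lemma R2_mulVec (c : (Fin N) → L) (f : (Fin N) × (Fin N) × (Fin N) → L) (x y z : (Fin N)) :
    (R2 (dj q c) *ᵥ f) (x, y, z) = djP q y z * f (x, y, z) + djQ q c y z * f (x, z, y) := by
  rw [← dj_mulVec c (fun p => f (x, p.1, p.2)) y z]
  simp only [mulVec, dotProduct, R2, kroneckerMap_apply, Fintype.sum_prod_type]
  simp [one_apply, Finset.sum_ite_eq, ite_mul]

lemma ext_mulVec {n : Type*} [Fintype n] [DecidableEq n] {A B : Matrix n n L} (h : ∀ f x, (A *ᵥ f) x = (B *ᵥ f) x) : A = B := by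
  refine Matrix.toLin'.injective (LinearMap.ext fun f => funext fun x => h f x)

lemma dj_quad (c : (Fin N) → L) (hc : ∀ i, c i * c i = (q-1) * c i + q) : dj q c * dj q c = (q - 1) • dj q c + q • 1 := by
  refine ext_mulVec fun f x => ?_
  obtain ⟨a, b⟩ := x
  rw [← mulVec_mulVec, add_mulVec, smul_mulVec, smul_mulVec, one_mulVec]
  simp only [dj_mulVec, Pi.add_apply, Pi.smul_apply, smul_eq_mul]
  rcases lt_trichotomy a b with h | rfl | h
  · simp [djP, djQ, h, h.ne, h.ne', h.not_gt]; try ring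
  · simp [djP, djQ]; linear_combination f (a, a) * hc a
  · simp [djP, djQ, h, h.ne, h.ne', h.not_gt]; try ring

lemma dj_braid (c : (Fin N) → L) (hc : ∀ i, c i * c i = (q-1) * c i + q) :
    R1 (dj q c) * R2 (dj q c) * R1 (dj q c) = R2 (dj q c) * R1 (dj q c) * R2 (dj q c) := by
  refine ext_mulVec fun f x => ?_
  obtain ⟨x, y, z⟩ := x
  simp only [← mulVec_mulVec, R1_mulVec, R2_mulVec]
  have hu : ∀ x y : Fin N, x = y → djP q x y = 0 ∧ djQ q c x y = c x := fun x y h => by simp [djP, djQ, h]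
  have hl : ∀ x y : Fin N, x < y → djP q x y = 0 ∧ djQ q c x y = 1 ∧ djP q y x = q - 1 ∧ djQ q c y x = q := fun x y h => by
    simp [djP, djQ, h, h.ne, h.ne', h.not_gt]
  have hux := fun x => hu x x rfl
  rcases lt_trichotomy x y with h1 | h1 | h1 <;> rcases lt_trichotomy y z with h2 | h2 | h2 <;>
    rcases lt_trichotomy x z with h3 | h3 | h3
  all_goals first
    | (exfalso; omega)
    | (subst_vars; simp [hux]; done)
    | (subst_vars; simp only [hl _ _ h1, hl _ _ h2, hl _ _ h3, hux]; ring1)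
    | (subst_vars; simp only [hl _ _ h1, hl _ _ h3, hux]; ring1)
    | (subst_vars; simp only [hl _ _ h2, hl _ _ h3, hux]; ring1)
    | (subst_vars; simp only [hl _ _ h1, hl _ _ h2, hux]; ring1)
    | (subst_vars; simp only [hl _ _ h2, hl _ _ h3, hux]; linear_combination (q-1) * f (y, y, z) * hc y)
    | (subst_vars; simp only [hl _ _ h1, hl _ _ h3, hux]; linear_combination -(q-1) * f (x, z, z) * hc z)

lemma dj_comm (c t : (Fin N) → L) : Commute (dj q c) (diagonal t ⊗ₖ diagonal t) := by
  refine ext_mulVec fun f x => ?_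
  obtain ⟨a, b⟩ := x
  rw [diagonal_kronecker_diagonal, ← mulVec_mulVec, ← mulVec_mulVec, mulVec_diagonal, dj_mulVec, dj_mulVec,
    mulVec_diagonal, mulVec_diagonal]
  ring

lemma ph_dj (c : (Fin N) → L) (β : Matrix (Fin N) (Fin N) L) (a b : (Fin N)) :
    ph (dj q c) β a b = (Fintype.card (Fin N) : L)⁻¹ * ((if a = b then (q-1) * ∑ j with j < a, β j j else 0) + djQ q c a b * β a b) := by
  simp only [ph, of_apply, dj, add_mul, Finset.sum_add_distrib]
  congr 2
  · simp only [Prod.mk.injEq, ite_mul, zero_mul]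
    split_ifs with h
    · subst h; simp [djP, Finset.sum_filter, Finset.mul_sum]
    · simp [h]
  · simp only [Prod.swap_prod_mk, Prod.mk.injEq, ite_and, ite_mul, zero_mul]
    simp

lemma dj_surj [NeZero N] (q0 : q ≠ 0) (c : (Fin N) → L) (hc : ∀ i, c i ≠ 0) (η : Matrix (Fin N) (Fin N) L) : ∃ β, ph (dj q c) β = η := by
  have inj : Function.Injective (phL (dj q c)) := by
    rw [injective_iff_map_eq_zero]
    intro β hβ
    have h0 : ∀ a b, ph (dj q c) β a b = 0 := fun a b => congrFun (congrFun hβ a) b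
    have hd := card_ne (L := L) (ι := Fin N)
    have hdiag : ∀ a, β a a = 0 := by
      intro a
      induction a using WellFoundedLT.induction with
      | ind a ih =>
        have := h0 a a
        rw [ph_dj, Finset.sum_eq_zero (fun j hj => ih j (by simpa using hj))] at this
        simpa [djQ, hc, NeZero.ne N] using this
    ext a b
    by_cases hab : a = b
    · subst hab; exact hdiag a
    · have := h0 a b
      rw [ph_dj, if_neg hab, zero_add, djQ, if_neg hab] at this
      split_ifs at this <;> simpa [NeZero.ne N, q0] using this
  exact LinearMap.injective_iff_surjective.1 inj η

end DJ

/-- prefix product recursion -/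
lemma prefix_prod {A : Type*} [CommRing A] (F a b : ℕ → A) (e : A) (N : ℕ)
    (h : ∀ i < N, F i * a i = b i * (1 + e * ∑ j ∈ Finset.range i, F j)) :
    (1 + e * ∑ j ∈ Finset.range N, F j) * ∏ i ∈ Finset.range N, a i = ∏ i ∈ Finset.range N, (a i + e * b i) := by
  induction N with
  | zero => simp
  | succ N ih =>
    have ih := ih (fun i hi => h i (by omega))
    rw [Finset.sum_range_succ, Finset.prod_range_succ, Finset.prod_range_succ, ← ih]
    linear_combination (e * ∏ i ∈ Finset.range N, a i) * h N (by omega)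

lemma prefix_fin {A : Type*} [CommRing A] {N : ℕ} (F a b : Fin N → A) (e : A)
    (h : ∀ i, F i * a i = b i * (1 + e * ∑ j with j < i, F j)) :
    (1 + e * ∑ j, F j) * ∏ i, a i = ∏ i, (a i + e * b i) := by
  have key := prefix_prod (fun i => if h : i < N then F ⟨i, h⟩ else 0) (fun i => if h : i < N then a ⟨i, h⟩ else 0)
    (fun i => if h : i < N then b ⟨i, h⟩ else 0) e N (fun i hi => by
      simp only [hi, dif_pos]
      rw [h ⟨i, hi⟩]
      congr 3
      have : ∑ j : Fin N with j < ⟨i, hi⟩, F j = ∑ j : Fin N, if (j : ℕ) < i then F j else 0 := by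
        rw [Finset.sum_filter]; rfl
      rw [this]
      have h2 : ∀ j : Fin N, (if (j : ℕ) < i then F j else 0) = (fun n : ℕ => if n < i then (if h : n < N then F ⟨n, h⟩ else 0) else 0) j := by
        intro j; simp
      rw [Finset.sum_congr rfl (fun j _ => h2 j), Fin.sum_univ_eq_sum_range (fun n : ℕ => if n < i then (if h : n < N then F ⟨n, h⟩ else 0) else 0), ← Finset.sum_filter]
      refine Finset.sum_congr ?_ fun _ _ => rfl
      ext n; simp; omega)
  rw [← Fin.sum_univ_eq_sum_range, ← Fin.prod_univ_eq_prod_range, ← Fin.prod_univ_eq_prod_range (fun i => (if h : i < N then a ⟨i, h⟩ else 0) + e * (if h : i < N then b ⟨i, h⟩ else 0))] at key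
  simpa using key

lemma dj_del {N : ℕ} [NeZero N] (c : Fin N → L) (σ : Sys L (Fin N) q) (hσ : σ.R = dj q c) :
    (1 - (q-1) * σ.del) * ∏ i, c i = ∏ i, (c i - (q-1)) := by
  have hd : (N : L) ≠ 0 := by simpa using card_ne (L := L) (ι := Fin N)
  have h := prefix_fin (fun i => (N : L)⁻¹ * σ.h i i) c 1 (-(q-1)) (fun i => by
    have := congrFun (congrFun σ.hh i) i
    rw [hσ, ph_dj, if_pos rfl, djQ, if_pos rfl, one_apply_eq] at this
    rw [← Finset.mul_sum]
    simp only [Fintype.card_fin] at this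
    simp only [Pi.one_apply]
    linear_combination this)
  rw [Sys.del, nb, trace]
  simp only [← Finset.mul_sum, Fintype.card_fin] at h ⊢
  simp only [Pi.one_apply, mul_one] at h
  simp only [diag_apply, sub_eq_add_neg (c _), sub_eq_add_neg (1:L), ← neg_mul]
  exact h

end
end HS

set_option linter.all false
namespace HS
open Matrix Kronecker

noncomputable section
variable {L ι : Type*} [Field L] [CharZero L] [Fintype ι] [DecidableEq ι] {q : L}

def pt (R : Matrix (ι × ι) (ι × ι) L) (t : Matrix ι ι L) (k : ℕ) : L :=
  (Fintype.card ι : L) ^ (k+1) * nb ((psi R t)^[k] t)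

lemma psi_smul (R : Matrix (ι × ι) (ι × ι) L) (t : Matrix ι ι L) (s u : L) (β : Matrix ι ι L) :
    psi R (s • t) (u • β) = (s * u) • psi R t β := by
  simp only [psi, ph_smul, smul_mul_smul_comm, mul_comm s]

lemma psi_iter_smul (R : Matrix (ι × ι) (ι × ι) L) (t : Matrix ι ι L) (s : L) (k : ℕ) :
    (psi R (s • t))^[k] (s • t) = s ^ (k+1) • (psi R t)^[k] t := by
  induction k with
  | zero => simp
  | succ k ih => rw [Function.iterate_succ_apply', Function.iterate_succ_apply', ih, psi_smul, pow_succ' s (k+1)]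

lemma pt_smul (R : Matrix (ι × ι) (ι × ι) L) (t : Matrix ι ι L) (s : L) (k : ℕ) :
    pt R (s • t) k = s ^ (k+1) * pt R t k := by
  rw [pt, pt, psi_iter_smul, nb, nb, trace_smul, smul_eq_mul]; ring

def WW (q : L) (p : ℕ → L) : PowerSeries L := 1 + PowerSeries.C (q-1) * (PowerSeries.X * PowerSeries.mk p)

lemma WW_inj (h1 : q ≠ 1) {p p' : ℕ → L} (h : WW q p = WW q p') : p = p' := by
  have h2 := add_left_cancel h
  funext k
  have := congrArg (PowerSeries.coeff (k+1)) h2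
  rw [PowerSeries.coeff_C_mul, PowerSeries.coeff_C_mul, PowerSeries.coeff_succ_X_mul, PowerSeries.coeff_succ_X_mul] at this
  simpa [sub_ne_zero.2 h1] using this

section DJ
variable {N : ℕ}
def djs (q : L) (c t f : Fin N → L) (i : Fin N) : L := t i * (c i * f i + (q-1) * ∑ j with j < i, f j)

lemma psi_dj (c t f : Fin N → L) : psi (dj q c) (diagonal t) (diagonal f) = (N : L)⁻¹ • diagonal (djs q c t f) := by
  ext a b
  rw [psi, mul_diagonal, ph_dj]
  by_cases h : a = b
  · subst h; simp [djs, djQ]; ring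
  · simp [h]

lemma psi_dj_iter (c t : Fin N → L) (k : ℕ) : (psi (dj q c) (diagonal t))^[k] (diagonal t) = ((N : L)⁻¹)^k • diagonal ((djs q c t)^[k] t) := by
  induction k with
  | zero => simp
  | succ k ih =>
    rw [Function.iterate_succ_apply', Function.iterate_succ_apply', ih]
    have := psi_smul (dj q c) (diagonal t) 1 ((N:L)⁻¹^k) (diagonal ((djs q c t)^[k] t))
    rw [one_smul, one_mul] at this
    rw [this, psi_dj, smul_smul, pow_succ]

lemma pt_dj [NeZero N] (c t : Fin N → L) (k : ℕ) : pt (dj q c) (diagonal t) k = ∑ i, (djs q c t)^[k] t i := by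
  have : (N : L) ≠ 0 := NeZero.ne _
  rw [pt, psi_dj_iter, nb, trace_smul, trace_diagonal, Fintype.card_fin, smul_eq_mul, inv_pow]
  field_simp; ring

lemma W_dj [NeZero N] (c t : Fin N → L) :
    WW q (pt (dj q c) (diagonal t)) * ∏ i, (1 - PowerSeries.C (c i * t i) * PowerSeries.X)
      = ∏ i, (1 - PowerSeries.C (c i * t i) * PowerSeries.X + PowerSeries.C ((q-1) * t i) * PowerSeries.X) := by
  have := prefix_fin (A := PowerSeries L) (fun i => PowerSeries.X * PowerSeries.mk fun k => (djs q c t)^[k] t i)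
    (fun i => 1 - PowerSeries.C (c i * t i) * PowerSeries.X) (fun i => PowerSeries.C (t i) * PowerSeries.X) (PowerSeries.C (q-1)) ?_
  · convert this using 2
    · rw [WW, ← Finset.mul_sum]
      congr 3
      ext k
      simp [pt_dj]
    · simp [mul_assoc]
  intro i
  have key : (PowerSeries.mk fun k => (djs q c t)^[k] t i) = PowerSeries.C (t i) + PowerSeries.X * (PowerSeries.C (t i) *
      (PowerSeries.C (c i) * (PowerSeries.mk fun k => (djs q c t)^[k] t i) + PowerSeries.C (q-1) * ∑ j with j < i, PowerSeries.mk fun k => (djs q c t)^[k] t j)) := by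
    ext k
    rcases k with _ | k
    · simp
    · rw [map_add, PowerSeries.coeff_succ_X_mul, PowerSeries.coeff_C_mul, map_add, PowerSeries.coeff_C_mul, PowerSeries.coeff_C_mul, map_sum]
      simp [Function.iterate_succ_apply', djs, PowerSeries.coeff_C]
  rw [← Finset.mul_sum, map_mul]
  linear_combination PowerSeries.X * key
end DJ
end
end HS

set_option linter.all false
namespace HS
open Matrix Kronecker

noncomputable section
variable {L ι ι' : Type*} [Field L] [CharZero L] [Fintype ι] [DecidableEq ι] [Nonempty ι]
  [Fintype ι'] [DecidableEq ι'] [Nonempty ι'] {q : L}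

lemma NN_map {P Q : Type*} [Ring P] [Algebra L P] [Ring Q] [Algebra L Q] {T : ℕ → P} {T' : ℕ → Q} (π : P →ₐ[L] Q)
    (hπ : ∀ i, π (T i) = T' i) {r : ℕ} {x : P} (hx : x ∈ NN L T r) : π x ∈ NN L T' r := by
  obtain ⟨k, b, c, hb, hc, rfl⟩ := NN_rep hx
  rw [map_sum]
  refine sum_mem fun i _ => ?_
  rw [map_mul, map_mul, hπ]
  exact NN_mem (HH_map π hπ (hb i)) (HH_map π hπ (hc i))

lemma exists_dN (q0 : q ≠ 0) (N : ℕ) : ∃ σ : Sys L (Fin (N+1)) q, σ.R = dj q fun _ => q :=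
  exists_sys _ (dj_braid _ fun _ => by ring) (dj_quad _ fun _ => by ring) (dj_surj q0 _ fun _ => q0) q0

def dN (q0 : q ≠ 0) (N : ℕ) : Sys L (Fin (N+1)) q := (exists_dN q0 N).choose
lemma dN_R (q0 : q ≠ 0) (N : ℕ) : (dN q0 N).R = dj q fun _ => q := (exists_dN q0 N).choose_spec

lemma dN_comm (q0 : q ≠ 0) (N : ℕ) : Commute (dN q0 N).R ((dN q0 N).h ⊗ₖ (dN q0 N).h) := by
  have h : ∃ f, (dN q0 N).h = diagonal f := by
    refine ⟨fun i => (dN q0 N).h i i, ?_⟩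
    ext a b
    by_cases hab : a = b
    · subst hab; simp
    · have := congrFun (congrFun (dN q0 N).hh a) b
      rw [dN_R, ph_dj] at this
      simp only [hab, if_false, zero_add, one_apply, ne_eq, not_false_eq_true] at this
      rw [diagonal_apply_ne _ hab]
      have hQ : djQ q (fun _ : Fin (N+1) => q) a b ≠ 0 := by
        unfold djQ; split_ifs <;> simp [q0]
      have hN : ((Fintype.card (Fin (N+1)) : L))⁻¹ ≠ 0 := inv_ne_zero (card_ne (L := L) (ι := Fin (N+1)))
      exact (mul_eq_zero.1 ((mul_eq_zero.1 this).resolve_left hN)).resolve_left hQ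
  obtain ⟨f, hf⟩ := h
  rw [hf, dN_R]
  exact dj_comm _ _

lemma dN_inj (q0 : q ≠ 0) (hq : ∀ n : ℕ, 1 ≤ n → q ^ n ≠ 1) : Function.Injective fun N => (dN q0 N).del := by
  have key : ∀ N, (1 - (q-1) * (dN q0 N).del) * q ^ (N+1) = 1 := fun N => by
    have := dj_del _ _ (dN_R q0 N)
    simpa using this
  have aux : ∀ N M : ℕ, N < M → (dN q0 N).del ≠ (dN q0 M).del := by
    intro N M h he
    have h1 := key N
    have h2 := key M
    rw [he] at h1
    refine hq (M - N) (by omega) ?_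
    have h3 : q ^ (M+1) = q ^ (N+1) := by
      have : (1 - (q-1) * (dN q0 M).del) ≠ 0 := fun h0 => by rw [h0] at h1; simp at h1
      exact mul_left_cancel₀ this (h2.trans h1.symm)
    rw [show M+1 = (M-N) + (N+1) by omega, pow_add] at h3
    exact mul_right_cancel₀ (pow_ne_zero (N+1) q0) (by rw [h3, one_mul])
  intro N M h
  rcases lt_trichotomy N M with h' | h' | h'
  · exact absurd h (aux _ _ h')
  · exact h'
  · exact absurd h.symm (aux _ _ h')

abbrev PP (L ι ι' : Type*) [Field L] [CharZero L] [Fintype ι] [DecidableEq ι] [Nonempty ι]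
  [Fintype ι'] [DecidableEq ι'] [Nonempty ι'] : Type _ := (Al L ι × Al L ι') × (∀ N : ℕ, Al L (Fin (N+1)))

variable (σ : Sys L ι q) (σ' : Sys L ι' q)
def TT (i : ℕ) : PP L ι ι' := (Tp σ σ' i, fun N => Tn (dN σ.q0 N).R i)

def prN (N : ℕ) : PP L ι ι' →ₐ[L] Al L (Fin (N+1)) :=
  (Pi.evalAlgHom L (fun N : ℕ => Al L (Fin (N+1))) N).comp (AlgHom.snd L (Al L ι × Al L ι') (∀ N : ℕ, Al L (Fin (N+1))))

lemma TT_prN (N i : ℕ) : prN N (TT σ σ' i) = Tn (dN σ.q0 N).R i := rfl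

lemma TT_hecke : IsHecke q (TT σ σ') where
  quad i := Prod.ext ((Tp_hecke σ σ').quad i) (funext fun N => (dN σ.q0 N).hecke.quad i)
  braid i := Prod.ext ((Tp_hecke σ σ').braid i) (funext fun N => (dN σ.q0 N).hecke.braid i)
  comm i j h := Prod.ext ((Tp_hecke σ σ').comm i j h) (funext fun N => (dN σ.q0 N).hecke.comm i j h)

def muN (N r : ℕ) : PP L ι ι' →ₗ[L] L :=
  (nu.comp (LinearMap.mulRight L (tp (dN σ.q0 N).h 0 (r+1)))).comp (prN N).toLinearMap

lemma muN_apply (N r : ℕ) (x : PP L ι ι') : muN σ N r x = nu (prN N x * tp (dN σ.q0 N).h 0 (r+1)) := rfl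

lemma TT_HH {r : ℕ} {x} (hx : x ∈ HH L (TT σ σ') r) (N : ℕ) : prN N x ∈ HH L (Tn (dN σ.q0 N).R) r :=
  HH_map (T := TT σ σ') (T' := Tn (dN σ.q0 N).R) (prN N) (TT_prN σ σ' N) hx

lemma markov (hq : ∀ n : ℕ, 1 ≤ n → q ^ n ≠ 1) : MarkovFam (TT σ σ') (fun N => (dN σ.q0 N).del) (muN σ) where
  inj := dN_inj σ.q0 hq
  m0 N := by
    rw [muN_apply, map_one, one_mul, tp, tp, one_mul, nu_jj]; rfl
  m1 N r a ha := by
    rw [muN_apply, muN_apply, tp.eq_2 _ _ (r+1), ← mul_assoc, nu_mul_j (S := Set.Iio (r+1)) (by simp), mul_comm]; rfl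
    exact mul_mem (HH_Str (TT_HH σ σ' ha N)) (tp_mem _ _ _ (by simp))
  m2 N r b c hb hc := by
    have := (dN σ.q0 N).E_close (r := r) (S := Set.Iio (r+1)) (by simp) (A := tp (dN σ.q0 N).h 0 (r+1)) (tp_mem _ _ _ (by simp)) (a := 0) (zero_mem _)
      (k := 1) (b := fun _ => prN N b) (c := fun _ => prN N c) (fun _ => TT_HH σ σ' hb N) (fun _ => TT_HH σ σ' hc N)
    rw [muN_apply, muN_apply, tp.eq_2 _ _ (r+1), ← mul_assoc, map_mul (prN N), map_mul (prN N), map_mul (prN N), TT_prN]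
    simpa using this

def JA (L ι : Type*) [Field L] [CharZero L] [Fintype ι] [DecidableEq ι] [Nonempty ι] (n : ℕ) :
    Matrix (Fin n → ι) (Fin n → ι) L →ₐ[L] Al L ι :=
  (JN (L := L) (ι := ι) n).codRestrict (AA L ι) (fun Y => AAn_le n ⟨Y, rfl⟩)

lemma exists_W (n : ℕ) (hn : n ≠ 0) : ∃ W : Submodule L (Al L ι × Al L ι'), FiniteDimensional L W ∧
    Module.finrank L W ≤ (Fintype.card ι ^ 2 + Fintype.card ι' ^ 2) ^ n ∧
    ∀ x : Al L ι × Al L ι', x.1 ∈ Str L ι (Set.Iio n) → x.2 ∈ Str L ι' (Set.Iio n) → x ∈ W := by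
  refine ⟨LinearMap.range (LinearMap.prodMap (JA L ι n).toLinearMap (JA L ι' n).toLinearMap), inferInstance, ?_, fun x h1 h2 => ?_⟩
  · refine (LinearMap.finrank_range_le _).trans ?_
    rw [Module.finrank_prod, Module.finrank_matrix, Module.finrank_matrix, Module.finrank_self, mul_one, mul_one]
    simp only [Fintype.card_pi, Finset.prod_const, Finset.card_univ, Fintype.card_fin]
    rw [← mul_pow, ← mul_pow, ← sq, ← sq]
    exact pow_add_pow_le (Nat.zero_le _) (Nat.zero_le _) hn
  · obtain ⟨Y, hY⟩ := Str_AAn h1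
    obtain ⟨Z, hZ⟩ := Str_AAn h2
    exact ⟨(Y, Z), Prod.ext (Subtype.ext hY) (Subtype.ext hZ)⟩

theorem exists_e (hq : ∀ n : ℕ, 1 ≤ n → q ^ n ≠ 1) : ∃ r, 1 ≤ r ∧ ∃ e ∈ HH L (Tp σ σ') r, e * e = e ∧ e ≠ 0 ∧ e ∈ NN L (Tp σ σ') r := by
  haveI : Nontrivial (Al L ι × Al L ι') := ⟨0, 1, fun h => by
    have := congrArg (fun x : Al L ι × Al L ι' => nu x.1) h
    simp [nu_one] at this⟩
  have hfst : ∀ i, (AlgHom.fst L (Al L ι × Al L ι') (∀ N : ℕ, Al L (Fin (N+1)))) (TT σ σ' i) = Tp σ σ' i := fun _ => rfl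
  obtain ⟨r, e, he, hee, h0, y, hy, hey⟩ := (TT_hecke σ σ').deep σ.q0 (markov σ σ' hq) (by
    intro N r z hz hn
    rw [muN_apply]
    refine nu_nilp ?_
    have hc : Commute (prN N z) (tp (dN σ.q0 N).h 0 (r+1)) := (dN σ.q0 N).HH_tp (dN_comm σ.q0 N) le_rfl (TT_HH σ σ' hz N)
    exact hc.isNilpotent_mul_right (hn.map (prN N))) (AlgHom.fst L (Al L ι × Al L ι') (∀ N : ℕ, Al L (Fin (N+1))))
    (Fintype.card ι ^ 2 + Fintype.card ι' ^ 2) (by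
    intro r
    obtain ⟨W, h1, h2, h3⟩ := exists_W (L := L) (ι := ι) (ι' := ι') (r+1) (by omega)
    refine ⟨W, h1, h2, fun x hx => h3 _ ?_ ?_⟩
    · exact HH_Str (HH1 (HH_map (T := TT σ σ') (T' := Tp σ σ') _ hfst hx))
    · exact HH_Str (HH2 (HH_map (T := TT σ σ') (T' := Tp σ σ') _ hfst hx)))
  set e' := (AlgHom.fst L (Al L ι × Al L ι') (∀ N : ℕ, Al L (Fin (N+1)))) e with he'
  have m1 : e' ∈ HH L (Tp σ σ') r := HH_map (T := TT σ σ') (T' := Tp σ σ') _ hfst he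
  have m2 : e' ∈ NN L (Tp σ σ') r := hey ▸ NN_map (T := TT σ σ') (T' := Tp σ σ') _ hfst hy
  refine ⟨r+1, by omega, e', HH_mono (by omega) m1, ?_, h0, (Tp_hecke σ σ').ext_NN σ.q0 m1 m2⟩
  rw [he', ← map_mul, hee]
end
end HS

set_option linter.all false
namespace HS
open Matrix Kronecker

noncomputable section
variable {L ι ι' : Type*} [Field L] [CharZero L] [Fintype ι] [DecidableEq ι] [Nonempty ι]
  [Fintype ι'] [DecidableEq ι'] [Nonempty ι'] {q : L}

lemma emb_diag (n : ℕ) (f : (Fin n → ι) → L) : embM n (diagonal f) = diagonal fun u => f (Fin.init u) := by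
  ext u v
  simp only [embM, diagonal_apply]
  have : u = v ↔ Fin.init u = Fin.init v ∧ u (Fin.last n) = v (Fin.last n) := by
    constructor
    · rintro rfl; simp
    · rintro ⟨h1, h2⟩
      rw [← Fin.snoc_init_self u, ← Fin.snoc_init_self v, h1, h2]
  by_cases h1 : Fin.init u = Fin.init v <;> by_cases h2 : u (Fin.last n) = v (Fin.last n) <;> simp [this, h1, h2]

lemma last_diag (n : ℕ) (f : ι → L) : lastM n (diagonal f) = diagonal fun u => f (u (Fin.last n)) := by
  ext u v
  simp only [lastM, diagonal_apply]
  have : u = v ↔ Fin.init u = Fin.init v ∧ u (Fin.last n) = v (Fin.last n) := by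
    constructor
    · rintro rfl; simp
    · rintro ⟨h1, h2⟩
      rw [← Fin.snoc_init_self u, ← Fin.snoc_init_self v, h1, h2]
  by_cases h1 : Fin.init u = Fin.init v <;> by_cases h2 : u (Fin.last n) = v (Fin.last n) <;> simp [this, h1, h2]

lemma tp_diag (f : ι → L) (n : ℕ) : JN n (diagonal fun u : Fin n → ι => ∏ i, f (u i)) = (tp (diagonal f) 0 n).1 := by
  induction n with
  | zero =>
    have : (diagonal fun u : Fin 0 → ι => ∏ i, f (u i)) = 1 := by simp
    rw [this, map_one]; rfl
  | succ n ih =>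
    have e : (tp (diagonal f) 0 (n+1)).1 = (tp (diagonal f) 0 n).1 * jE n (diagonal f) := by
      rw [tp.eq_2, zero_add]; rfl
    rw [e, ← ih, ← JN_last, ← JN_emb n, ← map_mul, emb_diag, last_diag, diagonal_mul_diagonal]
    congr 2
    funext u
    rw [Fin.prod_univ_castSucc]; rfl

lemma JN_inj (n : ℕ) : Function.Injective (JN (L := L) (ι := ι) n) := Jhom_inj _ Fin.val_injective

lemma nu_idem {e : Al L ι} (h : e * e = e) (h0 : e ≠ 0) : nu e ≠ 0 := by
  obtain ⟨n, X, Y, hX, hY⟩ := common e e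
  have hXX : X * X = X := JN_inj n (by rw [map_mul, hX]; exact congrArg Subtype.val h)
  rw [nu_eq hX]
  obtain ⟨k, hk, hk0⟩ := trace_idem_nat X hXX
  refine mul_ne_zero (pow_ne_zero _ (inv_ne_zero card_ne)) ?_
  rw [hk]
  intro hk'
  have := hk0 (by exact_mod_cast hk')
  rw [this, map_zero] at hX
  exact h0 (Subtype.ext hX.symm)

lemma nu_idem_w (φ : ℝ →+* L) (z : ι → ℝ) (hz : ∀ i, 0 < z i) {n : ℕ} {e : Al L ι} (h : e * e = e) (h0 : e ≠ 0) (hm : e ∈ Str L ι (Set.Iio n))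
    (hc : Commute e (tp (diagonal fun i => φ (z i)) 0 n)) : nu (e * tp (diagonal fun i => φ (z i)) 0 n) ≠ 0 := by
  obtain ⟨X, hX⟩ := Str_AAn hm
  replace hX : JN n X = e.1 := hX
  have hXX : X * X = X := JN_inj n (by rw [map_mul, hX]; exact congrArg Subtype.val h)
  have hT := tp_diag (fun i => φ (z i)) n
  simp only [← map_prod] at hT
  have hcc := congrArg Subtype.val hc.eq
  have hXT : JN n (X * diagonal fun u : Fin n → ι => φ (∏ i, z (u i))) = (e * tp (diagonal fun i => φ (z i)) 0 n).1 := by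
    rw [map_mul, hX, hT]; rfl
  rw [nu_eq hXT]
  refine mul_ne_zero (pow_ne_zero _ (inv_ne_zero card_ne)) fun h00 => ?_
  have := trace_idem_weight X hXX φ (fun u => ∏ i, z (u i)) (fun u => Finset.prod_pos fun i _ => hz _) (JN_inj n (by
    rw [hXT, hcc, map_mul, hX, hT]; rfl)) h00
  rw [this, map_zero] at hX
  exact h0 (Subtype.ext hX.symm)

lemma nb_iter (R : Matrix (ι × ι) (ι × ι) L) (t : Matrix ι ι L) (k : ℕ) :
    nb ((psi R t)^[k] t) = ((Fintype.card ι : L)⁻¹) ^ (k+1) * pt R t k := by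
  have : (Fintype.card ι : L) ≠ 0 := card_ne
  rw [pt, ← mul_assoc, ← mul_pow, inv_mul_cancel₀ this, one_pow, one_mul]

theorem main_sym (hq : ∀ n : ℕ, 1 ≤ n → q ^ n ≠ 1) (σ : Sys L ι q) {N : ℕ} [NeZero N] (φ : ℝ →+* L) (c : Fin N → L)
    (hc : ∀ i, c i = q ∨ c i = -1) (z : Fin N → ℝ) (hz : ∀ i, 0 < z i)
    (hp : ∀ k, pt σ.R 1 k = pt (dj q c) (diagonal fun i => φ (z i)) k) (k : ℕ) :
    pt σ.R 1 k = pt (dj q c) (diagonal fun i => φ (z i)⁻¹) k := by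
  have q0 := σ.q0
  have hcc : ∀ i, c i * c i = (q-1) * c i + q := fun i => by rcases hc i with h | h <;> rw [h] <;> ring
  have hc0 : ∀ i, c i ≠ 0 := fun i => by rcases hc i with h | h <;> rw [h] <;> simp [q0]
  obtain ⟨σ', hσ'⟩ := exists_sys (dj q c) (dj_braid c hcc) (dj_quad c hcc) (dj_surj q0 c hc0) q0
  set d : ℕ := Fintype.card ι with hd
  have d0 : (d : L) ≠ 0 := card_ne
  have N0 : (N : L) ≠ 0 := NeZero.ne _
  have dpos : (0 : ℝ) < d := by exact_mod_cast Fintype.card_pos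
  have Npos : (0 : ℝ) < N := by exact_mod_cast NeZero.pos N
  set s : ℝ := N / d with hs
  have spos : 0 < s := by positivity
  have hφs : φ s = (N : L) / d := by simp [hs]
  set z' : Fin N → ℝ := fun i => s * z i with hz'
  have e1 : (diagonal fun i => φ (z' i)) = φ s • diagonal fun i => φ (z i) := by
    rw [← diagonal_smul]; congr 1; funext i; simp [hz']
  have e2 : (diagonal fun i => φ (z' i)⁻¹) = (φ s)⁻¹ • diagonal fun i => φ (z i)⁻¹ := by
    rw [← diagonal_smul]; congr 1; funext i; simp [hz', mul_comm]
  have ht : Commute σ.R ((1 : Matrix ι ι L) ⊗ₖ (1 : Matrix ι ι L)) := by simp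
  have ht' : Commute σ'.R ((diagonal fun i => φ (z' i)) ⊗ₖ (diagonal fun i => φ (z' i))) := by
    rw [hσ']; exact dj_comm _ _
  have hti' : (diagonal fun i => φ (z' i)) * (diagonal fun i => φ (z' i)⁻¹) = 1 := by
    rw [diagonal_mul_diagonal, ← diagonal_one]; congr 1; funext i
    have : z' i ≠ 0 := (mul_pos spos (hz i)).ne'
    rw [map_inv₀]; exact mul_inv_cancel₀ ((map_ne_zero φ).2 this)
  have hpp : ∀ k, nb ((psi σ.R 1)^[k] 1) = nb ((psi σ'.R (diagonal fun i => φ (z' i)))^[k] (diagonal fun i => φ (z' i))) := by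
    intro k
    rw [nb_iter, nb_iter, hσ', e1, pt_smul, hp k, ← mul_assoc, ← mul_pow, hφs, Fintype.card_fin]
    congr 2
    rw [← hd]; field_simp
  obtain ⟨r, hr, e, he, hee, h0, hn⟩ := exists_e σ σ' hq
  have hk : nu (e.1 * tp (1 : Matrix ι ι L) 0 (r+1)) ≠ 0 := by
    by_cases h1 : e.1 = 0
    · rw [universal' ht ht' hpp r e he]
      refine nu_idem_w φ z' (fun i => mul_pos spos (hz i)) (congrArg Prod.snd hee) (fun h2 => h0 (Prod.ext h1 h2))
        (HH_Str (HH2 he)) ?_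
      exact σ'.HH_tp ht' le_rfl (HH2 he)
    · rw [tp_one, mul_one]
      exact nu_idem (congrArg Prod.fst hee) h1
  have hδ := del_eq ht ht' hpp he hn hk
  have hθ : 1 - (q-1) * σ'.del ≠ 0 := by
    intro h00
    have := dj_del c σ' hσ'
    rw [h00, zero_mul] at this
    refine Finset.prod_ne_zero_iff.2 (fun i _ => ?_) this.symm
    rcases hc i with h | h <;> rw [h]
    · simp
    · rw [show -1 - (q-1) = -q by ring]; simpa using q0
  have t0' : σ'.thb ≠ 0 := mul_ne_zero (pow_ne_zero _ card_ne) (mul_ne_zero (inv_ne_zero q0) hθ)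
  have t0 : σ.thb ≠ 0 := mul_ne_zero (pow_ne_zero _ card_ne) (mul_ne_zero (inv_ne_zero q0) (hδ ▸ hθ))
  have T := transfer ht ht' (mul_one 1) hti' t0 t0' hpp he hn hk hr k
  rw [nb_iter, nb_iter, hσ', e2, pt_smul, Sys.thb, Sys.thb, hδ, hφs, Fintype.card_fin, ← hd] at T
  have hA : (d:L)^2 * (q⁻¹ * (1 - (q-1)*σ'.del)) * (d:L)⁻¹ = d * (q⁻¹ * (1 - (q-1)*σ'.del)) := by field_simp
  have hB : (N:L)^2 * (q⁻¹ * (1 - (q-1)*σ'.del)) * (N:L)⁻¹ * ((N:L)/d)⁻¹ = d * (q⁻¹ * (1 - (q-1)*σ'.del)) := by field_simp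
  refine mul_left_cancel₀ (pow_ne_zero (k+1) (mul_ne_zero d0 (mul_ne_zero (inv_ne_zero q0) hθ))) ?_
  rw [← mul_assoc, ← mul_pow, hA] at T
  rw [T, ← hB]
  simp only [mul_pow]; ring
end
end HS

set_option linter.all false
namespace HS
open Matrix Kronecker

noncomputable section

section AS
variable {L P : Type*} [Field L] [Ring P] [Algebra L P] {q : L} {T : ℕ → P}

def qn (q : L) (k : ℕ) : L := ∑ i ∈ Finset.range k, q ^ i

lemma qn_succ (q : L) (k : ℕ) : qn q (k+1) = qn q k + q ^ k := Finset.sum_range_succ _ _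
lemma qn_mul (q : L) (k : ℕ) : (q - 1) * qn q k = q ^ k - 1 := by rw [qn, mul_comm, geom_sum_mul]
lemma qn_ne (hq : ∀ n : ℕ, 1 ≤ n → q ^ n ≠ 1) (k : ℕ) : qn q (k+1) ≠ 0 := fun h => by
  have := qn_mul q (k+1)
  rw [h, mul_zero] at this
  exact hq (k+1) (by omega) (sub_eq_zero.1 this.symm)

def AS (q : L) (T : ℕ → P) : ℕ → P
  | 0 => 1
  | r+1 => (q^(r+1) / qn q (r+2)) • AS q T r + (- qn q (r+1) / qn q (r+2)) • (AS q T r * T r * AS q T r)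

def RI (L : Type*) [Field L] {P : Type*} [Ring P] [Algebra L P] (T : ℕ → P) (r : ℕ) : Submodule L P :=
  Submodule.span L {x | ∃ i, i < r ∧ ∃ y : P, x = (T i + 1) * y}

lemma RI_mono (r : ℕ) : RI L T r ≤ RI L T (r+1) :=
  Submodule.span_mono fun x ⟨i, hi, y, h⟩ => ⟨i, by omega, y, h⟩

lemma RI_mul {r : ℕ} {x : P} (hx : x ∈ RI L T r) (y : P) : x * y ∈ RI L T r := by
  induction hx using Submodule.span_induction with
  | mem x h => obtain ⟨i, hi, z, rfl⟩ := h; exact Submodule.subset_span ⟨i, hi, z * y, by rw [mul_assoc]⟩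
  | zero => rw [zero_mul]; exact zero_mem _
  | add a b _ _ ha hb => rw [add_mul]; exact add_mem ha hb
  | smul c a _ ha => rw [smul_mul_assoc]; exact Submodule.smul_mem _ _ ha

lemma AS_mem (r : ℕ) : AS q T r ∈ HH L T r := by
  induction r with
  | zero => exact one_mem _
  | succ r ih =>
    have ih' := HH_mono (Nat.le_succ r) ih
    exact add_mem (Subalgebra.smul_mem _ ih' _) (Subalgebra.smul_mem _ (mul_mem (mul_mem ih' (T_mem (Nat.lt_succ_self r))) ih') _)

lemma AS_RI (hq : ∀ n : ℕ, 1 ≤ n → q ^ n ≠ 1) (r : ℕ) : 1 - AS q T r ∈ RI L T r := by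
  induction r with
  | zero => simp [AS]
  | succ r ih =>
    have ih' := RI_mono _ ih
    have hT : (T r + 1) * AS q T r ∈ RI L T (r+1) := Submodule.subset_span ⟨r, by omega, _, rfl⟩
    have h2 := RI_mul ih' (T r * AS q T r)
    have n0 := qn_ne hq (r+1)
    set a := AS q T r with ha
    have key : 1 - AS q T (r+1) = (1 - a) + (- qn q (r+1) / qn q (r+2)) • ((1 - a) * (T r * a)) - (- qn q (r+1) / qn q (r+2)) • ((T r + 1) * a) := by
      have e : q^(r+1) / qn q (r+2) = 1 + (- qn q (r+1) / qn q (r+2)) := by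
        have := qn_succ q (r+1); field_simp; rw [this]; ring
      rw [AS, ← ha, e]
      simp only [add_smul, one_smul, sub_mul, add_mul, one_mul, smul_sub, smul_add, mul_assoc]
      abel
    rw [key]
    exact sub_mem (add_mem ih' (Submodule.smul_mem _ _ h2)) (Submodule.smul_mem _ _ hT)

lemma mul_RI {a : P} {r : ℕ} (h : ∀ i < r, a * T i = - a) {x : P} (hx : x ∈ RI L T r) : a * x = 0 := by
  induction hx using Submodule.span_induction with
  | mem x h' => obtain ⟨i, hi, z, rfl⟩ := h'; rw [← mul_assoc, mul_add, h i hi]; simp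
  | zero => rw [mul_zero]
  | add a b _ _ ha hb => rw [mul_add, ha, hb, add_zero]
  | smul c a _ ha => rw [mul_smul_comm, ha, smul_zero]

lemma AS_T (H : IsHecke q T) (hq : ∀ n : ℕ, 1 ≤ n → q ^ n ≠ 1) (r : ℕ) : ∀ i < r, AS q T r * T i = - AS q T r := by
  induction r using Nat.strong_induction_on with
  | _ r ih =>
  rcases r with _ | r
  · intro i hi; omega
  intro i hi
  rcases Nat.lt_succ_iff_lt_or_eq.1 hi with hi | rfl
  · have := ih r (by omega) i hi
    rw [AS, add_mul, smul_mul_assoc, smul_mul_assoc, mul_assoc _ (AS q T r) (T i), this]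
    simp only [mul_neg, smul_neg, neg_add]
  rcases i with _ | r
  · have n0 := qn_ne hq 1
    have e1 : qn q (0+2) = 1 + q := by simp [qn, Finset.sum_range_succ]
    have e2 : qn q (0+1) = 1 := by simp [qn]
    simp only [zero_add] at e1 e2
    rw [show (1+1) = 2 from rfl, e1] at n0
    simp only [AS, one_mul, mul_one, zero_add, add_mul, smul_mul_assoc, H.quad, e1, e2, pow_one]
    have e : q / (1+q) = 1 - 1 / (1+q) := by field_simp; ring
    simp only [smul_add, smul_smul, neg_add, ← neg_smul]
    have h1 : (q / (1+q)) • T 0 + (-1/(1+q) * (q-1)) • T 0 = (-(-1/(1+q))) • T 0 := by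
      rw [← add_smul]; congr 1; field_simp; ring
    rw [← add_assoc, h1, add_comm]
    congr 2; field_simp
  have hab : AS q T (r+1) * AS q T r = AS q T (r+1) := by
    have := mul_RI (ih (r+1) (by omega)) (RI_mono _ (AS_RI (T := T) hq r))
    rw [mul_sub, mul_one, sub_eq_zero] at this; exact this.symm
  have haf := ih (r+1) (by omega) r (by omega)
  have hbg : Commute (AS q T r) (T (r+1)) := H.commT (by omega) (AS_mem r)
  have hbr := H.braid r
  have hgg := H.quad (r+1)
  have hdef : AS q T (r+1) = (q^(r+1) / qn q (r+2)) • AS q T r + (- qn q (r+1) / qn q (r+2)) • (AS q T r * T r * AS q T r) := rfl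
  rw [AS.eq_2 q T (r+1)]
  set a := AS q T (r+1)
  set b := AS q T r
  set g := T (r+1)
  set f := T r
  have n1 := qn_ne hq (r+1)
  have n2 := qn_ne hq (r+2)
  have n0 := qn_ne hq r
  set α := q^(r+1) / qn q (r+2) with hα
  set β := - qn q (r+1) / qn q (r+2)
  have k1 : a * g * b = a * g := by rw [mul_assoc, ← hbg.eq, ← mul_assoc, hab]
  have k2 : a * g * a = α • (a * g) + β • (a * g * f * b) := by
    have h0 : a * g * a = a * g * (α • b + β • (b * f * b)) := congrArg (fun z => a * g * z) hdef
    rw [h0, mul_add, mul_smul_comm, mul_smul_comm, k1, ← mul_assoc, ← mul_assoc, k1]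
  have k3 : a * g * f * b * g = - (a * g * f * b) := by
    calc a * g * f * b * g = a * (g * f * g) * b := by rw [mul_assoc _ b g, hbg.eq]; simp only [mul_assoc]
      _ = (a * f) * g * f * b := by rw [← hbr]; simp only [mul_assoc]
      _ = _ := by rw [haf]; simp only [neg_mul]
  have k4 : a * g * a * g = (α * q) • (a * g + a) - a * g * a := by
    conv_lhs => rw [k2, add_mul, smul_mul_assoc, smul_mul_assoc, k3, mul_assoc a g g, hgg]
    conv_rhs => rw [k2]
    simp only [mul_add, mul_smul_comm, mul_one, smul_add, smul_smul, smul_neg, mul_sub, sub_smul, one_smul, smul_sub]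
    abel
  have e : q^(r+1+1) / qn q (r+1+2) = - (- qn q (r+1+1) / qn q (r+1+2) * (α * q)) := by
    rw [hα]; field_simp; ring
  rw [add_mul, smul_mul_assoc, smul_mul_assoc, k4, e]
  simp only [smul_add, smul_sub, smul_smul, neg_smul, smul_neg]
  abel

lemma AS_idem (H : IsHecke q T) (hq : ∀ n : ℕ, 1 ≤ n → q ^ n ≠ 1) (r : ℕ) : AS q T r * AS q T r = AS q T r := by
  have := mul_RI (AS_T H hq r) (AS_RI (T := T) hq r)
  rw [mul_sub, mul_one, sub_eq_zero] at this; exact this.symm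
end AS

section Newton
variable {L ι : Type*} [Field L] [CharZero L] [Fintype ι] [DecidableEq ι] [Nonempty ι] {q : L}

def UU (q : L) (R : Matrix (ι × ι) (ι × ι) L) (r j : ℕ) : L := (Fintype.card ι : L) ^ (r+1+j) * nu (AS q (Tn R) r * Gc (Tn R) r j)

def lam (q : L) (R : Matrix (ι × ι) (ι × ι) L) : ℕ → L
  | 0 => 1
  | r+1 => (Fintype.card ι : L) ^ (r+1) * nu (AS q (Tn R) r)

lemma chain1 (R : Matrix (ι × ι) (ι × ι) L) (i : ℕ) {A : Al L ι} (hA : A ∈ Str L ι (Set.Iio i)) (j : ℕ) :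
    (Fintype.card ι : L) ^ (j+1) * nu (A * Gc (Tn R) i j) = nu A * pt R 1 j := by
  have := chain R 1 i hA j 1
  rw [tp_one, mul_one, map_one (jj (i+j)), mul_one] at this
  rw [this, pt]; ring

lemma UU_zero (R : Matrix (ι × ι) (ι × ι) L) (j : ℕ) : UU q R 0 j = pt R 1 j := by
  have := chain1 R 0 (one_mem (Str L ι _)) j
  rw [nu_one, one_mul, one_mul] at this
  rw [UU, AS, one_mul, ← this]; congr 2; omega

lemma UU_lam (R : Matrix (ι × ι) (ι × ι) L) (r : ℕ) : UU q R r 0 = lam q R (r+1) := by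
  rw [UU, lam, Gc, mul_one, add_zero]

lemma UU_succ (hq : ∀ n : ℕ, 1 ≤ n → q ^ n ≠ 1) (σ : Sys L ι q) (r j : ℕ) :
    qn q (r+2) * UU q σ.R (r+1) j = q^(r+1) * lam q σ.R (r+1) * pt σ.R 1 j - qn q (r+1) * UU q σ.R r (j+1) := by
  have hA : AS q (Tn σ.R) r ∈ Str L ι (Set.Iio (r+1)) := HH_Str (AS_mem r)
  have c1 := chain1 σ.R (r+1) hA j
  have hc : Commute (AS q (Tn σ.R) r) (Gc (Tn σ.R) (r+1) j) :=
    Str_comm (S := Set.Iio (r+1)) (S' := Set.Ico (r+1) (r+1+j+1)) (by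
      rw [Set.disjoint_left]; intro x h1 h2; simp at h1 h2; omega) hA (Hs_Str (Gc_mem _ _ _))
  have c2 : nu (AS q (Tn σ.R) r * Tn σ.R r * AS q (Tn σ.R) r * Gc (Tn σ.R) (r+1) j) = nu (AS q (Tn σ.R) r * Gc (Tn σ.R) r (j+1)) := by
    rw [mul_assoc _ (AS q (Tn σ.R) r), hc.eq, ← mul_assoc, nu_comm, Gc_succ', ← mul_assoc, ← mul_assoc, AS_idem σ.hecke hq, mul_assoc]
  have n0 := qn_ne hq (r+1)
  rw [UU, UU, lam, AS, add_mul, map_add, smul_mul_assoc, smul_mul_assoc, map_smul, map_smul, c2, smul_eq_mul, smul_eq_mul]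
  rw [show r+1+1+j = (r+1)+(j+1) by omega, show r+1+(j+1) = (r+1)+(j+1) by omega, pow_add]
  field_simp
  linear_combination (q^(r+1)) * c1

lemma newton (hq : ∀ n : ℕ, 1 ≤ n → q ^ n ≠ 1) (σ : Sys L ι q) (r : ℕ) : ∀ j,
    qn q (r+1) * UU q σ.R r j = ∑ i ∈ Finset.range (r+1), (-1)^i * (q^(r-i) * lam q σ.R (r-i)) * pt σ.R 1 (j+i) := by
  induction r with
  | zero => intro j; simp [qn, UU_zero, lam]
  | succ r ih =>
    intro j
    rw [UU_succ hq, ih (j+1), Finset.sum_range_succ' _ (r+1)]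
    simp only [Nat.add_sub_add_right, Nat.sub_zero, pow_zero, one_mul, add_zero]
    rw [sub_eq_add_neg, add_comm, ← Finset.sum_neg_distrib]
    congr 1
    refine Finset.sum_congr rfl fun i _ => ?_
    rw [pow_succ, show j + 1 + i = j + (i+1) by omega]; ring

lemma newton_ps (hq : ∀ n : ℕ, 1 ≤ n → q ^ n ≠ 1) (σ : Sys L ι q) :
    PowerSeries.mk (lam q σ.R) = PowerSeries.rescale q (PowerSeries.mk (lam q σ.R)) * PowerSeries.rescale (-1) (WW q (pt σ.R 1)) := by
  have e : PowerSeries.rescale (-1) (WW q (pt σ.R 1)) = 1 - PowerSeries.C (q-1) * (PowerSeries.X * PowerSeries.mk fun i => (-1)^i * pt σ.R 1 i) := by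
    ext k
    rw [PowerSeries.coeff_rescale, WW, map_add, map_sub (PowerSeries.coeff k), PowerSeries.coeff_C_mul, PowerSeries.coeff_C_mul]
    rcases k with _ | k
    · simp
    · rw [PowerSeries.coeff_succ_X_mul, PowerSeries.coeff_succ_X_mul]
      simp [PowerSeries.coeff_one, pow_succ]; ring
  rw [e, mul_sub, mul_one]
  ext k
  rw [map_sub (PowerSeries.coeff k), mul_left_comm, PowerSeries.coeff_C_mul, mul_left_comm]
  rcases k with _ | k
  · simp
  rw [PowerSeries.coeff_succ_X_mul, mul_comm (PowerSeries.rescale q _), PowerSeries.coeff_mul, Finset.Nat.sum_antidiagonal_eq_sum_range_succ_mk]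
  have := newton hq σ k 0
  rw [UU_lam] at this
  simp only [PowerSeries.coeff_rescale, PowerSeries.coeff_mk, Nat.succ_eq_add_one]
  have h2 : ∑ i ∈ Finset.range (k+1), (-1)^i * pt σ.R 1 i * (q^(k-i) * lam q σ.R (k-i)) = qn q (k+1) * lam q σ.R (k+1) := by
    rw [this]; refine Finset.sum_congr rfl fun i _ => ?_
    rw [zero_add]; ring
  rw [h2]
  linear_combination lam q σ.R (k+1) * (qn_mul q (k+1))
end Newton
end
end HS

set_option linter.all false
namespace HS
open Matrix Kronecker

noncomputable section

section Sym
variable {L : Type*} [Field L]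

def Xs {m : ℕ} (a : Fin m → L) : PowerSeries L := ∏ i, (1 + PowerSeries.C (a i) * PowerSeries.X)
def Ys {m : ℕ} (a : Fin m → L) : PowerSeries L := ∏ i, (1 - PowerSeries.C (a i) * PowerSeries.X)

lemma rescale_CX (s a : L) : PowerSeries.rescale s (PowerSeries.C a * PowerSeries.X) = PowerSeries.C (s * a) * PowerSeries.X := by
  ext k
  rw [PowerSeries.coeff_rescale, PowerSeries.coeff_C_mul, PowerSeries.coeff_C_mul, PowerSeries.coeff_X]
  split_ifs with h
  · subst h; ring
  · ring

lemma rescale_Xs {m : ℕ} (s : L) (a : Fin m → L) : PowerSeries.rescale s (Xs a) = Xs fun i => s * a i := by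
  simp only [Xs, map_prod, map_add, map_one, rescale_CX]
lemma rescale_Ys {m : ℕ} (s : L) (a : Fin m → L) : PowerSeries.rescale s (Ys a) = Ys fun i => s * a i := by
  simp only [Ys, map_prod, map_sub, map_one, rescale_CX]
lemma Xs_c {m : ℕ} (a : Fin m → L) : PowerSeries.constantCoeff (Xs a) = 1 := by
  simp [Xs, map_prod]
lemma Ys_c {m : ℕ} (a : Fin m → L) : PowerSeries.constantCoeff (Ys a) = 1 := by
  simp [Ys, map_prod]
lemma ne_zero_of_c {f : PowerSeries L} (h : PowerSeries.constantCoeff f = 1) : f ≠ 0 := by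
  rintro rfl; simp at h

lemma W_dj' [CharZero L] {q : L} {m n : ℕ} [NeZero (m+n)] (x : Fin m → L) (y : Fin n → L) :
    PowerSeries.rescale (-1) (WW q (pt (dj q (Fin.append (fun _ : Fin m => q) (fun _ : Fin n => -1))) (diagonal (Fin.append x y)))) *
      (Xs (fun i => q * x i) * Ys y) = Xs x * Ys (fun i => q * y i) := by
  have := congrArg (PowerSeries.rescale (-1)) (W_dj (q := q) (Fin.append (fun _ : Fin m => q) (fun _ : Fin n => -1)) (Fin.append x y))
  rw [map_mul, Fin.prod_univ_add, Fin.prod_univ_add] at this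
  simp only [Fin.append_left, Fin.append_right, map_mul (PowerSeries.rescale (-1 : L)), map_prod, map_add (PowerSeries.rescale (-1 : L)), map_sub (PowerSeries.rescale (-1 : L)), map_one (PowerSeries.rescale (-1 : L))] at this
  simp only [← map_mul (PowerSeries.rescale (-1 : L)), rescale_CX] at this
  convert this using 1
  · congr 2
    · refine Finset.prod_congr rfl fun i _ => ?_
      simp
    · refine Finset.prod_congr rfl fun i _ => ?_
      simp
  · congr 1
    · refine Finset.prod_congr rfl fun i _ => ?_
      simp; ring
    · refine Finset.prod_congr rfl fun i _ => ?_
      simp; ring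

lemma rescale_fix {q : L} (hq : ∀ n : ℕ, 1 ≤ n → q ^ n ≠ 1) {Z Z' : PowerSeries L}
    (h1 : PowerSeries.constantCoeff Z = 1) (h2 : PowerSeries.constantCoeff Z' = 1)
    (h : Z * PowerSeries.rescale q Z' = Z' * PowerSeries.rescale q Z) : Z = Z' := by
  have hc : PowerSeries.constantCoeff Z' ≠ 0 := by rw [h2]; exact one_ne_zero
  have hz := PowerSeries.mul_inv_cancel Z' hc
  have hzq : PowerSeries.rescale q Z' * PowerSeries.rescale q Z'⁻¹ = 1 := by rw [← map_mul, hz, map_one]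
  have hG : Z * Z'⁻¹ = PowerSeries.rescale q (Z * Z'⁻¹) := by
    rw [map_mul]
    calc Z * Z'⁻¹ = (Z * PowerSeries.rescale q Z') * Z'⁻¹ * PowerSeries.rescale q Z'⁻¹ := by
          linear_combination - (Z * Z'⁻¹) * hzq
      _ = _ := by rw [h]; linear_combination (PowerSeries.rescale q Z * PowerSeries.rescale q Z'⁻¹) * hz
  have hG1 : Z * Z'⁻¹ = 1 := by
    ext k
    rcases k with _ | k
    · simp [h1, h2]
    · have := congrArg (PowerSeries.coeff (k+1)) hG
      rw [PowerSeries.coeff_rescale] at this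
      rw [PowerSeries.coeff_one, if_neg (by omega)]
      have h3 : (1 - q^(k+1)) * PowerSeries.coeff (k+1) (Z * Z'⁻¹) = 0 := by linear_combination this
      rcases mul_eq_zero.1 h3 with h4 | h4
      · exact absurd (sub_eq_zero.1 h4).symm (hq (k+1) (by omega))
      · exact h4
  linear_combination Z' * hG1 - Z * hz

end Sym

section Sym2
variable {L ι : Type*} [Field L] [CharZero L] [Fintype ι] [DecidableEq ι] [Nonempty ι] {q : L}

theorem sym_poly (hq : ∀ n : ℕ, 1 ≤ n → q ^ n ≠ 1) (σ : Sys L ι q) {m n : ℕ} [NeZero (m+n)] (φ : ℝ →+* L)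
    (x : Fin m → ℝ) (y : Fin n → ℝ) (hx : ∀ i, 0 < x i) (hy : ∀ i, 0 < y i)
    (hE : PowerSeries.mk (lam q σ.R) * Ys (fun i => φ (y i)) = Xs (fun i => φ (x i))) :
    Xs (fun i => φ (x i)) * Ys (fun i => φ (y i)⁻¹) = Xs (fun i => φ (x i)⁻¹) * Ys (fun i => φ (y i)) := by
  have hN := newton_ps hq σ
  set E := PowerSeries.mk (lam q σ.R)
  set W := PowerSeries.rescale (-1) (WW q (pt σ.R 1)) with hW
  have hEq := congrArg (PowerSeries.rescale q) hE
  rw [map_mul, rescale_Xs, rescale_Ys] at hEq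
  have q1 : q ≠ 1 := by simpa using hq 1 le_rfl
  have h1 : W * (Xs (fun i => q * φ (x i)) * Ys (fun i => φ (y i))) = Xs (fun i => φ (x i)) * Ys (fun i => q * φ (y i)) := by
    rw [← hE, ← hEq]; linear_combination - (Ys (fun i => φ (y i)) * Ys (fun i => q * φ (y i))) * hN
  have h2 := W_dj' (q := q) (fun i => φ (x i)) (fun i => φ (y i))
  have hne : Xs (fun i => q * φ (x i)) * Ys (fun i => φ (y i)) ≠ 0 := mul_ne_zero (ne_zero_of_c (Xs_c _)) (ne_zero_of_c (Ys_c _))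
  have h3 := mul_right_cancel₀ hne (h1.trans h2.symm)
  have h4 : WW q (pt σ.R 1) = WW q (pt (dj q (Fin.append (fun _ : Fin m => q) (fun _ : Fin n => -1))) (diagonal (Fin.append (fun i => φ (x i)) (fun i => φ (y i))))) := by
    have := congrArg (PowerSeries.rescale (-1)) h3
    rw [hW, PowerSeries.rescale_rescale, PowerSeries.rescale_rescale] at this
    simpa using this
  have h5 := WW_inj q1 h4
  have ap : ∀ (f : ℝ → ℝ), (fun i => φ (f (Fin.append x y i))) = Fin.append (fun i => φ (f (x i))) (fun i => φ (f (y i))) := by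
    intro f; funext i
    refine Fin.addCases (fun i => ?_) (fun i => ?_) i <;> simp
  have h6 := main_sym hq σ φ (Fin.append (fun _ : Fin m => q) (fun _ : Fin n => -1)) (by
      intro i; refine Fin.addCases (fun i => ?_) (fun i => ?_) i <;> simp) (Fin.append x y) (by
      intro i; refine Fin.addCases (fun i => ?_) (fun i => ?_) i <;> simp [hx, hy]) (by
      intro k; rw [h5]; rw [ap (fun a => a)])
  rw [ap (fun a => a⁻¹)] at h6
  have h7 := W_dj' (q := q) (fun i => φ (x i)⁻¹) (fun i => φ (y i)⁻¹)
  rw [← funext h6, ← hW] at h7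
  refine rescale_fix hq (by rw [map_mul, Xs_c, Ys_c, one_mul]) (by rw [map_mul, Xs_c, Ys_c, one_mul]) ?_
  rw [map_mul, map_mul, rescale_Xs, rescale_Xs, rescale_Ys, rescale_Ys]
  have hWne : W ≠ 0 := by
    rintro h0; rw [h0, zero_mul] at h1
    exact mul_ne_zero (ne_zero_of_c (Xs_c _)) (ne_zero_of_c (Ys_c _)) h1.symm
  apply mul_left_cancel₀ hWne
  linear_combination (Xs (fun i => φ (x i)) * Ys (fun i => q * φ (y i))) * h7 - (Xs (fun i => φ (x i)⁻¹) * Ys (fun i => q * φ (y i)⁻¹)) * h1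
end Sym2
end
end HS

set_option linter.all false
namespace HS
noncomputable section
open Polynomial

lemma cop_fac {x y : ℝ} (hx : 0 < x) (hy : 0 < y) : IsCoprime (1 + C x * X : ℝ[X]) (1 - C y * X) := by
  have : x + y ≠ 0 := by positivity
  refine ⟨C (y / (x+y)), C (x/(x+y)), ?_⟩
  have e : y / (x+y) + x / (x+y) = 1 := by field_simp; ring
  have e2 : y / (x+y) * x = x / (x+y) * y := by field_simp
  calc _ = C (y / (x+y) + x / (x+y)) + (C (y/(x+y) * x) - C (x/(x+y)*y)) * X := by
        simp only [map_add, map_mul]; ring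
    _ = 1 := by rw [e, e2]; simp

def Ax {m : ℕ} (x : Fin m → ℝ) : ℝ[X] := ∏ i, (1 + C (x i) * X)
def Bx {m : ℕ} (x : Fin m → ℝ) : ℝ[X] := ∏ i, (1 - C (x i) * X)

lemma cop_AB {m n : ℕ} {x : Fin m → ℝ} {y : Fin n → ℝ} (hx : ∀ i, 0 < x i) (hy : ∀ i, 0 < y i) :
    IsCoprime (Ax x) (Bx y) :=
  IsCoprime.prod_left fun i _ => IsCoprime.prod_right fun j _ => cop_fac (hx i) (hy j)

lemma eq_of_dvd' {f g : ℝ[X]} (hf : f.eval 0 = 1) (hg : g.eval 0 = 1) (h1 : f ∣ g) (h2 : g ∣ f) : f = g := by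
  obtain ⟨u, hu⟩ := associated_of_dvd_dvd h1 h2
  obtain ⟨c, hc, hcu⟩ := Polynomial.isUnit_iff.1 u.isUnit
  rw [← hcu] at hu
  have := congrArg (eval 0) hu
  rw [eval_mul, eval_C, hf, hg, one_mul] at this
  rw [this] at hu; simpa using hu

lemma Ax0 {m : ℕ} (x : Fin m → ℝ) : (Ax x).eval 0 = 1 := by simp [Ax, eval_prod]
lemma Bx0 {m : ℕ} (x : Fin m → ℝ) : (Bx x).eval 0 = 1 := by simp [Bx, eval_prod]

lemma split {m n : ℕ} {x : Fin m → ℝ} {y : Fin n → ℝ} (hx : ∀ i, 0 < x i) (hy : ∀ i, 0 < y i)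
    (h : Ax x * Bx (fun i => (y i)⁻¹) = Ax (fun i => (x i)⁻¹) * Bx y) :
    Ax x = Ax (fun i => (x i)⁻¹) ∧ Bx y = Bx (fun i => (y i)⁻¹) := by
  have hx' : ∀ i, 0 < (x i)⁻¹ := fun i => inv_pos.2 (hx i)
  have hy' : ∀ i, 0 < (y i)⁻¹ := fun i => inv_pos.2 (hy i)
  have e : Ax x = Ax (fun i => (x i)⁻¹) := by
    refine eq_of_dvd' (Ax0 _) (Ax0 _) ?_ ?_
    · exact (cop_AB hx hy).dvd_of_dvd_mul_right (h ▸ Dvd.intro _ rfl)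
    · exact (cop_AB hx' hy').dvd_of_dvd_mul_right (h.symm ▸ Dvd.intro _ rfl)
  refine ⟨e, ?_⟩
  rw [e] at h
  have hn : Ax (fun i => (x i)⁻¹) ≠ 0 := by
    intro h0; have := Ax0 (fun i => (x i)⁻¹); rw [h0] at this; simp at this
  exact (mul_left_cancel₀ hn h).symm

lemma am2 {u v : ℝ} (hu : 0 < u) (hv : 0 < v) (h : u * v = 1) : 2 ≤ u + v := by
  nlinarith [sq_nonneg (u - v)]

lemma one_of_inv {u : ℝ} (hu : 0 < u) (h : u = u⁻¹) : u = 1 := by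
  have : u * u = 1 := by nth_rewrite 2 [h]; exact mul_inv_cancel₀ hu.ne'
  nlinarith

lemma classA {m : ℕ} (hm : m ≤ 3) {x : Fin m → ℝ} (hx : ∀ i, 0 < x i) (h : Ax x = Ax (fun i => (x i)⁻¹)) :
    ∃ ε₁ ε₂ : ℕ, ε₁ ≤ 1 ∧ ε₂ ≤ 1 ∧ ∃ a : ℝ, 2 ≤ a ∧ Ax x = (1 + X) ^ ε₁ * (1 + C a * X + X ^ 2) ^ ε₂ := by
  have e1 := congrArg (eval 1) h
  have e2 := congrArg (eval (-1)) h
  have e3 := congrArg (eval 2) h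
  simp only [Ax, eval_prod, eval_add, eval_one, eval_mul, eval_C, eval_X] at e1 e2 e3
  interval_cases m
  · exact ⟨0, 0, by omega, by omega, 2, le_rfl, by simp [Ax]⟩
  · simp only [Fin.prod_univ_succ, Fin.prod_univ_zero] at e1 e2 e3
    have : x 0 = 1 := one_of_inv (hx 0) (by linarith)
    exact ⟨1, 0, by omega, by omega, 2, le_rfl, by simp [Ax, this]⟩
  · rw [Fin.prod_univ_two, Fin.prod_univ_two] at e1 e2 e3
    have h2 : x 0 * x 1 = (x 0 * x 1)⁻¹ := by rw [mul_inv]; linarith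
    have h3 := one_of_inv (mul_pos (hx 0) (hx 1)) h2
    refine ⟨0, 1, by omega, by omega, x 0 + x 1, am2 (hx 0) (hx 1) h3, ?_⟩
    rw [Ax, Fin.prod_univ_two]
    have : (C (x 0) * C (x 1) : ℝ[X]) = 1 := by rw [← map_mul, h3, map_one]
    simp only [map_add]
    linear_combination (X^2) * this
  · rw [Fin.prod_univ_three, Fin.prod_univ_three] at e1 e2 e3
    have h2 : x 0 * x 1 * x 2 = (x 0 * x 1 * x 2)⁻¹ := by rw [mul_inv, mul_inv]; linarith
    have h3 := one_of_inv (mul_pos (mul_pos (hx 0) (hx 1)) (hx 2)) h2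
    have hu : (x 0)⁻¹ = x 1 * x 2 := by rw [inv_eq_iff_eq_inv]; exact eq_inv_of_mul_eq_one_left (by linarith)
    have hv : (x 1)⁻¹ = x 0 * x 2 := by rw [inv_eq_iff_eq_inv]; exact eq_inv_of_mul_eq_one_left (by linarith)
    have hw : (x 2)⁻¹ = x 0 * x 1 := by rw [inv_eq_iff_eq_inv]; exact eq_inv_of_mul_eq_one_left (by linarith)
    have h4 : x 0 + x 1 + x 2 = x 0 * x 1 + x 0 * x 2 + x 1 * x 2 := by
      have i3 : (x 0)⁻¹ * (x 1)⁻¹ * (x 2)⁻¹ = x 0 * x 1 * x 2 := by rw [h2, mul_inv, mul_inv]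
      have : x 0 + x 1 + x 2 = (x 0)⁻¹ + (x 1)⁻¹ + (x 2)⁻¹ := by linarith
      rw [hu, hv, hw] at this; linarith
    have h5 : (x 0 - 1) * ((x 1 - 1) * (x 2 - 1)) = 0 := by linear_combination h3 + h4
    have h6 : 2 ≤ x 0 + x 1 + x 2 - 1 := by
      rcases mul_eq_zero.1 h5 with h | h
      · have : x 0 = 1 := by linarith
        rw [this] at h3 ⊢; linarith [am2 (hx 1) (hx 2) (by linarith)]
      rcases mul_eq_zero.1 h with h | h
      · have : x 1 = 1 := by linarith
        rw [this] at h3 ⊢; linarith [am2 (hx 0) (hx 2) (by linarith)]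
      · have : x 2 = 1 := by linarith
        rw [this] at h3 ⊢; linarith [am2 (hx 0) (hx 1) (by linarith)]
    refine ⟨1, 1, by omega, by omega, _, h6, ?_⟩
    rw [Ax, Fin.prod_univ_three]
    have c3 : (C (x 0) * C (x 1) * C (x 2) : ℝ[X]) = 1 := by rw [← map_mul, ← map_mul, h3, map_one]
    have c4 : (C (x 0) + C (x 1) + C (x 2) : ℝ[X]) = C (x 0) * C (x 1) + C (x 0) * C (x 2) + C (x 1) * C (x 2) := by
      simp only [← map_mul, ← map_add, h4]
    simp only [map_add, map_sub, map_one]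
    linear_combination (X^3) * c3 - X^2 * c4

lemma Bx_comp {n : ℕ} (y : Fin n → ℝ) : (Bx y).comp (-X) = Ax y := by
  simp [Bx, Ax, Polynomial.prod_comp]
lemma Ax_comp {n : ℕ} (y : Fin n → ℝ) : (Ax y).comp (-X) = Bx y := by
  simp [Bx, Ax, Polynomial.prod_comp, sub_eq_add_neg]

lemma classB {m : ℕ} (hm : m ≤ 3) {x : Fin m → ℝ} (hx : ∀ i, 0 < x i) (h : Bx x = Bx (fun i => (x i)⁻¹)) :
    ∃ ε₁ ε₂ : ℕ, ε₁ ≤ 1 ∧ ε₂ ≤ 1 ∧ ∃ a : ℝ, 2 ≤ a ∧ Bx x = (1 - X) ^ ε₁ * (1 - C a * X + X ^ 2) ^ ε₂ := by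
  have h' := congrArg (fun p => Polynomial.comp p (-X)) h
  simp only [Bx_comp] at h'
  obtain ⟨e1, e2, h1, h2, a, ha, hh⟩ := classA hm hx h'
  refine ⟨e1, e2, h1, h2, a, ha, ?_⟩
  rw [← Ax_comp, hh]
  simp [sub_eq_add_neg]

lemma int_of_pow {b : ℝ} {Q : ℤ} (hQ : Q ≠ 0) (h : ∀ k : ℕ, ∃ z : ℤ, (Q : ℝ) * b ^ k = z) : ∃ z : ℤ, b = z := by
  obtain ⟨p, hp⟩ := h 1
  have hQ' : (Q : ℝ) ≠ 0 := by exact_mod_cast hQ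
  set r : ℚ := p / Q with hr
  have hb : b = r := by rw [hr]; push_cast; field_simp; linarith
  have hden : r.den = 1 := by
    by_contra hne
    have h2 : 2 ≤ r.den := by have := r.den_pos; omega
    have hdvd : ∀ k : ℕ, ((r.den : ℤ)^k) ∣ Q := by
      intro k
      obtain ⟨z, hz⟩ := h k
      rw [hb] at hz
      have hz' : (Q : ℚ) * r ^ k = z := by exact_mod_cast hz
      have hd0 : (r.den : ℚ) ≠ 0 := by exact_mod_cast r.den_pos.ne'
      have h3 : (Q : ℚ) * r.num ^ k = z * r.den ^ k := by
        rw [← hz', mul_assoc, ← mul_pow, Rat.mul_den_eq_num]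
      have h4 : Q * r.num ^ k = z * (r.den : ℤ) ^ k := by exact_mod_cast h3
      have hc : IsCoprime ((r.den : ℤ)^k) (r.num ^ k) := by
        apply IsCoprime.pow
        rw [Int.isCoprime_iff_gcd_eq_one, Int.gcd, Int.natAbs_natCast, Nat.gcd_comm]; exact r.reduced
      exact hc.dvd_of_dvd_mul_right (h4 ▸ Dvd.intro_left _ rfl)
    have h5 := Int.natAbs_dvd_natAbs.2 (hdvd Q.natAbs)
    have h6 := Nat.le_of_dvd (Int.natAbs_pos.2 hQ) h5
    rw [Int.natAbs_pow, Int.natAbs_natCast] at h6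
    have h7 : Q.natAbs < 2 ^ Q.natAbs := Nat.lt_two_pow_self
    have h8 := Nat.pow_le_pow_left h2 Q.natAbs
    omega
  refine ⟨r.num, ?_⟩
  rw [hb]
  have := Rat.coe_int_num_of_den_eq_one hden
  exact_mod_cast this.symm

def IntS : Subring (PowerSeries ℝ) := (PowerSeries.map (Int.castRingHom ℝ)).range

lemma IntS_coeff {f : PowerSeries ℝ} (hf : f ∈ IntS) (k : ℕ) : ∃ z : ℤ, PowerSeries.coeff k f = z := by
  obtain ⟨g, rfl⟩ := hf; exact ⟨PowerSeries.coeff k g, by simp⟩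
lemma IntS_mk {f : PowerSeries ℝ} (h : ∀ k, ∃ z : ℤ, PowerSeries.coeff k f = z) : f ∈ IntS := by
  choose g hg using h
  exact ⟨PowerSeries.mk g, by ext k; simp [hg]⟩

lemma coeff1 (Q : PowerSeries ℝ) (b : ℝ) : PowerSeries.coeff 1 (Q * ((1 - C b * X + X^2 : ℝ[X]) : PowerSeries ℝ)) = PowerSeries.coeff 1 Q - b * PowerSeries.coeff 0 Q := by
  push_cast
  rw [mul_add, mul_sub, mul_one, mul_left_comm, map_add, map_sub, PowerSeries.coeff_C_mul, PowerSeries.coeff_succ_mul_X, pow_two, ← mul_assoc, PowerSeries.coeff_succ_mul_X]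
  simp
lemma coeff2 (Q : PowerSeries ℝ) (b : ℝ) (k : ℕ) : PowerSeries.coeff (k+2) (Q * ((1 - C b * X + X^2 : ℝ[X]) : PowerSeries ℝ)) = PowerSeries.coeff (k+2) Q - b * PowerSeries.coeff (k+1) Q + PowerSeries.coeff k Q := by
  push_cast
  rw [mul_add, mul_sub, mul_one, mul_left_comm, map_add, map_sub, PowerSeries.coeff_C_mul, PowerSeries.coeff_succ_mul_X, pow_two, ← mul_assoc, PowerSeries.coeff_succ_mul_X, PowerSeries.coeff_succ_mul_X]

lemma rhs_coeff (a : ℝ) (k : ℕ) : PowerSeries.coeff k ((1 + C a * X + X^2 : ℝ[X]) : PowerSeries ℝ) = if k = 0 then 1 else if k = 1 then a else if k = 2 then 1 else 0 := by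
  rw [Polynomial.coeff_coe]
  simp only [coeff_add, coeff_one, coeff_C_mul, coeff_X, coeff_X_pow]
  rcases k with _ | _ | _ | k <;> simp

lemma both {Q : PowerSeries ℝ} (hQ : Q ∈ IntS) {a b : ℝ} (ha : 2 ≤ a) (hb : 2 ≤ b) (h0 : PowerSeries.coeff 0 Q = 1)
    (h : Q * ((1 - C b * X + X^2 : ℝ[X]) : PowerSeries ℝ) = ((1 + C a * X + X^2 : ℝ[X]) : PowerSeries ℝ)) :
    (∃ z : ℤ, a = z) ∧ (∃ z : ℤ, b = z) := by
  have h1 : PowerSeries.coeff 1 Q = a + b := by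
    have := congrArg (PowerSeries.coeff 1) h
    rw [coeff1, rhs_coeff, h0] at this; simp at this; linarith
  have h2 : PowerSeries.coeff 1 Q * b = PowerSeries.coeff 2 Q := by
    have := congrArg (PowerSeries.coeff (0+2)) h
    rw [coeff2, rhs_coeff, h0] at this; simp at this; linarith
  have h3 : ∀ j, PowerSeries.coeff (j+2) Q * b = PowerSeries.coeff (j+3) Q + PowerSeries.coeff (j+1) Q := by
    intro j
    have := congrArg (PowerSeries.coeff (j+1+2)) h
    rw [coeff2, rhs_coeff] at this; simp at this
    rw [show j+1+2 = j+3 by omega, show j+1+1=j+2 by omega] at this; linarith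
  have h4 : ∀ k j : ℕ, ∃ z : ℤ, PowerSeries.coeff (j+1) Q * b ^ k = z := by
    intro k
    induction k with
    | zero => intro j; simpa using IntS_coeff hQ (j+1)
    | succ k ih =>
      intro j
      rw [pow_succ', ← mul_assoc]
      rcases j with _ | j
      · rw [zero_add, h2]; exact ih 1
      · rw [h3]
        obtain ⟨z, hz⟩ := ih (j+2)
        obtain ⟨w, hw⟩ := ih j
        exact ⟨z + w, by rw [add_mul, hw, hz]; push_cast; ring⟩
  obtain ⟨z, hz⟩ := IntS_coeff hQ 1
  have hz0 : z ≠ 0 := by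
    rintro rfl; rw [h1] at hz; simp at hz; linarith
  obtain ⟨w, hw⟩ := int_of_pow hz0 (b := b) (fun k => by rw [← hz]; exact h4 k 0)
  refine ⟨⟨z - w, ?_⟩, w, hw⟩
  push_cast; rw [← hz, h1, ← hw]; ring

theorem final_real {P : PowerSeries ℝ} (hP : P ∈ IntS) {m n : ℕ} (hm : m ≤ 3) (hn : n ≤ 3) {x : Fin m → ℝ} {y : Fin n → ℝ}
    (hx : ∀ i, 0 < x i) (hy : ∀ i, 0 < y i)
    (heq : P * (Bx y : PowerSeries ℝ) = (Ax x : PowerSeries ℝ))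
    (h : Ax x * Bx (fun i => (y i)⁻¹) = Ax (fun i => (x i)⁻¹) * Bx y) :
    ∃ (ε₁ ε₂ δ₁ δ₂ : ℕ), ε₁ ≤ 1 ∧ ε₂ ≤ 1 ∧ δ₁ ≤ 1 ∧ δ₂ ≤ 1 ∧
      ∃ (a b : ℤ), 2 ≤ a ∧ 2 ≤ b ∧
        P * (((1 - Polynomial.X) ^ δ₁ *
              (1 - Polynomial.C (b : ℝ) * Polynomial.X + Polynomial.X ^ 2) ^ δ₂ :
                Polynomial ℝ) : PowerSeries ℝ) =
          (((1 + Polynomial.X) ^ ε₁ *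
            (1 + Polynomial.C (a : ℝ) * Polynomial.X + Polynomial.X ^ 2) ^ ε₂ :
              Polynomial ℝ) : PowerSeries ℝ) := by
  obtain ⟨hA, hB⟩ := split hx hy h
  obtain ⟨e1, e2, he1, he2, a, ha, hAe⟩ := classA hm hx hA
  obtain ⟨d1, d2, hd1, hd2, b, hb, hBe⟩ := classB hn hy hB
  refine ⟨e1, e2, d1, d2, he1, he2, hd1, hd2, ?_⟩
  rw [hAe, hBe] at heq
  set I : PowerSeries ℝ := PowerSeries.mk fun k => (-1)^k with hI
  have hI1 : I * ((1 + X : ℝ[X]) : PowerSeries ℝ) = 1 := by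
    push_cast
    ext k
    rw [mul_add, mul_one, map_add]
    rcases k with _ | k
    · simp [hI]
    · rw [PowerSeries.coeff_succ_mul_X, hI]; simp [PowerSeries.coeff_one, pow_succ]
  have hII : I ∈ IntS := IntS_mk fun k => ⟨(-1)^k, by simp [hI]⟩
  set Q := P * ((1 - X : ℝ[X]) : PowerSeries ℝ) ^ d1 * I ^ e1 with hQdef
  have hX : ((1 - X : ℝ[X]) : PowerSeries ℝ) ∈ IntS := ⟨1 - PowerSeries.X, by push_cast; simp⟩
  have hQ : Q ∈ IntS := mul_mem (mul_mem hP (pow_mem hX _)) (pow_mem hII _)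
  have hQe : Q * ((1 - C b * X + X^2 : ℝ[X]) : PowerSeries ℝ) ^ d2 = ((1 + C a * X + X^2 : ℝ[X]) : PowerSeries ℝ) ^ e2 := by
    rw [Polynomial.coe_mul, Polynomial.coe_mul, Polynomial.coe_pow, Polynomial.coe_pow, Polynomial.coe_pow, Polynomial.coe_pow] at heq
    have hI2 : I ^ e1 * ((1 + X : ℝ[X]) : PowerSeries ℝ) ^ e1 = 1 := by rw [← mul_pow, hI1, one_pow]
    rw [hQdef]
    linear_combination (I^e1) * heq + (((1 + C a * X + X^2 : ℝ[X]) : PowerSeries ℝ) ^ e2) * hI2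
  have key : ∃ a' b' : ℤ, 2 ≤ a' ∧ 2 ≤ b' ∧ (1 + C (a' : ℝ) * X + X^2 : ℝ[X]) ^ e2 = (1 + C a * X + X^2 : ℝ[X]) ^ e2 ∧
      (1 - C (b' : ℝ) * X + X^2 : ℝ[X]) ^ d2 = (1 - C b * X + X^2 : ℝ[X]) ^ d2 := by
    interval_cases e2 <;> interval_cases d2
    · exact ⟨2, 2, le_rfl, le_rfl, by simp, by simp⟩
    · rw [pow_one, pow_zero] at hQe
      have q0 : PowerSeries.coeff 0 Q = 1 := by
        have := congrArg (PowerSeries.coeff 0) hQe; simpa using this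
      have q1 := congrArg (PowerSeries.coeff 1) hQe
      rw [coeff1, q0, PowerSeries.coeff_one] at q1
      obtain ⟨z, hz⟩ := IntS_coeff hQ 1
      have : b = z := by simp at q1; linarith
      subst this
      exact ⟨2, z, le_rfl, by exact_mod_cast hb, by simp, rfl⟩
    · rw [pow_one, pow_zero, mul_one] at hQe
      obtain ⟨z, hz⟩ := IntS_coeff hQ 1
      rw [hQe, rhs_coeff] at hz
      simp at hz
      subst hz
      exact ⟨z, 2, by exact_mod_cast ha, le_rfl, rfl, by simp⟩
    · rw [pow_one, pow_one] at hQe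
      have q0 : PowerSeries.coeff 0 Q = 1 := by
        have := congrArg (PowerSeries.coeff 0) hQe; simpa using this
      obtain ⟨⟨z, rfl⟩, w, rfl⟩ := both hQ ha hb q0 hQe
      exact ⟨z, w, by exact_mod_cast ha, by exact_mod_cast hb, rfl, rfl⟩
  obtain ⟨a', b', ha', hb', k1, k2⟩ := key
  exact ⟨a', b', ha', hb', by rw [k1, k2]; exact heq⟩

end
end HS

set_option linter.all false
namespace HS
open Matrix Kronecker

noncomputable section

section Tm
variable {L ι : Type*} [Field L] [Fintype ι] [DecidableEq ι]

def up {k : ℕ} (u : Fin k → ι) (i : ℕ) (hi : i + 1 < k) (r : ι × ι) : Fin k → ι :=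
  Function.update (Function.update u ⟨i, by omega⟩ r.1) ⟨i+1, hi⟩ r.2

def Tm (R : Matrix (ι × ι) (ι × ι) L) (k i : ℕ) : Matrix (Fin k → ι) (Fin k → ι) L :=
  if hi : i + 1 < k then of fun u v => ∑ r : ι × ι, R (u ⟨i, by omega⟩, u ⟨i+1, hi⟩) r * if up u i hi r = v then 1 else 0
  else 0

lemma up_eq_iff {k : ℕ} (u v : Fin k → ι) (i : ℕ) (hi : i + 1 < k) (p r : ι × ι) :
    ((u ⟨i, by omega⟩, u ⟨i+1, hi⟩) = p ∧ up u i hi r = v) ↔ ((v ⟨i, by omega⟩, v ⟨i+1, hi⟩) = r ∧ up v i hi p = u) := by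
  have ne : (⟨i, by omega⟩ : Fin k) ≠ ⟨i+1, hi⟩ := by simp
  constructor
  · rintro ⟨rfl, rfl⟩
    refine ⟨by simp [up, ne], ?_⟩
    simp only [up]
    rw [Function.update_comm ne, Function.update_idem, Function.update_comm ne.symm, Function.update_idem]
    simp
  · rintro ⟨rfl, rfl⟩
    refine ⟨by simp [up, ne], ?_⟩
    simp only [up]
    rw [Function.update_comm ne, Function.update_idem, Function.update_comm ne.symm, Function.update_idem]
    simp

lemma Tm_mulVec (R : Matrix (ι × ι) (ι × ι) L) (k i : ℕ) (hi : i + 1 < k) (v : Fin k → ι) :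
    Tm R k i *ᵥ Pi.single v 1 = ∑ p : ι × ι, R p (v ⟨i, by omega⟩, v ⟨i+1, hi⟩) • Pi.single (up v i hi p) 1 := by
  funext u
  rw [Matrix.mulVec_single_one, Finset.sum_apply, Tm, dif_pos hi]
  simp only [Matrix.col_apply, of_apply, Pi.smul_apply, Pi.single_apply, smul_eq_mul, mul_ite, mul_one, mul_zero]
  have h1 : ∀ r : ι × ι, (if up u i hi r = v then R (u ⟨i, by omega⟩, u ⟨i+1, hi⟩) r else 0) = ∑ p : ι × ι, if ((u ⟨i, by omega⟩, u ⟨i+1, hi⟩) = p ∧ up u i hi r = v) then R p r else 0 := by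
    intro r
    simp only [ite_and, Finset.sum_ite_eq, Finset.mem_univ, if_true]
  have h2 : ∀ p : ι × ι, (if u = up v i hi p then R p (v ⟨i, by omega⟩, v ⟨i+1, hi⟩) else 0) = ∑ r : ι × ι, if ((u ⟨i, by omega⟩, u ⟨i+1, hi⟩) = p ∧ up u i hi r = v) then R p r else 0 := by
    intro p
    simp only [up_eq_iff u v i hi p, ite_and, Finset.sum_ite_eq, Finset.mem_univ, if_true, eq_comm (a := u)]
  simp only [h1, h2]
  exact Finset.sum_comm

lemma ext_upd {k : ℕ} (g : Fin k → ι) (w : ℕ → ι) (i : Fin k) (a : ι) :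
    Function.extend Fin.val (Function.update g i a) w = Function.update (Function.extend Fin.val g w) i.1 a := by
  funext j
  by_cases hj : ∃ x : Fin k, x.1 = j
  · obtain ⟨x, rfl⟩ := hj
    rw [Fin.val_injective.extend_apply]
    by_cases hx : x = i
    · subst hx; simp
    · rw [Function.update_of_ne hx, Function.update_of_ne (fun h => hx (Fin.ext h)), Fin.val_injective.extend_apply]
  · rw [Function.extend_apply' _ _ _ hj, Function.update_of_ne, Function.extend_apply' _ _ _ hj]
    rintro rfl; exact hj ⟨i, rfl⟩

lemma Tm_map {K : Type*} [Field K] (φ : L →+* K) (R : Matrix (ι × ι) (ι × ι) L) (k i : ℕ) :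
    (Tm R k i).map φ = Tm (R.map φ) k i := by
  unfold Tm
  split_ifs with h
  · ext u v
    simp [map_sum, apply_ite φ]
  · ext u v; simp
end Tm

section Tm2
variable {L ι : Type*} [Field L] [CharZero L] [Fintype ι] [DecidableEq ι] [Nonempty ι] {q : L}

lemma Tn_apply (R : Matrix (ι × ι) (ι × ι) L) (i : ℕ) (f : (ℕ → ι) → L) (w : ℕ → ι) :
    (Tn R i).1 f w = ∑ r : ι × ι, R (w i, w (i+1)) r * f (Function.update (Function.update w i r.1) (i+1) r.2) := by
  have e : (Tn R i).1 = ∑ p : ι × ι, ∑ r : ι × ι, R p r • (jE i (single p.1 r.1 1) * jE (i+1) (single p.2 r.2 1)) := by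
    change Alval L ι (tens (jj i) (jj (i+1)) R) = _
    rw [tens_apply]; simp only [map_sum, map_smul, map_mul]; rfl
  have h2 : ∀ p r : ι × ι, (jE i (single p.1 r.1 1) * jE (i+1) (single p.2 r.2 1) : EW L ι) f w = if p = (w i, w (i+1)) then f (Function.update (Function.update w i r.1) (i+1) r.2) else 0 := by
    intro p r
    simp only [Module.End.mul_apply, jE_apply, single_apply]
    rw [Finset.sum_eq_single r.1, Finset.sum_eq_single r.2]
    · have ne : i + 1 ≠ i := by omega
      rw [Function.update_of_ne ne]
      by_cases h1 : p.1 = w i <;> by_cases h2 : p.2 = w (i+1) <;> simp [h1, h2, Prod.ext_iff]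
    · intro b _ hb; simp [hb.symm]
    · simp
    · intro b _ hb; simp [hb.symm]
    · simp
  rw [e, LinearMap.sum_apply, Finset.sum_apply]
  simp only [LinearMap.sum_apply, Finset.sum_apply, LinearMap.smul_apply, Pi.smul_apply, h2, smul_eq_mul]
  rw [Finset.sum_comm]
  refine Finset.sum_congr rfl fun r _ => ?_
  simp

lemma JN_Tm (R : Matrix (ι × ι) (ι × ι) L) (k i : ℕ) (hi : i + 1 < k) : JN k (Tm R k i) = (Tn R i).1 := by
  ext f w
  rw [Tn_apply, Jhom_apply, Tm, dif_pos hi]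
  simp only [of_apply, Finset.sum_mul]
  rw [Finset.sum_comm]
  refine Finset.sum_congr rfl fun r _ => ?_
  rw [Finset.sum_eq_single (up (w ∘ Fin.val) i hi r)]
  · rw [if_pos rfl, mul_one, up, ext_upd, ext_upd, ext_self Fin.val_injective]
    rfl
  · intro u _ hu; rw [if_neg hu.symm]; simp
  · simp

lemma AS_map {P P' : Type*} [Ring P] [Algebra L P] [Ring P'] [Algebra L P'] (f : P →ₐ[L] P') {T : ℕ → P} {T' : ℕ → P'} (r : ℕ)
    (h : ∀ i < r, f (T i) = T' i) : f (AS q T r) = AS q T' r := by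
  induction r with
  | zero => exact map_one f
  | succ r ih =>
    have ih := ih fun i hi => h i (by omega)
    rw [AS, AS, map_add, map_smul, map_smul, map_mul, map_mul, ih, h r (by omega)]

lemma AS_mat_map {K : Type*} [Field K] (φ : L →+* K) {α : Type*} [Fintype α] [DecidableEq α] (T : ℕ → Matrix α α L) (r : ℕ) :
    (AS q T r).map φ = AS (φ q) (fun i => (T i).map φ) r := by
  have hqn : ∀ k, φ (qn q k) = qn (φ q) k := fun k => by simp [qn]
  induction r with
  | zero => simp [AS]
  | succ r ih =>
    have hs : ∀ (c : L) (M : Matrix α α L), (c • M).map φ = φ c • M.map φ := fun c M => by ext; simp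
    rw [AS, AS, Matrix.map_add φ (map_add φ), hs, hs, Matrix.map_mul, Matrix.map_mul, ih]
    simp only [map_div₀, map_neg, map_pow, hqn]

lemma JN_AS (R : Matrix (ι × ι) (ι × ι) L) (r : ℕ) : JN (r+1) (AS q (Tm R (r+1)) r) = (AS q (Tn R) r).1 := by
  rw [AS_map (JN (r+1)) (T' := fun i => (Tn R i).1) r fun i hi => JN_Tm R (r+1) i (by omega)]
  exact (AS_map (Alval L ι) r (fun i _ => rfl)).symm

lemma lam_trace (R : Matrix (ι × ι) (ι × ι) L) (r : ℕ) : lam q R (r+1) = (AS q (Tm R (r+1)) r).trace := by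
  have hc : (Fintype.card ι : L) ≠ 0 := by exact_mod_cast Fintype.card_ne_zero
  rw [lam, nu_eq (JN_AS R r), ← mul_assoc, ← mul_pow, mul_inv_cancel₀ hc, one_pow, one_mul]

lemma lam_map {K : Type*} [Field K] [CharZero K] (φ : L →+* K) (R : Matrix (ι × ι) (ι × ι) L) (r : ℕ) :
    φ (lam q R r) = lam (φ q) (R.map φ) r := by
  rcases r with _ | r
  · exact map_one φ
  · rw [lam_trace, lam_trace]
    have := AS_mat_map (q := q) φ (Tm R (r+1)) r
    simp only [Tm_map] at this
    rw [show AS (φ q) (Tm (R.map φ) (r+1)) r = _ from this.symm]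
    simp [Matrix.trace, map_sum]

/-- the data needed on the exterior side -/
lemma exists_A (hq : ∀ n : ℕ, 1 ≤ n → q ^ n ≠ 1) {R : Matrix (ι × ι) (ι × ι) L} (hb : R1 R * R2 R * R1 R = R2 R * R1 R * R2 R)
    (hquad : R * R = (q - 1) • R + q • 1) (k : ℕ) :
    ∃ A : Matrix (Fin k → ι) (Fin k → ι) L, A.trace = lam q R k ∧ A * A = A ∧ (∀ i, i + 1 < k → A * Tm R k i = - A) ∧
      1 - A ∈ RI L (Tm R k) (k - 1) := by
  rcases k with _ | r
  · exact ⟨1, by simp [lam], one_mul 1, fun i hi => by omega, by simp⟩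
  · have H := Tn_hecke hb hquad
    refine ⟨AS q (Tm R (r+1)) r, (lam_trace R r).symm, JN_inj _ ?_, fun i hi => JN_inj _ ?_, AS_RI hq r⟩
    · rw [map_mul, JN_AS]; exact congrArg Subtype.val (AS_idem H hq r)
    · rw [map_mul, map_neg, JN_AS, JN_Tm R _ i hi]; exact congrArg Subtype.val (AS_T H hq r i (by omega))
end Tm2
end
end HS

set_option linter.all false
namespace HS
open Matrix Kronecker TensorProduct

noncomputable section

section Lists
variable {ι : Type*} [Fintype ι] [DecidableEq ι]

def wd (k : ℕ) (l : List ι) (hl : l.length = k) : Fin k → ι := fun j => l[j.1]'(by have := j.2; omega)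

lemma ofFn_wd (k : ℕ) (l : List ι) (hl : l.length = k) : List.ofFn (wd k l hl) = l := by
  subst hl; exact List.ofFn_getElem

lemma wd_ofFn {k : ℕ} (w : Fin k → ι) : wd k (List.ofFn w) (List.length_ofFn) = w := by
  funext j; simp [wd]

lemma up_wd (k : ℕ) (s t : List ι) (a b c d : ι) (hl : (s ++ a :: b :: t).length = k) (hi : s.length + 1 < k) (hl' : (s ++ c :: d :: t).length = k) :
    up (wd k (s ++ a :: b :: t) hl) s.length hi (c, d) = wd k (s ++ c :: d :: t) hl' := by
  funext j
  obtain ⟨j, hj⟩ := j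
  rw [up]
  by_cases h1 : j = s.length + 1
  · subst h1; simp [wd, List.getElem_append]
  rw [Function.update_of_ne (by simpa using h1)]
  by_cases h2 : j = s.length
  · subst h2; simp [wd, List.getElem_append]
  rw [Function.update_of_ne (by simpa using h2)]
  simp only [wd, List.getElem_append]
  split_ifs with h3
  · rfl
  · obtain ⟨m, hm⟩ : ∃ m, j - s.length = m + 2 := ⟨j - s.length - 2, by omega⟩
    simp only [hm, List.getElem_cons_succ]

lemma exists_split {k : ℕ} (v : Fin k → ι) (i : ℕ) (hi : i + 1 < k) : ∃ (s t : List ι) (a b : ι) (hl : (s ++ a :: b :: t).length = k),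
    s.length = i ∧ v = wd k (s ++ a :: b :: t) hl := by
  have hlen : (List.ofFn v).length = k := List.length_ofFn
  have e : List.ofFn v = (List.ofFn v).take i ++ (List.ofFn v)[i] :: (List.ofFn v)[i+1] :: (List.ofFn v).drop (i+2) := by
    rw [← List.drop_eq_getElem_cons, ← List.drop_eq_getElem_cons, List.take_append_drop]
  refine ⟨_, _, _, _, e ▸ hlen, by simp; omega, ?_⟩
  conv_lhs => rw [← wd_ofFn v]
  congr 1
end Lists

section Lam
variable {K V : Type} [Field K] [AddCommGroup V] [Module K V] {ι : Type} [Fintype ι] [DecidableEq ι]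
variable (b : Module.Basis ι K V) (R : V ⊗[K] V →ₗ[K] V ⊗[K] V)

def MM : Matrix (ι × ι) (ι × ι) K := LinearMap.toMatrix (b.tensorProduct b) (b.tensorProduct b) R

lemma R_basis (i j : ι) : R (b i ⊗ₜ b j) = ∑ p : ι × ι, MM b R p (i, j) • (b p.1 ⊗ₜ[K] b p.2) := by
  have := (b.tensorProduct b).sum_repr (R (b i ⊗ₜ b j))
  rw [← this]
  refine Finset.sum_congr rfl fun p _ => ?_
  rw [Module.Basis.tensorProduct_apply', MM, LinearMap.toMatrix_apply, Module.Basis.tensorProduct_apply]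

abbrev BB (K ι : Type) [Field K] := MonoidAlgebra K (FreeMonoid ι)
def sw (K : Type) {ι : Type} [Field K] (l : List ι) : BB K ι := MonoidAlgebra.of K (FreeMonoid ι) (FreeMonoid.ofList l)

lemma sw_mul (l l' : List ι) : sw K l * sw K l' = sw K (l ++ l') := by
  rw [sw, sw, ← map_mul]; rfl
lemma sw_nil : sw K ([] : List ι) = 1 := rfl

def PhiE : TensorAlgebra K V ≃ₐ[K] BB K ι := (TensorAlgebra.equivFreeAlgebra b).trans FreeAlgebra.equivMonoidAlgebraFreeMonoid

lemma PhiE_ι (i : ι) : PhiE b (TensorAlgebra.ι K (b i)) = sw K [i] := by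
  rw [PhiE, AlgEquiv.trans_apply, TensorAlgebra.equivFreeAlgebra_ι_apply]
  simp [FreeAlgebra.equivMonoidAlgebraFreeMonoid]
  rfl

lemma PhiE_word (l : List ι) : PhiE b (l.map fun i => TensorAlgebra.ι K (b i)).prod = sw K l := by
  induction l with
  | nil => simp [sw_nil]
  | cons a l ih => rw [List.map_cons, List.prod_cons, map_mul, ih, PhiE_ι, sw_mul]; rfl

def FF (K : Type) {ι : Type} [Field K] (k : ℕ) : BB K ι →ₗ[K] ((Fin k → ι) → K) where
  toFun x := fun w => x.coeff (FreeMonoid.ofList (List.ofFn w))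
  map_add' x y := by funext w; simp
  map_smul' c x := by funext w; simp

lemma FF_sw (k : ℕ) (l : List ι) (hl : l.length = k) : FF K k (sw K l) = Pi.single (wd k l hl) 1 := by
  classical
  funext w
  change (MonoidAlgebra.single (FreeMonoid.ofList l) (1:K)).coeff (FreeMonoid.ofList (List.ofFn w)) = _
  rw [MonoidAlgebra.coeff_single_apply, Pi.single_apply]
  refine if_congr ?_ rfl rfl
  rw [FreeMonoid.ofList.injective.eq_iff]
  constructor
  · rintro rfl; exact (wd_ofFn w).symm
  · rintro rfl; exact (ofFn_wd _ _ _).symm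

lemma FF_sw_ne (k : ℕ) (l : List ι) (hl : l.length ≠ k) : FF K k (sw K l) = 0 := by
  classical
  funext w
  change (MonoidAlgebra.single (FreeMonoid.ofList l) (1:K)).coeff (FreeMonoid.ofList (List.ofFn w)) = _
  rw [MonoidAlgebra.coeff_single_apply, if_neg]; rfl
  rw [FreeMonoid.ofList.injective.eq_iff]
  rintro rfl; simp at hl

def rr (i j : ι) : BB K ι := sw K [i, j] + ∑ p : ι × ι, MM b R p (i, j) • sw K [p.1, p.2]

lemma PhiE_rel (i j : ι) : PhiE b (mulTwo K V ((R + (LinearMap.id : V ⊗[K] V →ₗ[K] V ⊗[K] V)) (b i ⊗ₜ b j))) = rr b R i j := by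
  rw [LinearMap.add_apply, R_basis, LinearMap.id_apply, map_add, map_add, add_comm, rr]
  have h : ∀ i j, PhiE b (mulTwo K V (b i ⊗ₜ b j)) = sw K [i, j] := fun i j => by
    simp [mulTwo, PhiE_ι, sw_mul]
  rw [h]
  simp only [map_sum, map_smul, h]

variable {b R}
lemma FF_rr {k : ℕ} (s t : List ι) (i j : ι) (hl : (s ++ i :: j :: t).length = k) (hi : s.length + 1 < k) :
    FF K k (sw K s * rr b R i j * sw K t) = (Tm (MM b R) k s.length + 1) *ᵥ Pi.single (wd k (s ++ i :: j :: t) hl) 1 := by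
  have h : ∀ i j : ι, sw K s * sw K [i, j] * sw K t = sw K (s ++ i :: j :: t) := fun i j => by
    rw [sw_mul, sw_mul]; simp
  rw [rr, mul_add, add_mul, h, Finset.mul_sum, Finset.sum_mul, map_add, map_sum, add_mulVec, one_mulVec, Tm_mulVec _ _ _ hi, FF_sw k _ hl, add_comm]
  congr 1
  refine Finset.sum_congr rfl fun p _ => ?_
  rw [mul_smul_comm, smul_mul_assoc, h, map_smul, FF_sw k _ (by simpa using hl), ← up_wd k s t i j p.1 p.2 hl hi]
  congr 2
  simp [wd, List.getElem_append]

lemma FF_rr_ne {k : ℕ} (s t : List ι) (i j : ι) (hl : (s ++ i :: j :: t).length ≠ k) :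
    FF K k (sw K s * rr b R i j * sw K t) = 0 := by
  have h : ∀ i j : ι, sw K s * sw K [i, j] * sw K t = sw K (s ++ i :: j :: t) := fun i j => by
    rw [sw_mul, sw_mul]; simp
  rw [rr, mul_add, add_mul, h, Finset.mul_sum, Finset.sum_mul, map_add, map_sum, FF_sw_ne k _ hl, zero_add]
  refine Finset.sum_eq_zero fun p _ => ?_
  rw [mul_smul_comm, smul_mul_assoc, h, map_smul, FF_sw_ne k _ (by simpa using hl), smul_zero]

def GG (K : Type) {ι : Type} [Field K] [Fintype ι] (k : ℕ) : ((Fin k → ι) → K) →ₗ[K] BB K ι where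
  toFun f := ∑ w, f w • sw K (List.ofFn w)
  map_add' f g := by simp [add_smul, Finset.sum_add_distrib]
  map_smul' c f := by simp [Finset.smul_sum, mul_smul]

lemma GG_single {k : ℕ} (w : Fin k → ι) : GG K k (Pi.single w 1) = sw K (List.ofFn w) := by
  change ∑ w', (Pi.single w 1 : (Fin k → ι) → K) w' • sw K (List.ofFn w') = _
  rw [Finset.sum_eq_single w]
  · simp
  · intro w' _ h; simp [h]
  · simp

lemma pi_lin_ext {α M : Type*} [Fintype α] [DecidableEq α] [AddCommGroup M] [Module K M] {f g : (α → K) →ₗ[K] M} (h : ∀ a, f (Pi.single a 1) = g (Pi.single a 1)) : f = g := by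
  apply (Pi.basisFun K α).ext
  intro i; simpa using h i

lemma FF_GG {k : ℕ} (f : (Fin k → ι) → K) : FF K k (GG K k f) = f := by
  have : FF K k ∘ₗ GG K k = (LinearMap.id : ((Fin k → ι) → K) →ₗ[K] _) := pi_lin_ext fun w => by
    rw [LinearMap.comp_apply, GG_single, FF_sw k _ List.length_ofFn, wd_ofFn]; rfl
  exact LinearMap.congr_fun this f

variable (b R)
/-- the map from words to the quotient -/
def gam (k : ℕ) : ((Fin k → ι) → K) →ₗ[K] RingQuot (lambdaRel K V R) :=
  (RingQuot.mkAlgHom K (lambdaRel K V R)).toLinearMap ∘ₗ (PhiE b).symm.toLinearMap ∘ₗ GG K k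

lemma gam_range (k : ℕ) : LinearMap.range (gam b R k) = lambdaGrade K V R k := by
  rw [gam, LinearMap.range_comp, lambdaGrade]
  congr 1
  have h1 : LinearMap.range (TensorAlgebra.ι K : V →ₗ[K] TensorAlgebra K V) = Submodule.span K (Set.range fun i => TensorAlgebra.ι K (b i)) := by
    rw [LinearMap.range_eq_map, ← b.span_eq, Submodule.map_span, ← Set.range_comp]; rfl
  have h2 : ∀ w : Fin k → ι, (PhiE b).symm (sw K (List.ofFn w)) = (List.ofFn fun i => TensorAlgebra.ι K (b (w i))).prod := by
    intro w
    rw [AlgEquiv.symm_apply_eq, ← PhiE_word b, List.map_ofFn]; rfl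
  rw [h1, Submodule.span_pow, LinearMap.range_eq_map, ← (Pi.basisFun K (Fin k → ι)).span_eq, Submodule.map_span]
  congr 1
  ext x
  simp only [Set.mem_image, Set.mem_range, exists_exists_eq_and, Set.mem_pow]
  constructor
  · rintro ⟨w, rfl⟩
    refine ⟨fun i => ⟨_, w i, rfl⟩, ?_⟩
    rw [Pi.basisFun_apply, LinearMap.comp_apply, GG_single]; exact (h2 w).symm
  · rintro ⟨f, rfl⟩
    choose w hw using fun i => (f i).2
    refine ⟨w, ?_⟩
    rw [Pi.basisFun_apply, LinearMap.comp_apply, GG_single]; refine (h2 w).trans ?_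
    simp only [hw]

lemma gam_rel (k i : ℕ) (hi : i + 1 < k) (f : (Fin k → ι) → K) : gam b R k ((Tm (MM b R) k i + 1) *ᵥ f) = 0 := by
  have : gam b R k ∘ₗ Matrix.mulVecLin (Tm (MM b R) k i + 1) = 0 := by
    refine pi_lin_ext fun v => ?_
    obtain ⟨s, t, i', j', hl, rfl, rfl⟩ := exists_split v i hi
    rw [LinearMap.comp_apply, Matrix.mulVecLin_apply, ← FF_rr s t i' j' hl hi]
    have e : GG K k (FF K k (sw K s * rr b R i' j' * sw K t)) = sw K s * rr b R i' j' * sw K t := by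
      have h : ∀ i j : ι, sw K s * sw K [i, j] * sw K t = sw K (s ++ i :: j :: t) := fun i j => by
        rw [sw_mul, sw_mul]; simp
      have h' : ∀ i j : ι, GG K k (FF K k (sw K (s ++ i :: j :: t))) = sw K (s ++ i :: j :: t) := fun i j => by
        rw [FF_sw k _ (by simpa using hl), GG_single, ofFn_wd]
      rw [rr, mul_add, add_mul, h, Finset.mul_sum, Finset.sum_mul, map_add, map_sum, map_add, map_sum, h']
      congr 1
      refine Finset.sum_congr rfl fun p _ => ?_
      rw [mul_smul_comm, smul_mul_assoc, h, map_smul, map_smul, h']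
    change RingQuot.mkAlgHom K (lambdaRel K V R) ((PhiE b).symm (GG K k _)) = 0
    rw [e, ← PhiE_rel, map_mul, map_mul, map_mul, map_mul, AlgEquiv.symm_apply_apply]
    have hrel : RingQuot.mkAlgHom K (lambdaRel K V R) (mulTwo K V ((R + (LinearMap.id : V ⊗[K] V →ₗ[K] V ⊗[K] V)) (b i' ⊗ₜ b j'))) = 0 := by
      rw [← map_zero (RingQuot.mkAlgHom K (lambdaRel K V R))]
      exact RingQuot.mkAlgHom_rel K ⟨rfl, _, rfl⟩
    rw [hrel, mul_zero, zero_mul]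
  exact LinearMap.congr_fun this f

/-- subspace of tensors killed -/
def JJ {k : ℕ} (A : Matrix (Fin k → ι) (Fin k → ι) K) : Submodule K (BB K ι) where
  carrier := {x | ∀ s t : List ι, A *ᵥ FF K k (sw K s * x * sw K t) = 0}
  add_mem' {x y} hx hy s t := by rw [mul_add, add_mul, map_add, mulVec_add, hx, hy, add_zero]
  zero_mem' s t := by simp
  smul_mem' c x hx s t := by rw [mul_smul_comm, smul_mul_assoc, map_smul, mulVec_smul, hx, smul_zero]

variable {b R} in
lemma JJ_mul {k : ℕ} {A : Matrix (Fin k → ι) (Fin k → ι) K} {x : BB K ι} (hx : x ∈ JJ A) (y : BB K ι) : y * x ∈ JJ A ∧ x * y ∈ JJ A := by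
  induction y using MonoidAlgebra.induction_on with
  | of m =>
    constructor
    · intro s t
      have := hx (s ++ FreeMonoid.toList m) t
      rw [← sw_mul] at this; rw [← mul_assoc]; exact this
    · intro s t
      have := hx s (FreeMonoid.toList m ++ t)
      rw [← sw_mul] at this; rw [← mul_assoc, mul_assoc _ _ (sw K t)]; exact this
  | add x y h1 h2 => exact ⟨by rw [add_mul]; exact add_mem h1.1 h2.1, by rw [mul_add]; exact add_mem h1.2 h2.2⟩
  | smul c x h => exact ⟨by rw [smul_mul_assoc]; exact Submodule.smul_mem _ _ h.1, by rw [mul_smul_comm]; exact Submodule.smul_mem _ _ h.2⟩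

lemma JJ_rel {k : ℕ} {A : Matrix (Fin k → ι) (Fin k → ι) K} (hA : ∀ i, i + 1 < k → A * Tm (MM b R) k i = - A) (u : V ⊗[K] V) :
    PhiE b (mulTwo K V ((R + (LinearMap.id : V ⊗[K] V →ₗ[K] V ⊗[K] V)) u)) ∈ JJ A := by
  have h0 : ∀ i j, rr b R i j ∈ JJ A := by
    intro i j s t
    by_cases hl : (s ++ i :: j :: t).length = k
    · have hi : s.length + 1 < k := by simp at hl; omega
      rw [FF_rr s t i j hl hi, mulVec_mulVec, mul_add, hA _ hi, mul_one, neg_add_cancel, zero_mulVec]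
    · rw [FF_rr_ne s t i j hl, mulVec_zero]
  rw [← (b.tensorProduct b).sum_repr u]
  simp only [map_sum, map_smul]
  refine Submodule.sum_mem _ fun p _ => Submodule.smul_mem _ _ ?_
  rw [Module.Basis.tensorProduct_apply', PhiE_rel]
  exact h0 _ _

lemma JJ_ker {k : ℕ} {A : Matrix (Fin k → ι) (Fin k → ι) K} (hA : ∀ i, i + 1 < k → A * Tm (MM b R) k i = - A) {x y : TensorAlgebra K V}
    (h : RingQuot.mkAlgHom K (lambdaRel K V R) x = RingQuot.mkAlgHom K (lambdaRel K V R) y) : PhiE b (x - y) ∈ JJ A := by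
  have h' : RingQuot.mkRingHom (lambdaRel K V R) x = RingQuot.mkRingHom (lambdaRel K V R) y := by
    rw [← RingQuot.mkAlgHom_coe K]; exact h
  rw [RingQuot.mkRingHom_def] at h'
  have h2 : Quot.mk (RingQuot.Rel (lambdaRel K V R)) x = Quot.mk (RingQuot.Rel (lambdaRel K V R)) y := by
    injection h'
  have h3 := Quot.eqvGen_exact h2
  clear h h' h2
  induction h3 with
  | rel x y h =>
    induction h with
    | of h => obtain ⟨rfl, u, rfl⟩ := h; rw [sub_zero]; exact JJ_rel b R hA u
    | add_left _ ih => simpa using ih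
    | mul_left _ ih => rw [← sub_mul, map_mul]; exact (JJ_mul ih _).2
    | mul_right _ ih => rw [← mul_sub, map_mul]; exact (JJ_mul ih _).1
  | refl x => rw [sub_self, map_zero]; exact zero_mem _
  | symm x y _ h => rw [← neg_sub, map_neg]; exact neg_mem h
  | trans x y z _ _ h1 h2 => rw [← sub_add_sub_cancel x y z, map_add]; exact add_mem h1 h2

theorem dim_grade {k : ℕ} {A : Matrix (Fin k → ι) (Fin k → ι) K} (hA : ∀ i, i + 1 < k → A * Tm (MM b R) k i = - A)
    (hA1 : 1 - A ∈ RI K (Tm (MM b R) k) (k-1)) : Module.finrank K (lambdaGrade K V R k) = Module.finrank K (LinearMap.range (Matrix.toLin' A)) := by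
  have hker : LinearMap.ker (gam b R k) = LinearMap.ker (Matrix.toLin' A) := by
    apply le_antisymm
    · intro f hf
      rw [LinearMap.mem_ker] at hf ⊢
      have := JJ_ker b R hA (x := (PhiE b).symm (GG K k f)) (y := 0) (by rw [map_zero]; exact hf) [] []
      rw [sub_zero, AlgEquiv.apply_symm_apply, sw_nil, one_mul, mul_one, FF_GG] at this
      rwa [Matrix.toLin'_apply]
    · intro f hf
      rw [LinearMap.mem_ker] at hf ⊢
      have h1 : ∀ Y ∈ RI K (Tm (MM b R) k) (k-1), gam b R k (Y *ᵥ f) = 0 := by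
        intro Y hY
        induction hY using Submodule.span_induction with
        | mem x h => obtain ⟨i, hi, y, rfl⟩ := h; rw [← mulVec_mulVec]; exact gam_rel b R k i (by omega) _
        | zero => simp
        | add a b _ _ ha hb => rw [add_mulVec, map_add, ha, hb, add_zero]
        | smul c a _ ha => rw [smul_mulVec, map_smul, ha, smul_zero]
      have := h1 _ hA1
      rw [sub_mulVec, one_mulVec] at this
      rw [Matrix.toLin'_apply] at hf
      rwa [hf, sub_zero] at this
  have r1 := LinearMap.finrank_range_add_finrank_ker (gam b R k)
  have r2 := LinearMap.finrank_range_add_finrank_ker (Matrix.toLin' A)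
  rw [hker] at r1
  rw [gam_range] at r1
  omega
end Lam
end
end HS

set_option linter.all false
namespace HS
open Matrix Kronecker TensorProduct

noncomputable section
section Tr
variable {K V : Type} [Field K] [AddCommGroup V] [Module K V] {ι : Type} [Fintype ι] [DecidableEq ι]
variable (b : Module.Basis ι K V) (R : V ⊗[K] V →ₗ[K] V ⊗[K] V)

lemma repr_assoc (z : V ⊗[K] (V ⊗[K] V)) (p : (ι × ι) × ι) :
    ((b.tensorProduct b).tensorProduct b).repr ((TensorProduct.assoc K V V V).symm z) p = (b.tensorProduct (b.tensorProduct b)).repr z (Equiv.prodAssoc ι ι ι p) := by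
  induction z using TensorProduct.induction_on with
  | zero => simp
  | add x y hx hy => simp only [map_add, Finsupp.add_apply, hx, hy]
  | tmul u z =>
    induction z using TensorProduct.induction_on with
    | zero => simp
    | add x y hx hy => simp only [map_add, Finsupp.add_apply, hx, hy, tmul_add]
    | tmul v w =>
      obtain ⟨⟨i, j⟩, k⟩ := p
      simp [Module.Basis.tensorProduct_repr_tmul_apply]; try ring

lemma mat_S1 : LinearMap.toMatrix ((b.tensorProduct b).tensorProduct b) ((b.tensorProduct b).tensorProduct b)
    (TensorProduct.map R LinearMap.id) = MM b R ⊗ₖ (1 : Matrix ι ι K) := by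
  rw [TensorProduct.toMatrix_map, LinearMap.toMatrix_id]; rfl

lemma mat_S2 : LinearMap.toMatrix ((b.tensorProduct b).tensorProduct b) ((b.tensorProduct b).tensorProduct b)
    ((TensorProduct.assoc K V V V).symm.toLinearMap ∘ₗ
        TensorProduct.map LinearMap.id R ∘ₗ (TensorProduct.assoc K V V V).toLinearMap) = ((1 : Matrix ι ι K) ⊗ₖ MM b R).submatrix (Equiv.prodAssoc ι ι ι) (Equiv.prodAssoc ι ι ι) := by
  have h : LinearMap.toMatrix (b.tensorProduct (b.tensorProduct b)) (b.tensorProduct (b.tensorProduct b)) (TensorProduct.map (LinearMap.id : V →ₗ[K] V) R) = (1 : Matrix ι ι K) ⊗ₖ MM b R := by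
    rw [TensorProduct.toMatrix_map, LinearMap.toMatrix_id]; rfl
  rw [← h]
  ext p r
  rw [LinearMap.toMatrix_apply, submatrix_apply, LinearMap.toMatrix_apply]
  simp only [LinearMap.comp_apply, LinearEquiv.coe_coe]
  rw [repr_assoc]
  obtain ⟨⟨i, j⟩, k⟩ := r
  simp [Module.Basis.tensorProduct_apply]

variable {b R} {q : K}
lemma MM_braid (hR : IsHeckeSymmetry K V q R) : R1 (MM b R) * R2 (MM b R) * R1 (MM b R) = R2 (MM b R) * R1 (MM b R) * R2 (MM b R) := by
  have h := congrArg (LinearMap.toMatrix ((b.tensorProduct b).tensorProduct b) ((b.tensorProduct b).tensorProduct b)) hR.2.1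
  rw [LinearMap.toMatrix_comp _ ((b.tensorProduct b).tensorProduct b), LinearMap.toMatrix_comp _ ((b.tensorProduct b).tensorProduct b),
    LinearMap.toMatrix_comp _ ((b.tensorProduct b).tensorProduct b) _ (_ ∘ₗ _) (_ ∘ₗ _ ∘ₗ _), LinearMap.toMatrix_comp _ ((b.tensorProduct b).tensorProduct b) _ (TensorProduct.map R LinearMap.id), mat_S1, mat_S2] at h
  have h' := congrArg (fun X => X.submatrix (Equiv.prodAssoc ι ι ι).symm (Equiv.prodAssoc ι ι ι).symm) h
  simp only [← submatrix_mul_equiv _ _ _ (Equiv.prodAssoc ι ι ι).symm, submatrix_submatrix, Equiv.self_comp_symm, submatrix_id_id] at h'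
  rw [mul_assoc, mul_assoc]; exact h'

lemma MM_quad (hR : IsHeckeSymmetry K V q R) : MM b R * MM b R = (q - 1) • MM b R + q • 1 := by
  have h := congrArg (LinearMap.toMatrix (b.tensorProduct b) (b.tensorProduct b)) hR.2.2.1
  rw [LinearMap.toMatrix_comp _ (b.tensorProduct b), map_add, map_sub, map_smul, LinearMap.toMatrix_id, map_zero] at h
  change (MM b R + 1) * (MM b R - q • 1) = 0 at h
  rw [add_mul, mul_sub, mul_sub, mul_smul_comm, mul_one, one_mul, one_mul] at h
  rw [sub_smul, one_smul, ← sub_eq_zero, ← h]; abel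

/-- partial transpose -/
def PT {L : Type*} (M : Matrix (ι × ι) (ι × ι) L) : Matrix (ι × ι) (ι × ι) L := of fun p r => M (p.1, r.2) (p.2, r.1)

lemma dth_inj [FiniteDimensional K V] {z : V ⊗[K] Module.Dual K V} (h : dualTensorHom K V V ((TensorProduct.comm K V (Module.Dual K V)) z) = 0) : z = 0 := by
  have inj : Function.Injective (dualTensorHom K V V) := by
    have := (dualTensorHomEquiv K V V).injective
    exact this
  have h1 : (TensorProduct.comm K V (Module.Dual K V)) z = 0 := inj (by rw [h, map_zero])
  exact (TensorProduct.comm K V (Module.Dual K V)).injective (by rw [h1, map_zero])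

lemma dual_zero (f : ι × ι → K) (h : ∑ p : ι × ι, f p • (b.coord p.1 ⊗ₜ[K] b p.2) = 0) : f = 0 := by
  have e : ∑ p : ι × ι, f p • (b.dualBasis.tensorProduct b) p = 0 := by
    rw [← h]
    refine Finset.sum_congr rfl fun p _ => ?_
    rw [Module.Basis.tensorProduct_apply', Module.Basis.coe_dualBasis]
  have h2 := (b.dualBasis.tensorProduct b).repr_sum_self f
  rw [e, map_zero] at h2
  rw [← h2]; rfl

lemma PT_ker (Rs : Module.Dual K V ⊗[K] V →ₗ[K] V ⊗[K] Module.Dual K V) (hRs : ∀ (ξ : Module.Dual K V) (v w : V),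
      dualTensorHom K V V ((TensorProduct.comm K V (Module.Dual K V)) (Rs (ξ ⊗ₜ[K] v))) w =
        TensorProduct.lid K V (TensorProduct.map ξ LinearMap.id (R (v ⊗ₜ[K] w)))) (f : ι × ι → K) (hf : (PT (MM b R))ᵀ.mulVecLin f = 0) :
    dualTensorHom K V V ((TensorProduct.comm K V (Module.Dual K V)) (Rs (∑ p : ι × ι, f p • (b.coord p.1 ⊗ₜ[K] b p.2)))) = 0 := by
  refine b.ext fun d => ?_
  simp only [map_sum, map_smul, LinearMap.sum_apply, LinearMap.smul_apply, hRs, R_basis, TensorProduct.map_tmul, TensorProduct.lid_tmul, LinearMap.id_apply, LinearMap.zero_apply]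
  refine b.ext_elem fun e => ?_
  have h2 := congrFun hf (d, e)
  simp only [Matrix.mulVecLin_apply, Matrix.mulVec, dotProduct, transpose_apply, PT, of_apply, Pi.zero_apply] at h2
  rw [map_zero, Finsupp.zero_apply, ← h2]
  simp only [map_sum, map_smul, Finsupp.coe_finset_sum, Finset.sum_apply, Finsupp.smul_apply, smul_eq_mul]
  refine Finset.sum_congr rfl fun p _ => ?_
  rw [mul_comm]; congr 1
  rw [Fintype.sum_prod_type]
  simp [Finsupp.single_apply]

lemma PT_unit (hR : IsHeckeSymmetry K V q R) : IsUnit (PT (MM b R)) := by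
  obtain ⟨Rs, hbij, hRs⟩ := hR.2.2.2
  rw [← Matrix.isUnit_transpose, ← Matrix.mulVec_injective_iff_isUnit, ← Matrix.coe_mulVecLin, ← LinearMap.ker_eq_bot, LinearMap.ker_eq_bot']
  intro f hf
  haveI := Module.Finite.of_basis b
  have h2 := dth_inj (PT_ker Rs hRs f hf)
  exact dual_zero f (hbij.1 (by rw [h2, map_zero]))

variable {L : Type} [Field L] [CharZero L] [Nonempty ι]

lemma ph_surj_of (M : Matrix (ι × ι) (ι × ι) L) (h : IsUnit (PT M)) (η : Matrix ι ι L) : ∃ c, ph M c = η := by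
  obtain ⟨v, hv⟩ := Matrix.mulVec_surjective_iff_isUnit.2 h (fun p => (Fintype.card ι : L) * η p.1 p.2)
  refine ⟨of fun d e => v (d, e), ?_⟩
  ext a c
  have h1 := congrFun hv (a, c)
  have hc : (Fintype.card ι : L) ≠ 0 := by simp
  rw [ph, of_apply, inv_mul_eq_iff_eq_mul₀ hc, ← h1, mulVec, dotProduct, Fintype.sum_prod_type, Finset.sum_comm]
  rfl

lemma map_R1 (φ : K →+* L) (M : Matrix (ι × ι) (ι × ι) K) : R1 (M.map φ) = (R1 M).map φ := by
  ext p r; simp [R1, kroneckerMap_apply, one_apply, apply_ite φ]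
lemma map_R2 (φ : K →+* L) (M : Matrix (ι × ι) (ι × ι) K) : R2 (M.map φ) = (R2 M).map φ := by
  ext p r; simp [R2, kroneckerMap_apply, one_apply, apply_ite φ]

lemma exists_sys_map (hR : IsHeckeSymmetry K V q R) (q0 : q ≠ 0) (φ : K →+* L) : ∃ σ : Sys L ι (φ q), σ.R = (MM b R).map φ := by
  refine exists_sys _ ?_ ?_ (ph_surj_of _ ?_) (by simpa using q0)
  · have h := congrArg (fun X : Matrix _ _ K => X.map φ) (MM_braid (b := b) hR)
    simpa only [Matrix.map_mul, map_R1, map_R2] using h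
  · have h := congrArg (fun X : Matrix _ _ K => X.map φ) (MM_quad (b := b) hR)
    rw [← Matrix.map_mul, h]
    ext p r
    simp [one_apply, apply_ite φ]
  · exact (PT_unit (b := b) hR).map φ.mapMatrix
end Tr

/-- a field containing both -/
lemma exists_field (K : Type) [Field K] [CharZero K] : ∃ (L : Type) (_ : Field L) (_ : CharZero L), Nonempty (K →+* L) ∧ Nonempty (ℝ →+* L) := by
  obtain ⟨I, hI⟩ := Ideal.exists_maximal (K ⊗[ℚ] ℝ)
  letI := Ideal.Quotient.field I
  let f : K →+* (K ⊗[ℚ] ℝ) ⧸ I := (Ideal.Quotient.mk I).comp (Algebra.TensorProduct.includeLeftRingHom)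
  let g : ℝ →+* (K ⊗[ℚ] ℝ) ⧸ I := (Ideal.Quotient.mk I).comp (Algebra.TensorProduct.includeRight : ℝ →ₐ[ℚ] K ⊗[ℚ] ℝ).toRingHom
  exact ⟨_, inferInstance, charZero_of_injective_ringHom f.injective, ⟨f⟩, ⟨g⟩⟩

end
end HS

set_option linter.all false
namespace HS
open Matrix Kronecker TensorProduct

noncomputable section

lemma map_Ax {L : Type} [Field L] (ψ : ℝ →+* L) {m : ℕ} (x : Fin m → ℝ) : PowerSeries.map ψ (Ax x : PowerSeries ℝ) = Xs (fun i => ψ (x i)) := by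
  have : (Ax x : PowerSeries ℝ) = ∏ i, (1 + PowerSeries.C (x i) * PowerSeries.X) := by
    rw [Ax, ← Polynomial.coeToPowerSeries.ringHom_apply, map_prod]; simp
  rw [this, map_prod, Xs]; simp
lemma map_Bx {L : Type} [Field L] (ψ : ℝ →+* L) {m : ℕ} (x : Fin m → ℝ) : PowerSeries.map ψ (Bx x : PowerSeries ℝ) = Ys (fun i => ψ (x i)) := by
  have : (Bx x : PowerSeries ℝ) = ∏ i, (1 - PowerSeries.C (x i) * PowerSeries.X) := by
    rw [Bx, ← Polynomial.coeToPowerSeries.ringHom_apply, map_prod]; simp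
  rw [this, map_prod, Ys]; simp

lemma nontriv {K V : Type} [Field K] [AddCommGroup V] [Module K V] [Subsingleton V] (R : V ⊗[K] V →ₗ[K] V ⊗[K] V)
    {m n : ℕ} {x : Fin m → ℝ} {y : Fin n → ℝ} (hx : ∀ i, 0 < x i) (hy : ∀ i, 0 < y i)
    (heq : poincareLambda K V R * (Bx y : PowerSeries ℝ) = (Ax x : PowerSeries ℝ)) : m + n = 0 := by
  obtain ⟨c, hc⟩ : ∃ c : ℝ, poincareLambda K V R = ((Polynomial.C c : Polynomial ℝ) : PowerSeries ℝ) := by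
    refine ⟨Module.finrank K (lambdaGrade K V R 0), ?_⟩
    ext k
    rw [poincareLambda, PowerSeries.coeff_mk, Polynomial.coeff_coe, Polynomial.coeff_C]
    rcases k with _ | k
    · simp
    · have : LinearMap.range (TensorAlgebra.ι K : V →ₗ[K] TensorAlgebra K V) = ⊥ := by
        rw [LinearMap.range_eq_bot]; ext v; rw [Subsingleton.elim v 0]; simp
      have h2 : lambdaGrade K V R (k+1) = ⊥ := by
        rw [lambdaGrade, this, Submodule.bot_pow (by simp), Submodule.map_bot]
      rw [h2]; simp
  rw [hc, ← Polynomial.coe_mul, Polynomial.coe_inj] at heq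
  rcases n with _ | n
  · rcases m with _ | m
    · rfl
    exfalso
    have h1 := congrArg (Polynomial.eval (-(x 0)⁻¹)) heq
    have h0 := congrArg (Polynomial.eval 0) heq
    have e : (Ax x).eval (-(x 0)⁻¹) = 0 := by
      rw [Ax, Polynomial.eval_prod]
      refine Finset.prod_eq_zero (Finset.mem_univ 0) ?_
      simp [(hx 0).ne']
    rw [e] at h1
    simp [Bx, Ax, Polynomial.eval_prod] at h0 h1
    rw [h0] at h1; exact one_ne_zero h1
  · exfalso
    have h1 := congrArg (Polynomial.eval ((y 0)⁻¹)) heq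
    rw [Polynomial.eval_mul] at h1
    have e : (Bx y).eval ((y 0)⁻¹) = 0 := by
      rw [Bx, Polynomial.eval_prod]
      refine Finset.prod_eq_zero (Finset.mem_univ 0) ?_
      simp [(hy 0).ne']
    rw [e, mul_zero] at h1
    have : 0 < (Ax x).eval ((y 0)⁻¹) := by
      rw [Ax, Polynomial.eval_prod]
      refine Finset.prod_pos fun i _ => ?_
      have := hx i; have := hy 0
      simp; positivity
    linarith

theorem main_symAB (K : Type) [Field K] [CharZero K]
    (V : Type) [AddCommGroup V] [Module K V] [FiniteDimensional K V]
    (q : K) (hq0 : q ≠ 0) (hq : ∀ n : ℕ, 1 < n → q ^ n ≠ 1)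
    (R : V ⊗[K] V →ₗ[K] V ⊗[K] V) (hR : IsHeckeSymmetry K V q R)
    {m n : ℕ} (x : Fin m → ℝ) (y : Fin n → ℝ)
    (hx : ∀ i, 0 < x i) (hy : ∀ j, 0 < y j)
    (heq : poincareLambda K V R * (Bx y : PowerSeries ℝ) = (Ax x : PowerSeries ℝ)) :
    Ax x * Bx (fun i => (y i)⁻¹) = Ax (fun i => (x i)⁻¹) * Bx y := by
  by_cases hmn : m + n = 0
  · obtain rfl : m = 0 := by omega
    obtain rfl : n = 0 := by omega
    simp [Ax, Bx]
  haveI : NeZero (m + n) := ⟨hmn⟩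
  have hV : ¬ Subsingleton V := fun h => hmn (nontriv R hx hy heq)
  haveI : Nontrivial V := not_subsingleton_iff_nontrivial.1 hV
  let b : Module.Basis (Fin (Module.finrank K V)) K V := Module.finBasis K V
  haveI : Nonempty (Fin (Module.finrank K V)) := ⟨⟨0, Module.finrank_pos⟩⟩
  have hq1 : ∀ n : ℕ, 1 ≤ n → q ^ n ≠ 1 := by
    intro n hn h
    refine hq (n * 2) (by omega) ?_
    rw [pow_mul, h, one_pow]
  have hlam : ∀ k, lam q (MM b R) k = (Module.finrank K (lambdaGrade K V R k) : K) := by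
    intro k
    obtain ⟨A, h1, h2, h3, h4⟩ := exists_A hq1 (MM_braid (b := b) hR) (MM_quad (b := b) hR) k
    rw [← h1, trace_idem A h2, dim_grade b R h3 h4]
  obtain ⟨L, _, _, ⟨φ⟩, ⟨ψ⟩⟩ := exists_field K
  obtain ⟨σ, hσ⟩ := exists_sys_map (b := b) hR hq0 φ
  have hmk : PowerSeries.mk (lam (φ q) σ.R) = PowerSeries.map ψ (poincareLambda K V R) := by
    ext k
    rw [PowerSeries.coeff_mk, PowerSeries.coeff_map, poincareLambda, PowerSeries.coeff_mk, hσ, ← lam_map, hlam, map_natCast, map_natCast]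
  have hE : PowerSeries.mk (lam (φ q) σ.R) * Ys (fun i => ψ (y i)) = Xs (fun i => ψ (x i)) := by
    rw [hmk, ← map_Bx, ← map_mul, heq, map_Ax]
  have key := sym_poly (fun n hn h => hq1 n hn (φ.injective (by rw [map_pow, h, map_one]))) σ ψ x y hx hy hE
  have key' : PowerSeries.map ψ ((Ax x * Bx (fun i => (y i)⁻¹) : Polynomial ℝ) : PowerSeries ℝ) = PowerSeries.map ψ ((Ax (fun i => (x i)⁻¹) * Bx y : Polynomial ℝ) : PowerSeries ℝ) := by
    rw [Polynomial.coe_mul, Polynomial.coe_mul, map_mul, map_mul, map_Ax, map_Ax, map_Bx, map_Bx]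
    exact key
  exact Polynomial.coe_inj.1 (PowerSeries.map_injective ψ ψ.injective key')
end
end HS

/-- For a Hecke symmetry of birank `(m, n)` with `m, n ≤ 3`, the Poincaré series of
the exterior algebra has the form
`(1 + t)^ε₁ (1 + a t + t²)^ε₂ / ((1 - t)^δ₁ (1 - b t + t²)^δ₂)` with
`ε᷈ᵢ, δⱼ ∈ {0, 1}` and integers `a, b ≥ 2`. -/
theorem poincare_series_lambda_low_birank_classification
    (K : Type) [Field K] [CharZero K]
    (V : Type) [AddCommGroup V] [Module K V] [FiniteDimensional K V]
    (q : K) (hq0 : q ≠ 0) (hq : ∀ n : ℕ, 1 < n → q ^ n ≠ 1)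
    (R : V ⊗[K] V →ₗ[K] V ⊗[K] V) (hR : IsHeckeSymmetry K V q R)
    (m n : ℕ) (x : Fin m → ℝ) (y : Fin n → ℝ)
    (hx : ∀ i, 0 < x i) (hy : ∀ j, 0 < y j)
    (heq : poincareLambda K V R *
        ((∏ j : Fin n, (1 - Polynomial.C (y j) * Polynomial.X) : Polynomial ℝ) :
          PowerSeries ℝ) =
      ((∏ i : Fin m, (1 + Polynomial.C (x i) * Polynomial.X) : Polynomial ℝ) :
        PowerSeries ℝ))
    (hm : m ≤ 3) (hn : n ≤ 3) :
    ∃ (ε₁ ε₂ δ₁ δ₂ : ℕ), ε₁ ≤ 1 ∧ ε₂ ≤ 1 ∧ δ₁ ≤ 1 ∧ δ₂ ≤ 1 ∧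
      ∃ (a b : ℤ), 2 ≤ a ∧ 2 ≤ b ∧
        poincareLambda K V R *
            (((1 - Polynomial.X) ^ δ₁ *
              (1 - Polynomial.C (b : ℝ) * Polynomial.X + Polynomial.X ^ 2) ^ δ₂ :
                Polynomial ℝ) : PowerSeries ℝ) =
          (((1 + Polynomial.X) ^ ε₁ *
            (1 + Polynomial.C (a : ℝ) * Polynomial.X + Polynomial.X ^ 2) ^ ε₂ :
              Polynomial ℝ) : PowerSeries ℝ) := by
  refine HS.final_real (HS.IntS_mk fun k => ⟨Module.finrank K (lambdaGrade K V R k), ?_⟩) hm hn hx hy heq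
    (HS.main_symAB K V q hq0 hq R hR x y hx hy heq)
  rw [poincareLambda, PowerSeries.coeff_mk]; simp

end
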